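/- Let d ≥ 1, p > 1, p' = p/(p−1), c, r > 0, and assume: (1) Ω ⊆ ℝ^d is convex and bounded, η: ℝ^d → [0,1] is C² with η(x) = 1 when d(x,Ω^c) ≤ r, η(x) = 0 when d(x,Ω^c) ≥ 2r, ||∇η||_∞ ≤ c/r and ||∇²η||_∞ ≤ c/r²; (2) μ is a measure on Ω supported on Y ⊆ cl(Ω) with 1/2 ≤ μ(Ω)/|Ω| ≤ 2, and λ := (μ(Ω)/|Ω|) χ_Ω; (3) v ∈ S(b_Ω^p, Y) is an optimizer of the dual formulation of Wb^p_Ω(μ,λ), and set u := Q_{b_Ω^p}(v) and ℓ := ( osc_Y(v) + d(Ω,Y)^p )^{1/p}. If r ≥ 4ℓ, then for every ε ∈ (0,1): W^p_Ω(μ,λ) − Wb^p_Ω(μ,λ) ≤ C [ ε Wb^p_Ω(μ,λ) + ε^{1−p} ( W^p_Ω( (∫_Ω η dμ / ∫_Ω η) η , η μ ) + diam(Ω)^p ( | (⨍_Ω η dμ)/(⨍_Ω η) − 1 |^p ∫_Ω η^p + r^{−2p} ( Wb^p_Ω(μ,λ) )^{(d+2p)/(d+p)} ) + || (∇u)^{(p'/p)}·∇η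 − ⨍_Ω (∇u)^{(p'/p)}·∇η ||^p_{H^{−1,p}(Ω)} ) ], where C depends only on c, d, p and Ω, and is invariant under dilations of Ω. -/

import Mathlib

open MeasureTheory Metric Set Filter
open scoped ENNReal NNReal Topology RealInnerProductSpace Pointwise

noncomputable section

/-- The set of couplings between two measures: Borel measures on the product whose
first marginal is `lam` and second marginal is `μ`. -/
def couplings {X : Type*} [MeasurableSpace X] (μ lam : Measure X) : Set (Measure (X × X)) :=
  {π | π.map Prod.fst = lam ∧ π.map Prod.snd = μ}

/-- Optimal transport cost for a cost function `c` (extended-real valued). -/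
def transportCostE {X : Type*} [MeasurableSpace X] (c : X → X → ℝ) (μ lam : Measure X) : ℝ≥0∞ :=
  ⨅ π ∈ couplings μ lam, ∫⁻ z, ENNReal.ofReal (c z.1 z.2) ∂π

/-- Optimal transport cost for a cost function `c` (real valued). -/
def transportCost {X : Type*} [MeasurableSpace X] (c : X → X → ℝ) (μ lam : Measure X) : ℝ :=
  (transportCostE c μ lam).toReal

/-- Wasserstein transport cost of order `p`: `W^p(μ, λ)`. -/
def W {X : Type*} [MeasurableSpace X] [PseudoMetricSpace X] (p : ℝ) (μ lam : Measure X) : ℝ :=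
  transportCost (fun x y => dist x y ^ p) μ lam

/-- The boundary pseudo-distance `b_Ω(x,y) = min{d(x,y), (d(x,Ω^c)^p + d(y,Ω^c)^p)^{1/p}}`. -/
def bdist {X : Type*} [PseudoMetricSpace X] (p : ℝ) (Ω : Set X) (x y : X) : ℝ :=
  min (dist x y) ((infDist x Ωᶜ ^ p + infDist y Ωᶜ ^ p) ^ (1 / p))

/-- Boundary transport cost `Wb^p_Ω(μ, λ)` (between the restrictions to `Ω`). -/
def Wb {X : Type*} [MeasurableSpace X] [PseudoMetricSpace X] (p : ℝ) (Ω : Set X)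
    (μ lam : Measure X) : ℝ :=
  transportCost (fun x y => bdist p Ω x y ^ p) (μ.restrict Ω) (lam.restrict Ω)

/-- The cost transform `Q_{b_Ω^p}(v)(x) = inf_{y ∈ Y} (v(y) + b_Ω(x,y)^p)`. -/
def Qb {X : Type*} [PseudoMetricSpace X] (p : ℝ) (Ω Y : Set X) (v : X → ℝ) (x : X) : ℝ :=
  ⨅ y : Y, (v ↑y + bdist p Ω x ↑y ^ p)

/-- The dual transform `Q̂_{b_Ω^p}(u)(y) = sup_{x ∈ K} (u(x) − b_Ω(x,y)^p)` (ambient set `K`). -/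
def Qbhat {X : Type*} [PseudoMetricSpace X] (p : ℝ) (Ω K : Set X) (u : X → ℝ) (y : X) : ℝ :=
  ⨆ x : K, (u ↑x - bdist p Ω ↑x y ^ p)

/-- `S(b_Ω^p, Y)`: functions on `Y` which are dual transforms of some `u`. -/
def memS {X : Type*} [PseudoMetricSpace X] (p : ℝ) (Ω K Y : Set X) (v : X → ℝ) : Prop :=
  ∃ u : X → ℝ, ∀ y ∈ Y, v y = Qbhat p Ω K u y

/-- oscillation of `v` on `Y`. -/
def oscOn {X : Type*} (Y : Set X) (v : X → ℝ) : ℝ := sSup (v '' Y) - sInf (v '' Y)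

/-- `d(A,B) = sup_{x ∈ A} inf_{y ∈ B} d(x,y)`. -/
def supInfDist {X : Type*} [PseudoMetricSpace X] (A B : Set X) : ℝ :=
  sSup ((fun x => infDist x B) '' A)

/-- `v` is an optimizer of the dual formulation of `Wb^p_Ω(μ, λ)`. -/
def IsDualOpt {X : Type*} [MeasurableSpace X] [PseudoMetricSpace X] (p : ℝ) (Ω K Y : Set X)
    (v : X → ℝ) (μ lam : Measure X) : Prop :=
  memS p Ω K Y v ∧
    (∫ x, Qb p Ω Y v x ∂lam) - (∫ y in Y, v y ∂μ) = Wb p Ω μ lam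

/-- the vector power `z^{(α)} = |z|^{α-1} z`. -/
def vpow {d : ℕ} (z : EuclideanSpace ℝ (Fin d)) (α : ℝ) : EuclideanSpace ℝ (Fin d) :=
  ‖z‖ ^ (α - 1) • z

/-- unweighted negative Sobolev norm `‖f‖_{H^{-1,p}(Ω)}`:
`sup {∫_Ω f φ : φ Lipschitz, ‖∇φ‖_{L^{p'}(Ω)} ≤ 1}` with `p' = p/(p-1)`. -/
def HnegNorm {d : ℕ} (p : ℝ) (Ω : Set (EuclideanSpace ℝ (Fin d)))
    (f : EuclideanSpace ℝ (Fin d) → ℝ) : ℝ :=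
  sSup {r : ℝ | ∃ φ : EuclideanSpace ℝ (Fin d) → ℝ, (∃ K, LipschitzWith K φ) ∧
    (∫ x in Ω, ‖gradient φ x‖ ^ (p / (p - 1))) ≤ 1 ∧ r = ∫ x in Ω, f x * φ x}

/-- The infimum of `∫ φ dλ + ∫ ψ dμ` over continuous `φ, ψ` with `h ≤ φ ⊕ ψ`. -/
def dualMajorant {X : Type*} [TopologicalSpace X] [MeasurableSpace X] (μ lam : Measure X)
    (h : C(X × X, ℝ)) : ℝ :=
  sInf {a : ℝ | ∃ φ ψ : C(X, ℝ), (∀ x y, h (x, y) ≤ φ x + ψ y) ∧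
    a = ∫ x, φ x ∂lam + ∫ y, ψ y ∂μ}

lemma dualMajorant_nonempty {X : Type*} [MetricSpace X] [CompactSpace X]
    [MeasurableSpace X] {μ lam : Measure X} (h : C(X × X, ℝ)) :
    {a : ℝ | ∃ φ ψ : C(X, ℝ), (∀ x y, h (x, y) ≤ φ x + ψ y) ∧
      a = ∫ x, φ x ∂lam + ∫ y, ψ y ∂μ}.Nonempty := by
  refine ⟨_, ContinuousMap.const X ‖h‖, 0, fun x y => ?_, rfl⟩
  have := h.norm_coe_le_norm (x, y)
  rw [Real.norm_eq_abs] at this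
  simpa using (le_abs_self _).trans this

section DualMajorant

variable {X : Type*} [MetricSpace X] [CompactSpace X] [MeasurableSpace X] [BorelSpace X]
  {μ lam : Measure X} [IsFiniteMeasure μ] [IsFiniteMeasure lam]

lemma integrable_continuousMap_of_compactSpace (ν : Measure X) [IsFiniteMeasure ν] (φ : C(X, ℝ)) :
    Integrable (fun x => φ x) ν :=
  φ.continuous.integrable_of_hasCompactSupport (HasCompactSupport.of_compactSpace _)

lemma le_integral_add_integral_of_le [Nonempty X] (hm : μ univ = lam univ) {m : ℝ}
    {φ ψ : C(X, ℝ)} (h : ∀ x y, m ≤ φ x + ψ y) :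
    m * lam.real univ ≤ ∫ x, φ x ∂lam + ∫ y, ψ y ∂μ := by
  obtain ⟨y₀, -, hy₀⟩ := isCompact_univ.exists_isMinOn univ_nonempty ψ.continuous.continuousOn
  have h1 : (m - ψ y₀) * lam.real univ ≤ ∫ x, φ x ∂lam := by
    have := integral_mono (integrable_const (m - ψ y₀))
      (integrable_continuousMap_of_compactSpace lam φ) (fun x => by have := h x y₀; simp; linarith)
    simpa [mul_comm] using this
  have h2 : ψ y₀ * lam.real univ ≤ ∫ y, ψ y ∂μ := by
    have := integral_mono (integrable_const (ψ y₀))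
      (integrable_continuousMap_of_compactSpace μ ψ) (fun y => hy₀ (mem_univ y))
    simpa [mul_comm, Measure.real, hm] using this
  linarith

lemma dualMajorant_bddBelow [Nonempty X] (hm : μ univ = lam univ) (h : C(X × X, ℝ)) :
    BddBelow {a : ℝ | ∃ φ ψ : C(X, ℝ), (∀ x y, h (x, y) ≤ φ x + ψ y) ∧
      a = ∫ x, φ x ∂lam + ∫ y, ψ y ∂μ} := by
  refine ⟨-‖h‖ * lam.real univ, ?_⟩
  rintro a ⟨φ, ψ, hφψ, rfl⟩
  refine le_integral_add_integral_of_le hm fun x y => le_trans ?_ (hφψ x y)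
  have := h.norm_coe_le_norm (x, y)
  rw [Real.norm_eq_abs] at this
  linarith [neg_abs_le (h (x, y))]

lemma dualMajorant_le [Nonempty X] (hm : μ univ = lam univ) {h : C(X × X, ℝ)} {φ ψ : C(X, ℝ)}
    (hφψ : ∀ x y, h (x, y) ≤ φ x + ψ y) :
    dualMajorant μ lam h ≤ ∫ x, φ x ∂lam + ∫ y, ψ y ∂μ :=
  csInf_le (dualMajorant_bddBelow hm h) ⟨φ, ψ, hφψ, rfl⟩

lemma dualMajorant_add_le [Nonempty X] (hm : μ univ = lam univ) (h k : C(X × X, ℝ)) :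
    dualMajorant μ lam (h + k) ≤ dualMajorant μ lam h + dualMajorant μ lam k := by
  rw [← sub_le_iff_le_add]
  refine le_csInf (dualMajorant_nonempty h) ?_
  rintro _ ⟨φ, ψ, h1, rfl⟩
  rw [sub_le_comm]
  refine le_csInf (dualMajorant_nonempty k) ?_
  rintro _ ⟨φ', ψ', h2, rfl⟩
  rw [sub_le_iff_le_add']
  refine (dualMajorant_le hm (φ := φ + φ') (ψ := ψ + ψ') fun x y => ?_).trans_eq ?_
  · have := h1 x y
    have := h2 x y
    simp only [ContinuousMap.add_apply]
    linarith
  · simp only [ContinuousMap.add_apply]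
    rw [integral_add (integrable_continuousMap_of_compactSpace _ φ)
      (integrable_continuousMap_of_compactSpace _ φ'),
      integral_add (integrable_continuousMap_of_compactSpace _ ψ)
      (integrable_continuousMap_of_compactSpace _ ψ')]
    ring

lemma dualMajorant_smul_le [Nonempty X] (hm : μ univ = lam univ) {a : ℝ} (ha : 0 < a)
    (h : C(X × X, ℝ)) : dualMajorant μ lam (a • h) ≤ a * dualMajorant μ lam h := by
  rw [← div_le_iff₀' ha]
  refine le_csInf (dualMajorant_nonempty h) ?_
  rintro _ ⟨φ, ψ, h1, rfl⟩
  rw [div_le_iff₀' ha]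
  refine (dualMajorant_le hm (φ := a • φ) (ψ := a • ψ) fun x y => ?_).trans_eq ?_
  · have := h1 x y
    simp only [ContinuousMap.smul_apply, smul_eq_mul]
    nlinarith
  · simp only [ContinuousMap.smul_apply, smul_eq_mul, integral_const_mul]
    ring

lemma dualMajorant_smul [Nonempty X] (hm : μ univ = lam univ) {a : ℝ} (ha : 0 < a)
    (h : C(X × X, ℝ)) : dualMajorant μ lam (a • h) = a * dualMajorant μ lam h := by
  refine le_antisymm (dualMajorant_smul_le hm ha h) ?_
  have := dualMajorant_smul_le hm (inv_pos.2 ha) (a • h)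
  rw [inv_smul_smul₀ ha.ne'] at this
  rwa [← div_eq_inv_mul, le_div_iff₀' ha] at this

/-- Kantorovich duality with existence of an optimal plan on a compact metric space. -/
theorem exists_optimal_coupling_of_compactSpace [Nonempty X] (hm : μ univ = lam univ)
    (c : C(X × X, ℝ)) :
    ∃ π ∈ couplings μ lam, ∀ δ > 0, ∃ φ ψ : C(X, ℝ), (∀ x y, ψ y - φ x ≤ c (x, y)) ∧
      ∫ z, c z ∂π ≤ ∫ y, ψ y ∂μ - ∫ x, φ x ∂lam + δ := by
  set N := dualMajorant μ lam with hN
  have hN0 : N 0 = 0 := by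
    have := dualMajorant_smul hm (two_pos) (0 : C(X × X, ℝ))
    rw [smul_zero] at this
    linarith
  have hf : ∀ x : (LinearPMap.mkSpanSingleton' (-c) (N (-c)) (σ := RingHom.id ℝ) (by
      intro a ha
      rcases smul_eq_zero.1 ha with h | h
      · simp [h]
      · simp [h, hN0])).domain, (LinearPMap.mkSpanSingleton' (-c) (N (-c)) (σ := RingHom.id ℝ) (by
      intro a ha
      rcases smul_eq_zero.1 ha with h | h
      · simp [h]
      · simp [h, hN0])) x ≤ N x := by
    rintro ⟨x, hx⟩
    obtain ⟨a, rfl⟩ := Submodule.mem_span_singleton.1 hx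
    rw [LinearPMap.mkSpanSingleton'_apply]
    simp only [RingHom.id_apply, smul_eq_mul]
    rcases lt_trichotomy a 0 with h | h | h
    · have h1 := dualMajorant_add_le hm (a • -c) ((-a) • -c)
      rw [← add_smul, add_neg_cancel, zero_smul, dualMajorant_smul hm (neg_pos.2 h)] at h1
      rw [← hN, hN0] at h1
      linarith
    · simp [h, hN0]
    · rw [hN, dualMajorant_smul hm h]
  obtain ⟨g, hg, hgN⟩ := exists_extension_of_le_sublinear _ N
    (fun a ha x => dualMajorant_smul hm ha x) (fun x y => dualMajorant_add_le hm x y) hf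
  have hgc : g (-c) = N (-c) := by
    exact (hg ⟨-c, Submodule.mem_span_singleton_self _⟩).trans
      (LinearPMap.mkSpanSingleton'_apply_self _ _ _ _)
  have hg0 : ∀ h : C(X × X, ℝ), (∀ z, 0 ≤ h z) → 0 ≤ g h := by
    intro h hh
    have h1 := hgN (-h)
    have h2 : N (-h) ≤ 0 := by
      have := dualMajorant_le hm (h := -h) (φ := 0) (ψ := 0) (fun x y => by simpa using hh (x, y))
      simpa using this
    rw [map_neg] at h1
    linarith
  let Λ₀ : CompactlySupportedContinuousMap (X × X) ℝ →ₗ[ℝ] ℝ :=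
    { toFun := fun f => g (f : C(X × X, ℝ))
      map_add' := fun f f' => g.map_add (f : C(X × X, ℝ)) (f' : C(X × X, ℝ))
      map_smul' := fun a f => g.map_smul a (f : C(X × X, ℝ)) }
  let Λ : CompactlySupportedContinuousMap (X × X) ℝ →ₚ[ℝ] ℝ :=
    PositiveLinearMap.mk₀ Λ₀ (fun f hf => hg0 _ (fun z => hf z))
  set π := RealRMK.rieszMeasure Λ with hπ
  have hint : ∀ h : C(X × X, ℝ), ∫ z, h z ∂π = g h := fun h =>
    RealRMK.integral_rieszMeasure Λ (CompactlySupportedContinuousMap.continuousMapEquiv h)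
  refine ⟨π, ⟨?_, ?_⟩, ?_⟩
  · refine ext_of_forall_integral_eq_of_IsFiniteMeasure fun f => ?_
    rw [integral_map (by fun_prop) (by fun_prop)]
    have e := hint (f.toContinuousMap.comp ⟨Prod.fst, continuous_fst⟩)
    have h1 := hgN (f.toContinuousMap.comp ⟨Prod.fst, continuous_fst⟩)
    have h2 := hgN (-(f.toContinuousMap.comp ⟨Prod.fst, continuous_fst⟩))
    have h3 := dualMajorant_le hm (h := f.toContinuousMap.comp ⟨Prod.fst, continuous_fst⟩)
      (φ := f.toContinuousMap) (ψ := 0) (fun x y => by simp)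
    have h4 := dualMajorant_le hm (h := -(f.toContinuousMap.comp ⟨Prod.fst, continuous_fst⟩))
      (φ := -f.toContinuousMap) (ψ := 0) (fun x y => by simp)
    rw [map_neg] at h2
    simp [integral_neg] at h3 h4
    simp at e
    simp only [e]
    apply le_antisymm <;> linarith
  · refine ext_of_forall_integral_eq_of_IsFiniteMeasure fun f => ?_
    rw [integral_map (by fun_prop) (by fun_prop)]
    have e := hint (f.toContinuousMap.comp ⟨Prod.snd, continuous_snd⟩)
    have h1 := hgN (f.toContinuousMap.comp ⟨Prod.snd, continuous_snd⟩)
    have h2 := hgN (-(f.toContinuousMap.comp ⟨Prod.snd, continuous_snd⟩))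
    have h3 := dualMajorant_le hm (h := f.toContinuousMap.comp ⟨Prod.snd, continuous_snd⟩)
      (ψ := f.toContinuousMap) (φ := 0) (fun x y => by simp)
    have h4 := dualMajorant_le hm (h := -(f.toContinuousMap.comp ⟨Prod.snd, continuous_snd⟩))
      (ψ := -f.toContinuousMap) (φ := 0) (fun x y => by simp)
    rw [map_neg] at h2
    simp [integral_neg] at h3 h4
    simp at e
    simp only [e]
    apply le_antisymm <;> linarith
  · intro δ hδ
    obtain ⟨_, ⟨φ, ψ, hφψ, rfl⟩, hlt⟩ := exists_lt_of_csInf_lt (dualMajorant_nonempty (-c))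
      (lt_add_of_pos_right (dualMajorant μ lam (-c)) hδ)
    refine ⟨φ, -ψ, fun x y => ?_, ?_⟩
    · have := hφψ x y
      simp only [ContinuousMap.neg_apply] at this ⊢
      linarith
    · rw [hint, ← neg_neg (g c), ← map_neg, hgc]
      simp only [ContinuousMap.neg_apply, integral_neg]
      rw [hN]
      linarith

end DualMajorant

section CouplingBasics

variable {X : Type*} [MeasurableSpace X] {μ lam : Measure X} {π : Measure (X × X)}

lemma isFiniteMeasure_of_mem_couplings [IsFiniteMeasure lam] (hπ : π ∈ couplings μ lam) :
    IsFiniteMeasure π := by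
  refine ⟨?_⟩
  have := congrArg (fun ν => ν univ) hπ.1
  simp only [Measure.map_apply measurable_fst MeasurableSet.univ, preimage_univ] at this
  rw [this]
  exact measure_lt_top _ _

lemma ae_fst_of_mem_couplings (hπ : π ∈ couplings μ lam) {P : X → Prop} (h : ∀ᵐ x ∂lam, P x) :
    ∀ᵐ z ∂π, P z.1 := by
  rw [← hπ.1] at h
  exact ae_of_ae_map measurable_fst.aemeasurable h

lemma ae_snd_of_mem_couplings (hπ : π ∈ couplings μ lam) {P : X → Prop} (h : ∀ᵐ x ∂μ, P x) :
    ∀ᵐ z ∂π, P z.2 := by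
  rw [← hπ.2] at h
  exact ae_of_ae_map measurable_snd.aemeasurable h

lemma integral_fst_of_mem_couplings (hπ : π ∈ couplings μ lam) {f : X → ℝ}
    (hf : AEStronglyMeasurable f lam) : ∫ z, f z.1 ∂π = ∫ x, f x ∂lam := by
  rw [← hπ.1] at hf ⊢
  rw [integral_map measurable_fst.aemeasurable hf]

lemma integral_snd_of_mem_couplings (hπ : π ∈ couplings μ lam) {f : X → ℝ}
    (hf : AEStronglyMeasurable f μ) : ∫ z, f z.2 ∂π = ∫ x, f x ∂μ := by
  rw [← hπ.2] at hf ⊢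
  rw [integral_map measurable_snd.aemeasurable hf]

lemma integrable_fst_of_mem_couplings (hπ : π ∈ couplings μ lam) {f : X → ℝ}
    (hf : Integrable f lam) : Integrable (fun z : X × X => f z.1) π := by
  rw [← hπ.1] at hf
  exact hf.comp_measurable measurable_fst

lemma integrable_snd_of_mem_couplings (hπ : π ∈ couplings μ lam) {f : X → ℝ}
    (hf : Integrable f μ) : Integrable (fun z : X × X => f z.2) π := by
  rw [← hπ.2] at hf
  exact hf.comp_measurable measurable_snd

lemma dual_le_integral (hπ : π ∈ couplings μ lam) {c : X → X → ℝ}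
    (hc : Integrable (fun z : X × X => c z.1 z.2) π) {φ ψ : X → ℝ} (hφ : Integrable φ lam)
    (hψ : Integrable ψ μ) (h : ∀ᵐ z ∂π, ψ z.2 - φ z.1 ≤ c z.1 z.2) :
    ∫ y, ψ y ∂μ - ∫ x, φ x ∂lam ≤ ∫ z, c z.1 z.2 ∂π := by
  rw [← integral_fst_of_mem_couplings hπ hφ.1, ← integral_snd_of_mem_couplings hπ hψ.1,
    ← integral_sub (integrable_snd_of_mem_couplings hπ hψ) (integrable_fst_of_mem_couplings hπ hφ)]
  exact integral_mono_ae ((integrable_snd_of_mem_couplings hπ hψ).sub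
    (integrable_fst_of_mem_couplings hπ hφ)) hc h

lemma transportCost_congr {K : Set X} (hμ : ∀ᵐ x ∂μ, x ∈ K) (hlam : ∀ᵐ x ∂lam, x ∈ K)
    {c c' : X → X → ℝ} (h : ∀ x ∈ K, ∀ y ∈ K, c x y = c' x y) :
    transportCost c μ lam = transportCost c' μ lam := by
  unfold transportCost transportCostE
  congr 1
  refine iInf_congr fun π => iInf_congr fun hπ => lintegral_congr_ae ?_
  filter_upwards [ae_fst_of_mem_couplings hπ hlam, ae_snd_of_mem_couplings hπ hμ] with z h1 h2
  rw [h _ h1 _ h2]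

lemma transportCost_nonneg (c : X → X → ℝ) (μ lam : Measure X) : 0 ≤ transportCost c μ lam :=
  ENNReal.toReal_nonneg

end CouplingBasics

lemma integrable_of_continuous_bounded {X : Type*} [TopologicalSpace X] [MeasurableSpace X]
    [OpensMeasurableSpace X] {ν : Measure X} [IsFiniteMeasure ν] {f : X → ℝ}
    (hf : Continuous f) {B : ℝ} (hB : ∀ x, |f x| ≤ B) : Integrable f ν :=
  Integrable.of_bound hf.measurable.aestronglyMeasurable B (.of_forall hB)

section Duality

variable {E : Type*} [MetricSpace E] [SecondCountableTopology E] [MeasurableSpace E] [BorelSpace E]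
  {μ lam : Measure E} [IsFiniteMeasure μ] [IsFiniteMeasure lam]

/-- Kantorovich duality with existence of an optimal plan for a bounded Lipschitz cost and
measures carried by a compact set. -/
theorem exists_optimal_coupling {K : Set E} (hK : IsCompact K) (hKn : K.Nonempty)
    (hμ : μ Kᶜ = 0) (hlam : lam Kᶜ = 0) (hm : μ univ = lam univ) {c : E → E → ℝ} {L : ℝ≥0} {M : ℝ}
    (hc1 : ∀ y, LipschitzWith L (fun x => c x y)) (hc2 : ∀ x, LipschitzWith L (c x))
    (hc0 : ∀ x y, 0 ≤ c x y) (hM : ∀ x y, c x y ≤ M) :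
    ∃ π ∈ couplings μ lam, transportCost c μ lam = ∫ z, c z.1 z.2 ∂π ∧
      ∀ δ > 0, ∃ φ ψ : E → ℝ, LipschitzWith L φ ∧ LipschitzWith L ψ ∧
      (∃ B, ∀ x, |φ x| ≤ B) ∧ (∃ B, ∀ x, |ψ x| ≤ B) ∧ (∀ x y, ψ y - φ x ≤ c x y) ∧
      ∫ z, c z.1 z.2 ∂π ≤ ∫ y, ψ y ∂μ - ∫ x, φ x ∂lam + δ := by
  have : CompactSpace K := isCompact_iff_compactSpace.1 hK
  have : Nonempty K := hKn.to_subtype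
  have hcc : Continuous (fun z : E × E => c z.1 z.2) := (LipschitzWith.uncurry hc1 hc2).continuous
  have hme : MeasurableEmbedding (Subtype.val : K → E) :=
    MeasurableEmbedding.subtype_coe hK.measurableSet
  have hmap : ∀ ν : Measure E, ν Kᶜ = 0 → (ν.comap (Subtype.val : K → E)).map Subtype.val = ν := by
    intro ν hν
    rw [hme.map_comap, Subtype.range_coe]
    exact Measure.restrict_eq_self_of_ae_mem hν
  have hfin : ∀ ν : Measure E, IsFiniteMeasure ν → ν Kᶜ = 0 →
      IsFiniteMeasure (ν.comap (Subtype.val : K → E)) := by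
    intro ν _ hν
    refine ⟨?_⟩
    rw [hme.comap_apply]
    exact measure_lt_top _ _
  have := hfin μ inferInstance hμ
  have := hfin lam inferInstance hlam
  have hmK : (μ.comap (Subtype.val : K → E)) univ = (lam.comap (Subtype.val : K → E)) univ := by
    have h1 := congrArg (fun ν => ν univ) (hmap μ hμ)
    have h2 := congrArg (fun ν => ν univ) (hmap lam hlam)
    simp only [Measure.map_apply measurable_subtype_coe MeasurableSet.univ, preimage_univ] at h1 h2
    rw [h1, h2, hm]
  obtain ⟨π', ⟨hπ1, hπ2⟩, hπ'⟩ := exists_optimal_coupling_of_compactSpace hmK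
    ⟨fun z : K × K => c z.1 z.2, by fun_prop⟩
  have hval : Measurable (Prod.map (Subtype.val : K → E) (Subtype.val : K → E)) := by fun_prop
  have hπc : π'.map (Prod.map Subtype.val Subtype.val) ∈ couplings μ lam := by
    constructor
    · rw [Measure.map_map measurable_fst hval, ← hmap lam hlam, ← hπ1,
        Measure.map_map measurable_subtype_coe measurable_fst]
      rfl
    · rw [Measure.map_map measurable_snd hval, ← hmap μ hμ, ← hπ2,
        Measure.map_map measurable_subtype_coe measurable_snd]
      rfl
  have hcint : ∀ π ∈ couplings μ lam, Integrable (fun z : E × E => c z.1 z.2) π := by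
    intro π hπ
    have := isFiniteMeasure_of_mem_couplings hπ
    refine integrable_of_continuous_bounded hcc (B := M) fun z => ?_
    rw [abs_of_nonneg (hc0 _ _)]
    exact hM _ _
  have hdual : ∀ δ > 0, ∃ φ ψ : E → ℝ, LipschitzWith L φ ∧ LipschitzWith L ψ ∧
      (∃ B, ∀ x, |φ x| ≤ B) ∧ (∃ B, ∀ x, |ψ x| ≤ B) ∧ (∀ x y, ψ y - φ x ≤ c x y) ∧
      ∫ z, c z.1 z.2 ∂(π'.map (Prod.map Subtype.val Subtype.val)) ≤
        ∫ y, ψ y ∂μ - ∫ x, φ x ∂lam + δ := by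
    intro δ hδ
    obtain ⟨φ₀, ψ₀, h1, h2⟩ := hπ' δ hδ
    simp only [ContinuousMap.coe_mk] at h1 h2
    have hψb : ∀ y, |ψ₀ y| ≤ ‖ψ₀‖ := fun y => ψ₀.norm_coe_le_norm y
    have hbdd : ∀ x : E, BddAbove (range fun y : K => ψ₀ y - c x y) := by
      intro x
      refine ⟨‖ψ₀‖, ?_⟩
      rintro _ ⟨y, rfl⟩
      simp only
      linarith [le_abs_self (ψ₀ y), hψb y, hc0 x y]
    let φ : E → ℝ := fun x => ⨆ y : K, (ψ₀ y - c x y)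
    have hφle : ∀ x, φ x ≤ ‖ψ₀‖ := fun x => ciSup_le fun y => by
      linarith [le_abs_self (ψ₀ y), hψb y, hc0 x y]
    have hφge : ∀ x, -‖ψ₀‖ - M ≤ φ x := fun x =>
      le_ciSup_of_le (hbdd x) (Classical.arbitrary K) (by
        linarith [neg_abs_le (ψ₀ (Classical.arbitrary K)), hψb (Classical.arbitrary K),
          hM x (Classical.arbitrary K : K)])
    have hφb : ∀ x, |φ x| ≤ ‖ψ₀‖ + M := fun x => by
      rw [abs_le]
      constructor
      · linarith [hφge x]
      · linarith [hφle x, hc0 x x, hM x x]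
    have hφL : LipschitzWith L φ := by
      refine LipschitzWith.of_le_add_mul L fun x x' => ciSup_le fun y => ?_
      have := (hc1 y).le_add_mul x' x
      have h3 := le_ciSup (hbdd x') y
      rw [dist_comm] at this
      simp only [φ]
      linarith
    have hbdd' : ∀ y : E, BddBelow (range fun x : E => φ x + c x y) := by
      intro y
      refine ⟨-‖ψ₀‖ - M, ?_⟩
      rintro _ ⟨x, rfl⟩
      simp only
      linarith [hφge x, hc0 x y]
    obtain ⟨x₀, hx₀⟩ := hKn
    have : Nonempty E := ⟨x₀⟩
    let ψ : E → ℝ := fun y => ⨅ x : E, (φ x + c x y)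
    have hψL : LipschitzWith L ψ := by
      refine LipschitzWith.of_le_add_mul L fun y y' => ?_
      rw [← sub_le_iff_le_add]
      refine le_ciInf fun x => ?_
      have := (hc2 x).le_add_mul y y'
      have h3 := ciInf_le (hbdd' y) x
      simp only [ψ]
      linarith
    have hψb : ∀ y, |ψ y| ≤ ‖ψ₀‖ + M + M := fun y => by
      rw [abs_le]
      constructor
      · refine le_ciInf fun x => ?_
        linarith [hφge x, hc0 x y, hM x y]
      · refine ciInf_le_of_le (hbdd' y) x₀ ?_
        linarith [hφle x₀, hM x₀ y, hc0 x₀ y]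
    refine ⟨φ, ψ, hφL, hψL, ⟨_, hφb⟩, ⟨_, hψb⟩, fun x y => ?_, ?_⟩
    · have := ciInf_le (hbdd' y) x
      simp only [ψ]
      linarith
    · rw [integral_map hval.aemeasurable hcc.measurable.aestronglyMeasurable]
      refine h2.trans ?_
      have e1 : ∫ y, ψ y ∂μ = ∫ y : K, ψ y ∂(μ.comap (Subtype.val : K → E)) := by
        conv_lhs => rw [← hmap μ hμ]
        rw [hme.integral_map]
      have e2 : ∫ x, φ x ∂lam = ∫ x : K, φ x ∂(lam.comap (Subtype.val : K → E)) := by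
        conv_lhs => rw [← hmap lam hlam]
        rw [hme.integral_map]
      rw [e1, e2]
      have h3 : ∫ y, ψ₀ y ∂(μ.comap (Subtype.val : K → E)) ≤
          ∫ y : K, ψ y ∂(μ.comap (Subtype.val : K → E)) := by
        refine integral_mono (integrable_continuousMap_of_compactSpace _ ψ₀)
          (integrable_of_continuous_bounded (hψL.continuous.comp continuous_subtype_val)
            (B := ‖ψ₀‖ + M + M) fun y => hψb y) fun y => ?_
        refine le_ciInf fun x => ?_
        have := le_ciSup (hbdd x) y
        simp only [φ]
        linarith
      have h4 : ∫ x : K, φ x ∂(lam.comap (Subtype.val : K → E)) ≤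
          ∫ x, φ₀ x ∂(lam.comap (Subtype.val : K → E)) := by
        refine integral_mono (integrable_of_continuous_bounded
          (hφL.continuous.comp continuous_subtype_val) (B := ‖ψ₀‖ + M) fun y => hφb y)
          (integrable_continuousMap_of_compactSpace _ φ₀) fun x => ?_
        refine ciSup_le fun y => ?_
        linarith [h1 x y]
      linarith
  refine ⟨_, hπc, ?_, hdual⟩
  have hlint : ∀ π ∈ couplings μ lam, ∫⁻ z, ENNReal.ofReal (c z.1 z.2) ∂π =
      ENNReal.ofReal (∫ z, c z.1 z.2 ∂π) := fun π hπ =>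
    (ofReal_integral_eq_lintegral_ofReal (hcint π hπ) (.of_forall fun z => hc0 _ _)).symm
  have hE : transportCostE c μ lam =
      ENNReal.ofReal (∫ z, c z.1 z.2 ∂(π'.map (Prod.map Subtype.val Subtype.val))) := by
    refine le_antisymm ((iInf₂_le _ hπc).trans_eq (hlint _ hπc)) (le_iInf₂ fun π hπ => ?_)
    rw [hlint π hπ]
    refine ENNReal.ofReal_le_ofReal (le_of_forall_pos_le_add fun δ hδ => ?_)
    obtain ⟨φ, ψ, hφ, hψ, ⟨B, hB⟩, ⟨B', hB'⟩, hle, h⟩ := hdual δ hδ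
    have := dual_le_integral hπ (hcint π hπ) (integrable_of_continuous_bounded hφ.continuous hB)
      (integrable_of_continuous_bounded hψ.continuous hB') (.of_forall fun z => hle _ _)
    linarith
  rw [transportCost, hE, ENNReal.toReal_ofReal (integral_nonneg fun z => hc0 _ _)]

end Duality

section VPow

variable {d : ℕ}

lemma norm_vpow (z : EuclideanSpace ℝ (Fin d)) {α : ℝ} (hα : 0 < α) : ‖vpow z α‖ = ‖z‖ ^ α := by
  rcases eq_or_ne z 0 with rfl | hz
  · simp [vpow, Real.zero_rpow hα.ne']
  · have : 0 < ‖z‖ := norm_pos_iff.2 hz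
    rw [vpow, norm_smul, Real.norm_of_nonneg (by positivity)]
    nth_rewrite 2 [← Real.rpow_one ‖z‖]
    rw [← Real.rpow_add this, sub_add_cancel]

lemma inner_vpow_self (z : EuclideanSpace ℝ (Fin d)) {α : ℝ} (hα : 0 < α) :
    ⟪z, vpow z α⟫ = ‖z‖ ^ (α + 1) := by
  rcases eq_or_ne z 0 with rfl | hz
  · simp [vpow, Real.zero_rpow (by linarith : α + 1 ≠ 0)]
  · have : 0 < ‖z‖ := norm_pos_iff.2 hz
    rw [vpow, inner_smul_right, real_inner_self_eq_norm_sq, ← Real.rpow_natCast,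
      ← Real.rpow_add this]
    congr 1
    push_cast
    ring

lemma measurable_vpow {α : ℝ} :
    Measurable (fun z : EuclideanSpace ℝ (Fin d) => vpow z α) := by
  unfold vpow
  exact (measurable_norm.pow_const _).smul measurable_id

end VPow

section HopfLax

/-- The Hopf–Lax semigroup `Q_t φ(x) = inf_v (φ(x - t v) + t |v|^p)`. -/
def hopfLax {E : Type*} [NormedAddCommGroup E] [NormedSpace ℝ E] (p t : ℝ) (φ : E → ℝ) (x : E) :
    ℝ :=
  ⨅ v : E, (φ (x - t • v) + t * ‖v‖ ^ p)

variable {E : Type*} [NormedAddCommGroup E] [NormedSpace ℝ E] {p t h B : ℝ} {φ : E → ℝ}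

lemma hopfLax_bddBelow (ht : 0 ≤ t) (hB : ∀ x, |φ x| ≤ B) (x : E) :
    BddBelow (range fun v : E => φ (x - t • v) + t * ‖v‖ ^ p) := by
  refine ⟨-B, ?_⟩
  rintro _ ⟨v, rfl⟩
  have h1 : 0 ≤ t * ‖v‖ ^ p := by positivity
  have := (abs_le.1 (hB (x - t • v))).1
  simp only
  linarith

lemma hopfLax_zero : hopfLax p 0 φ = φ := by
  ext x
  simp [hopfLax]

lemma hopfLax_le (hp : 1 < p) (ht : 0 ≤ t) (hB : ∀ x, |φ x| ≤ B) (x : E) :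
    hopfLax p t φ x ≤ φ x := by
  refine ciInf_le_of_le (hopfLax_bddBelow ht hB x) 0 ?_
  simp [Real.zero_rpow (by linarith : p ≠ 0)]

lemma abs_hopfLax_le (hp : 1 < p) (ht : 0 ≤ t) (hB : ∀ x, |φ x| ≤ B) (x : E) :
    |hopfLax p t φ x| ≤ B := by
  rw [abs_le]
  constructor
  · refine le_ciInf fun v => ?_
    have h1 : 0 ≤ t * ‖v‖ ^ p := by positivity
    have := (abs_le.1 (hB (x - t • v))).1
    linarith
  · exact (hopfLax_le hp ht hB x).trans (abs_le.1 (hB x)).2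

lemma lipschitzWith_hopfLax (ht : 0 ≤ t) (hB : ∀ x, |φ x| ≤ B) {L : ℝ≥0}
    (hL : LipschitzWith L φ) : LipschitzWith L (hopfLax p t φ) := by
  refine LipschitzWith.of_le_add_mul L fun x y => ?_
  rw [← sub_le_iff_le_add]
  refine le_ciInf fun v => ?_
  have h1 := ciInf_le (hopfLax_bddBelow (p := p) ht hB x) v
  have h2 := hL.le_add_mul (x - t • v) (y - t • v)
  rw [dist_sub_right] at h2
  unfold hopfLax
  linarith

lemma hopfLax_add_le (hp : 1 < p) (ht : 0 ≤ t) (hh : 0 < h) (hB : ∀ x, |φ x| ≤ B) (x v : E) :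
    hopfLax p (t + h) φ x ≤ hopfLax p t φ (x - h • v) + h * ‖v‖ ^ p := by
  rw [← sub_le_iff_le_add]
  refine le_ciInf fun w => ?_
  rw [sub_le_iff_le_add]
  have hth : 0 < t + h := by linarith
  refine ciInf_le_of_le (hopfLax_bddBelow hth.le hB x) ((t + h)⁻¹ • (t • w + h • v)) ?_
  rw [smul_inv_smul₀ hth.ne', show x - (t • w + h • v) = x - h • v - t • w by abel, add_assoc]
  gcongr
  have hcv := (convexOn_rpow hp.le).2 (mem_Ici.2 (norm_nonneg w)) (mem_Ici.2 (norm_nonneg v))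
    (show 0 ≤ t / (t + h) by positivity) (show 0 ≤ h / (t + h) by positivity) (by field_simp)
  simp only [smul_eq_mul] at hcv
  have hn : ‖(t + h)⁻¹ • (t • w + h • v)‖ ≤ t / (t + h) * ‖w‖ + h / (t + h) * ‖v‖ := by
    rw [norm_smul, Real.norm_of_nonneg (by positivity)]
    have := norm_add_le (t • w) (h • v)
    rw [norm_smul, norm_smul, Real.norm_of_nonneg ht, Real.norm_of_nonneg hh.le] at this
    calc (t + h)⁻¹ * ‖t • w + h • v‖ ≤ (t + h)⁻¹ * (t * ‖w‖ + h * ‖v‖) := by gcongr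
      _ = _ := by field_simp
  calc (t + h) * ‖(t + h)⁻¹ • (t • w + h • v)‖ ^ p
      ≤ (t + h) * (t / (t + h) * ‖w‖ ^ p + h / (t + h) * ‖v‖ ^ p) := by
        gcongr
        exact (Real.rpow_le_rpow (norm_nonneg _) hn (by linarith)).trans hcv
    _ = _ := by field_simp

lemma mul_sub_rpow_le (hp : 1 < p) {L b : ℝ} (hL : 0 ≤ L) (hb : 0 ≤ b) :
    L * b - b ^ p ≤ L * L ^ (1 / (p - 1)) := by
  have hp1 : 0 < p - 1 := by linarith
  rcases le_or_gt b (L ^ (1 / (p - 1))) with h | h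
  · have : 0 ≤ b ^ p := by positivity
    nlinarith
  · have hb' : 0 < b := lt_of_le_of_lt (by positivity) h
    have h1 : L ≤ b ^ (p - 1) := by
      have := Real.rpow_le_rpow (by positivity) h.le hp1.le
      rwa [← Real.rpow_mul hL, one_div_mul_cancel hp1.ne', Real.rpow_one] at this
    have h2 : b ^ p = b ^ (p - 1) * b := by
      nth_rewrite 3 [← Real.rpow_one b]
      rw [← Real.rpow_add hb', sub_add_cancel]
    have h3 : 0 ≤ L * L ^ (1 / (p - 1)) := by positivity
    nlinarith

lemma le_hopfLax_add (hp : 1 < p) (ht : 0 ≤ t) (hh : 0 ≤ h) (hB : ∀ x, |φ x| ≤ B) {L : ℝ≥0}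
    (hL : LipschitzWith L φ) (x : E) :
    hopfLax p t φ x - h * (L * (L : ℝ) ^ (1 / (p - 1))) ≤ hopfLax p (t + h) φ x := by
  refine le_ciInf fun v => ?_
  have h1 := ciInf_le (hopfLax_bddBelow (p := p) ht hB (x - h • v)) v
  have h2 := (lipschitzWith_hopfLax (p := p) ht hB hL).le_add_mul x (x - h • v)
  rw [dist_eq_norm, sub_sub_cancel, norm_smul, Real.norm_of_nonneg hh] at h2
  have h3 := mul_sub_rpow_le hp L.2 (norm_nonneg v)
  rw [show x - (t + h) • v = x - h • v - t • v by rw [add_smul]; abel]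
  unfold hopfLax at h2 ⊢
  have h4 := mul_le_mul_of_nonneg_left h3 hh
  simp only [NNReal.val_eq_coe] at h4
  nlinarith

lemma hopfLax_one_add_le (hp : 1 < p) (ht : 0 ≤ t) (hB : ∀ x, |φ x| ≤ B) (x y : E) :
    hopfLax p (t + 1) φ y - hopfLax p t φ x ≤ ‖y - x‖ ^ p := by
  have := hopfLax_add_le hp ht one_pos hB y (y - x)
  simp only [one_smul, sub_sub_cancel, one_mul] at this
  linarith

lemma le_hopfLax (ht : 0 < t) {ψ : E → ℝ}
    {K : Set E} (h : ∀ x, ∀ y ∈ K, ψ y - φ x ≤ ‖x - y‖ ^ p / t ^ (p - 1)) {y : E} (hy : y ∈ K) :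
    ψ y ≤ hopfLax p t φ y := by
  refine le_ciInf fun v => ?_
  have := h (y - t • v) y hy
  rw [sub_sub_cancel_left, norm_neg, norm_smul, Real.norm_of_nonneg ht.le,
    Real.mul_rpow ht.le (norm_nonneg _), Real.rpow_sub_one ht.ne'] at this
  have e : t ^ p * ‖v‖ ^ p / (t ^ p / t) = t * ‖v‖ ^ p := by
    have : 0 < t ^ p := by positivity
    field_simp
  linarith

end HopfLax

section HopfLaxTransport

lemma young_bound {p : ℝ} (hp : 1 < p) {A θ k : ℝ} (hA : 0 ≤ A) (hθ : 0 ≤ θ) (hk : 0 < k) :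
    A * θ ≤ A ^ p * k ^ (1 - p) + k * θ ^ (p / (p - 1)) := by
  have hp1 : 0 < p - 1 := by linarith
  have hpq : p.HolderConjugate (p / (p - 1)) := Real.HolderConjugate.conjExponent hp
  have hq0 : 0 < p / (p - 1) := by positivity
  have h := Real.young_inequality_of_nonneg (a := A * k ^ (-((p - 1) / p)))
    (b := k ^ ((p - 1) / p) * θ) (by positivity) (by positivity) hpq
  have e1 : A * k ^ (-((p - 1) / p)) * (k ^ ((p - 1) / p) * θ) = A * θ := by
    rw [Real.rpow_neg hk.le]
    have : 0 < k ^ ((p - 1) / p) := by positivity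
    field_simp
  have e2 : (A * k ^ (-((p - 1) / p))) ^ p = A ^ p * k ^ (1 - p) := by
    rw [Real.mul_rpow hA (by positivity), ← Real.rpow_mul hk.le]
    congr 2
    field_simp
    ring
  have e3 : (k ^ ((p - 1) / p) * θ) ^ (p / (p - 1)) = k * θ ^ (p / (p - 1)) := by
    rw [Real.mul_rpow (by positivity) hθ, ← Real.rpow_mul hk.le]
    congr 1
    rw [show (p - 1) / p * (p / (p - 1)) = 1 by field_simp, Real.rpow_one]
  rw [e1, e2, e3] at h
  refine h.trans (add_le_add ?_ ?_)
  · exact div_le_self (by positivity) hp.le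
  · exact div_le_self (by positivity) (by rw [le_div_iff₀ hp1]; linarith)

variable {d : ℕ}

lemma norm_gradient_le {w : EuclideanSpace ℝ (Fin d) → ℝ} {L : ℝ≥0} (hw : LipschitzWith L w)
    (x : EuclideanSpace ℝ (Fin d)) : ‖gradient w x‖ ≤ L := by
  rw [gradient, LinearIsometryEquiv.norm_map]
  exact norm_fderiv_le_of_lipschitz ℝ hw

lemma measurable_gradient (w : EuclideanSpace ℝ (Fin d) → ℝ) : Measurable (gradient w) :=
  (InnerProductSpace.toDual ℝ (EuclideanSpace ℝ (Fin d))).symm.continuous.measurable.comp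
    (measurable_fderiv ℝ w)

lemma fderiv_eq_inner_gradient {w : EuclideanSpace ℝ (Fin d) → ℝ} (x v) :
    fderiv ℝ w x v = ⟪gradient w x, v⟫ := by
  rw [← toDual_gradient, InnerProductSpace.toDual_apply_apply]

lemma tendsto_slope_of_differentiableAt {w : EuclideanSpace ℝ (Fin d) → ℝ}
    {x : EuclideanSpace ℝ (Fin d)} (hw : DifferentiableAt ℝ w x) (v : EuclideanSpace ℝ (Fin d)) :
    Tendsto (fun h : ℝ => h⁻¹ * (w (x - h • v) - w x)) (𝓝[>] 0) (𝓝 (-⟪gradient w x, v⟫)) := by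
  have h1 : HasDerivAt (fun h : ℝ => x - h • v) (-v) 0 := by
    simpa using ((hasDerivAt_id (0 : ℝ)).smul_const v).const_sub x
  have h2 : HasDerivAt (fun h : ℝ => w (x - h • v)) (fderiv ℝ w x (-v)) 0 := by
    have : HasFDerivAt w (fderiv ℝ w x) (x - (0 : ℝ) • v) := by simpa using hw.hasFDerivAt
    exact this.comp_hasDerivAt 0 h1
  have := h2.tendsto_slope_zero_right
  rw [map_neg, fderiv_eq_inner_gradient] at this
  simpa using this

lemma half_sub_half_rpow_pos {p : ℝ} (hp : 1 < p) : 0 < 1 / 2 - (1 / 2 : ℝ) ^ p := by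
  have := Real.rpow_lt_rpow_of_exponent_gt (x := 1 / 2) (by norm_num) (by norm_num) hp
  rw [Real.rpow_one] at this
  linarith

/-- The velocity field used in the Hopf–Lax estimate. -/
lemma tendsto_integral_slope {p : ℝ} (hp : 1 < p) {ν : Measure (EuclideanSpace ℝ (Fin d))}
    [IsFiniteMeasure ν] (hν : ν ≪ volume) {w : EuclideanSpace ℝ (Fin d) → ℝ} {L : ℝ≥0}
    (hw : LipschitzWith L w) :
    Tendsto (fun h : ℝ => ∫ x, (h⁻¹ *
        (w (x - h • (1 / 2 : ℝ) • vpow (gradient w x) (1 / (p - 1))) - w x) +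
        ‖(1 / 2 : ℝ) • vpow (gradient w x) (1 / (p - 1))‖ ^ p) ∂ν) (𝓝[>] 0)
      (𝓝 (-((1 / 2 - (1 / 2 : ℝ) ^ p) * ∫ x, ‖gradient w x‖ ^ (p / (p - 1)) ∂ν))) := by
  have hp1 : 0 < p - 1 := by linarith
  set V : EuclideanSpace ℝ (Fin d) → EuclideanSpace ℝ (Fin d) :=
    fun x => (1 / 2 : ℝ) • vpow (gradient w x) (1 / (p - 1)) with hV
  have hVm : Measurable V :=
    (measurable_vpow.comp (measurable_gradient w)).const_smul (1 / 2 : ℝ)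
  have hVn : ∀ x, ‖V x‖ = 1 / 2 * ‖gradient w x‖ ^ (1 / (p - 1)) := fun x => by
    simp only [hV]
    rw [norm_smul, norm_vpow _ (by positivity)]
    norm_num
  have hVb : ∀ x, ‖V x‖ ≤ 1 / 2 * (L : ℝ) ^ (1 / (p - 1)) := fun x => by
    rw [hVn]
    gcongr
    exact norm_gradient_le hw x
  have hVp : ∀ x, ‖V x‖ ^ p = (1 / 2 : ℝ) ^ p * ‖gradient w x‖ ^ (p / (p - 1)) := fun x => by
    rw [hVn, Real.mul_rpow (by norm_num) (by positivity), ← Real.rpow_mul (norm_nonneg _)]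
    congr 2
    field_simp
  have hVi : ∀ x, ⟪gradient w x, V x⟫ = 1 / 2 * ‖gradient w x‖ ^ (p / (p - 1)) := fun x => by
    simp only [hV]
    rw [inner_smul_right, inner_vpow_self _ (by positivity)]
    congr 2
    field_simp
    ring
  rw [← integral_const_mul, ← integral_neg]
  refine tendsto_integral_filter_of_dominated_convergence
    (fun _ => L * (1 / 2 * (L : ℝ) ^ (1 / (p - 1))) + (1 / 2 * (L : ℝ) ^ (1 / (p - 1))) ^ p)
    (.of_forall fun h => ?_) ?_ (integrable_const _) ?_
  · refine Measurable.aestronglyMeasurable ?_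
    have h1 : Measurable fun x => w (x - h • V x) :=
      hw.continuous.measurable.comp (measurable_id.sub (hVm.const_smul h))
    exact ((h1.sub hw.continuous.measurable).const_mul _).add (hVm.norm.pow_const _)
  · filter_upwards [self_mem_nhdsWithin] with h hh
    refine .of_forall fun x => ?_
    have hh : 0 < h := hh
    refine (norm_add_le _ _).trans (add_le_add ?_ ?_)
    · rw [norm_mul, norm_inv, Real.norm_of_nonneg hh.le, inv_mul_le_iff₀ hh, ← dist_eq_norm]
      refine (hw.dist_le_mul _ _).trans ?_
      rw [dist_eq_norm, sub_sub_cancel_left, norm_neg, norm_smul, Real.norm_of_nonneg hh.le]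
      have := mul_le_mul_of_nonneg_left (hVb x) (mul_nonneg L.2 hh.le)
      simp only [NNReal.val_eq_coe] at this
      linarith
    · rw [Real.norm_of_nonneg (by positivity)]
      exact Real.rpow_le_rpow (norm_nonneg _) (hVb x) (by linarith)
  · filter_upwards [hν.ae_le hw.ae_differentiableAt] with x hx
    have h1 := (tendsto_slope_of_differentiableAt hx (V x)).add_const (‖V x‖ ^ p)
    convert h1 using 2
    rw [hVi, hVp]
    ring

end HopfLaxTransport

section HopfLaxIntegral

variable {d : ℕ} {p B : ℝ} {φ : EuclideanSpace ℝ (Fin d) → ℝ} {L : ℝ≥0}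

lemma integrable_hopfLax (hp : 1 < p) {t : ℝ} (ht : 0 ≤ t) (hB : ∀ x, |φ x| ≤ B)
    (hL : LipschitzWith L φ) (f : Measure (EuclideanSpace ℝ (Fin d))) [IsFiniteMeasure f] :
    Integrable (hopfLax p t φ) f :=
  integrable_of_continuous_bounded (lipschitzWith_hopfLax ht hB hL).continuous
    (abs_hopfLax_le hp ht hB)

lemma hopfLax_antitone (hp : 1 < p) {s t : ℝ} (hs : 0 ≤ s) (hst : s ≤ t) (hB : ∀ x, |φ x| ≤ B)
    (x : EuclideanSpace ℝ (Fin d)) : hopfLax p t φ x ≤ hopfLax p s φ x := by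
  rcases hst.eq_or_lt with rfl | h
  · rfl
  · have := hopfLax_add_le hp hs (sub_pos.2 h) hB x 0
    simpa [Real.zero_rpow (by linarith : p ≠ 0)] using this

lemma continuousOn_integral_hopfLax (hp : 1 < p) (hB : ∀ x, |φ x| ≤ B)
    (hL : LipschitzWith L φ) (f : Measure (EuclideanSpace ℝ (Fin d))) [IsFiniteMeasure f] :
    ContinuousOn (fun t => ∫ x, hopfLax p t φ x ∂f) (Ici 0) := by
  set M : ℝ := (L * (L : ℝ) ^ (1 / (p - 1))) * f.real univ with hM
  have key : ∀ s t : ℝ, 0 ≤ s → s ≤ t →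
      dist (∫ x, hopfLax p s φ x ∂f) (∫ x, hopfLax p t φ x ∂f) ≤ M * (t - s) := by
    intro s t hs hst
    have hi := integrable_hopfLax hp hs hB hL f
    have hi' := integrable_hopfLax hp (hs.trans hst) hB hL f
    rw [Real.dist_eq, abs_of_nonneg (sub_nonneg.2 (integral_mono hi' hi
      fun x => hopfLax_antitone hp hs hst hB x)), ← integral_sub hi hi']
    calc ∫ x, (hopfLax p s φ x - hopfLax p t φ x) ∂f
        ≤ ∫ _, (t - s) * (L * (L : ℝ) ^ (1 / (p - 1))) ∂f := by
          refine integral_mono (hi.sub hi') (integrable_const _) fun x => ?_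
          have := le_hopfLax_add hp hs (sub_nonneg.2 hst) hB hL x
          rw [add_sub_cancel] at this
          simp only
          linarith
      _ = M * (t - s) := by rw [integral_const, hM, smul_eq_mul]; ring
  have hM0 : 0 ≤ M := by positivity
  refine (LipschitzOnWith.of_dist_le_mul (K := ⟨M, hM0⟩) fun s hs t ht => ?_).continuousOn
  rcases le_total s t with h | h
  · rw [Real.dist_eq s t, abs_sub_comm, abs_of_nonneg (sub_nonneg.2 h)]
    exact key s t hs h
  · rw [dist_comm, Real.dist_eq s t, abs_of_nonneg (sub_nonneg.2 h)]
    exact key t s ht h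

/-- If `g - f` has small negative Sobolev norm relative to a measure dominated by `f`, then
the Hopf–Lax evolution bounds the dual transport functional between `g` and `f`. -/
lemma integral_hopfLax_sub_le (hp : 1 < p) {ν f g : Measure (EuclideanSpace ℝ (Fin d))}
    [IsFiniteMeasure ν] [IsFiniteMeasure f] [IsFiniteMeasure g] (hν : ν ≪ volume) {a A : ℝ}
    (ha : 0 < a) (hA0 : 0 ≤ A) (hf : ENNReal.ofReal a • ν ≤ f)
    (hA : ∀ w : EuclideanSpace ℝ (Fin d) → ℝ, ∀ K, LipschitzWith K w → (∀ x, |w x| ≤ B) →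
      ∫ x, w x ∂g - ∫ x, w x ∂f ≤ A * (∫ x, ‖gradient w x‖ ^ (p / (p - 1)) ∂ν) ^ ((p - 1) / p))
    (hB : ∀ x, |φ x| ≤ B) (hL : LipschitzWith L φ) :
    ∫ x, hopfLax p 1 φ x ∂g - ∫ x, φ x ∂f ≤
      (p * A) ^ p * (a * (1 / 2 - (1 / 2 : ℝ) ^ p)) ^ (1 - p) := by
  have hp1 : 0 < p - 1 := by linarith
  have hp0 : 0 < p := by linarith
  set c₀ : ℝ := 1 / 2 - (1 / 2 : ℝ) ^ p with hc₀
  have hc : 0 < c₀ := half_sub_half_rpow_pos hp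
  set R : ℝ := (p * A) ^ p * (a * c₀) ^ (1 - p) with hR
  set F : ℝ → ℝ := fun t => ∫ x, hopfLax p t φ x ∂f with hF
  set G : ℝ → ℝ := fun t => ∫ x, hopfLax p t φ x ∂g with hG
  have hFc : ContinuousOn F (Ici 0) := continuousOn_integral_hopfLax hp hB hL f
  have hGc : ContinuousOn G (Ici 0) := continuousOn_integral_hopfLax hp hB hL g
  set I : ℝ → ℝ := fun t => (1 - t) ^ p * F t + (1 - (1 - t) ^ p) * G t with hI
  have hpc : Continuous fun t : ℝ => (1 - t) ^ p :=
    (continuous_const.sub continuous_id).rpow_const fun _ => Or.inr hp0.le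
  have hIc : ContinuousOn I (Icc 0 1) := by
    have hsub : Icc (0 : ℝ) 1 ⊆ Ici 0 := Icc_subset_Ici_self
    exact (hpc.continuousOn.mul (hFc.mono hsub)).add
      ((continuous_const.sub hpc).continuousOn.mul (hGc.mono hsub))
  have hbound : ∀ t ∈ Ico (0 : ℝ) 1, ∀ r, R < r → ∃ᶠ z in 𝓝[>] t, slope I t z < r := by
    rintro t ⟨ht0, ht1⟩ r hr
    refine Eventually.frequently ?_
    set w := hopfLax p t φ with hw
    have hwL : LipschitzWith L w := lipschitzWith_hopfLax ht0 hB hL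
    set V : EuclideanSpace ℝ (Fin d) → EuclideanSpace ℝ (Fin d) :=
      fun x => (1 / 2 : ℝ) • vpow (gradient w x) (1 / (p - 1)) with hV
    set S : ℝ → ℝ := fun h => ∫ x, (h⁻¹ * (w (x - h • V x) - w x) + ‖V x‖ ^ p) ∂ν with hS
    set Q : ℝ := ∫ x, ‖gradient w x‖ ^ (p / (p - 1)) ∂ν with hQ
    have hQ0 : 0 ≤ Q := integral_nonneg fun x => by positivity
    have hSt : Tendsto S (𝓝[>] 0) (𝓝 (-(c₀ * Q))) := tendsto_integral_slope hp hν hwL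
    have hsub : Tendsto (fun z : ℝ => z - t) (𝓝[>] t) (𝓝[>] 0) := by
      refine tendsto_nhdsWithin_iff.2 ⟨?_, ?_⟩
      · have : Tendsto (fun z : ℝ => z - t) (𝓝 t) (𝓝 (t - t)) :=
          (continuous_id.sub continuous_const).tendsto t
        rw [sub_self] at this
        exact this.mono_left nhdsWithin_le_nhds
      · filter_upwards [self_mem_nhdsWithin] with z hz
        exact sub_pos.2 (mem_Ioi.1 hz)
    have hD : Tendsto (slope (fun t : ℝ => (1 - t) ^ p) t) (𝓝[>] t)
        (𝓝 (-(p * (1 - t) ^ (p - 1)))) := by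
      have h1 : HasDerivAt (fun t : ℝ => (1 - t) ^ p) (-1 * p * (1 - t) ^ (p - 1)) t :=
        ((hasDerivAt_id t).const_sub 1).rpow_const (Or.inr hp.le)
      have h2 := hasDerivAt_iff_tendsto_slope.1 h1
      rw [show -(p * (1 - t) ^ (p - 1)) = -1 * p * (1 - t) ^ (p - 1) by ring]
      exact h2.mono_left (nhdsWithin_mono _ fun z hz => ne_of_gt hz)
    have hFt : Tendsto F (𝓝[>] t) (𝓝 (F t)) :=
      (hFc t ht0).mono_left (nhdsWithin_mono _ fun z hz => ht0.trans (le_of_lt hz))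
    have hGt : Tendsto G (𝓝[>] t) (𝓝 (G t)) :=
      (hGc t ht0).mono_left (nhdsWithin_mono _ fun z hz => ht0.trans (le_of_lt hz))
    have hlim : Tendsto (fun z => (1 - t) ^ p * (a * S (z - t)) +
        slope (fun t : ℝ => (1 - t) ^ p) t z * (F z - G z)) (𝓝[>] t)
        (𝓝 ((1 - t) ^ p * (a * (-(c₀ * Q))) + -(p * (1 - t) ^ (p - 1)) * (F t - G t))) :=
      (((hSt.comp hsub).const_mul a).const_mul _).add (hD.mul (hFt.sub hGt))
    have hle : (1 - t) ^ p * (a * (-(c₀ * Q))) + -(p * (1 - t) ^ (p - 1)) * (F t - G t) ≤ R := by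
      have h1 : G t - F t ≤ A * Q ^ ((p - 1) / p) := hA w L hwL (abs_hopfLax_le hp ht0 hB)
      have ht1' : 0 < 1 - t := by linarith
      have h2 := young_bound hp (A := p * A) (θ := (1 - t) ^ (p - 1) * Q ^ ((p - 1) / p))
        (k := a * c₀) (by positivity) (by positivity) (by positivity)
      have h3 : ((1 - t) ^ (p - 1) * Q ^ ((p - 1) / p)) ^ (p / (p - 1)) = (1 - t) ^ p * Q := by
        rw [Real.mul_rpow (by positivity) (by positivity), ← Real.rpow_mul ht1'.le,
          ← Real.rpow_mul hQ0]
        rw [show (p - 1) * (p / (p - 1)) = p by field_simp,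
          show (p - 1) / p * (p / (p - 1)) = 1 by field_simp, Real.rpow_one]
      rw [h3] at h2
      have h4 : p * (1 - t) ^ (p - 1) * (G t - F t) ≤
          p * (1 - t) ^ (p - 1) * (A * Q ^ ((p - 1) / p)) :=
        mul_le_mul_of_nonneg_left h1 (by positivity)
      rw [hR]
      linarith
    filter_upwards [hlim.eventually_lt_const (hle.trans_lt hr), self_mem_nhdsWithin] with z hz hz'
    refine lt_of_le_of_lt ?_ hz
    have hzt : t < z := hz'
    have hh : 0 < z - t := sub_pos.2 hzt
    have hz0 : 0 ≤ z := ht0.trans hzt.le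
    have hGz : G z ≤ G t := integral_mono (integrable_hopfLax hp hz0 hB hL g)
      (integrable_hopfLax hp ht0 hB hL g) fun x => hopfLax_antitone hp ht0 hzt.le hB x
    have hiz := fun (m : Measure (EuclideanSpace ℝ (Fin d))) (_ : IsFiniteMeasure m) =>
      integrable_hopfLax hp hz0 hB hL m
    have hit := fun (m : Measure (EuclideanSpace ℝ (Fin d))) (_ : IsFiniteMeasure m) =>
      integrable_hopfLax hp ht0 hB hL m
    have hFz : F z - F t ≤ (z - t) * (a * S (z - t)) := by
      have h1 : ∫ x, (w x - hopfLax p z φ x) ∂(ENNReal.ofReal a • ν) ≤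
          ∫ x, (w x - hopfLax p z φ x) ∂f :=
        integral_mono_measure hf (.of_forall fun x =>
          sub_nonneg.2 (hopfLax_antitone hp ht0 hzt.le hB x)) ((hit f ‹_›).sub (hiz f ‹_›))
      rw [integral_smul_measure, ENNReal.toReal_ofReal ha.le, smul_eq_mul,
        integral_sub (hit f ‹_›) (hiz f ‹_›)] at h1
      have h2 : -((z - t) * S (z - t)) ≤ ∫ x, (w x - hopfLax p z φ x) ∂ν := by
        rw [← integral_const_mul, ← integral_neg]
        by_cases hSi : Integrable (fun x => -((z - t) * ((z - t)⁻¹ *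
            (w (x - (z - t) • V x) - w x) + ‖V x‖ ^ p))) ν
        · refine integral_mono hSi ((hit ν ‹_›).sub (hiz ν ‹_›)) fun x => ?_
          have h := hopfLax_add_le hp ht0 hh hB x (V x)
          rw [add_sub_cancel] at h
          have e : (z - t) * ((z - t)⁻¹ * (w (x - (z - t) • V x) - w x) + ‖V x‖ ^ p) =
              w (x - (z - t) • V x) - w x + (z - t) * ‖V x‖ ^ p := by
            field_simp
          simp only [e]
          linarith
        · rw [integral_undef hSi]
          exact integral_nonneg fun x => sub_nonneg.2 (hopfLax_antitone hp ht0 hzt.le hB x)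
      have h3 := mul_le_mul_of_nonneg_left h2 ha.le
      linarith
    have h5 : slope I t z = (1 - t) ^ p * ((F z - F t) / (z - t)) +
        (1 - (1 - t) ^ p) * ((G z - G t) / (z - t)) +
        slope (fun t : ℝ => (1 - t) ^ p) t z * (F z - G z) := by
      simp only [hI, slope_def_field]
      field_simp
      ring
    have ht1' : 0 < 1 - t := by linarith
    have h6 : (1 - t) ^ p ≤ 1 := Real.rpow_le_one ht1'.le (by linarith) hp0.le
    have h7 : (1 - (1 - t) ^ p) * ((G z - G t) / (z - t)) ≤ 0 :=
      mul_nonpos_of_nonneg_of_nonpos (by linarith)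
        (div_nonpos_of_nonpos_of_nonneg (by linarith) hh.le)
    have h8 : (F z - F t) / (z - t) ≤ a * S (z - t) := by
      rw [div_le_iff₀ hh]; linarith
    have h9 := mul_le_mul_of_nonneg_left h8 (by positivity : 0 ≤ (1 - t) ^ p)
    rw [h5]
    linarith
  have := image_le_of_liminf_slope_right_le_deriv_boundary hIc (B := fun t => F 0 + R * t)
    (B' := fun _ => R) (by simp [hI]) (by fun_prop)
    (fun x _ => by
      simpa using (((hasDerivAt_id x).const_mul R).const_add (F 0)).hasDerivWithinAt)
    hbound (right_mem_Icc.2 zero_le_one)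
  simp only [hI, sub_self, Real.zero_rpow hp0.ne', hF, hG, hopfLax_zero] at this
  linarith

end HopfLaxIntegral

section Poincare

lemma rpow_lintegral_le {α : Type*} [MeasurableSpace α] {m : Measure α} [IsProbabilityMeasure m]
    {q : ℝ} (hq : 1 ≤ q) {f : α → ℝ≥0∞} (hf : Measurable f) :
    (∫⁻ x, f x ∂m) ^ q ≤ ∫⁻ x, f x ^ q ∂m := by
  have hq0 : 0 < q := by linarith
  have := eLpNorm'_le_eLpNorm'_of_exponent_le one_pos hq m hf.aestronglyMeasurable
  simp only [eLpNorm', enorm_eq_self, ENNReal.rpow_one, div_one, one_div] at this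
  calc (∫⁻ x, f x ∂m) ^ q ≤ ((∫⁻ x, f x ^ q ∂m) ^ q⁻¹) ^ q := by gcongr
    _ = _ := by rw [← ENNReal.rpow_mul, inv_mul_cancel₀ hq0.ne', ENNReal.rpow_one]

variable {d : ℕ}

lemma lintegral_comp_add_smul (H : EuclideanSpace ℝ (Fin d) → ℝ≥0∞) (hH : Measurable H)
    (z : EuclideanSpace ℝ (Fin d)) {t : ℝ} (ht : 1 / 2 ≤ t) :
    ∫⁻ y, H (z + t • y) ≤ 2 ^ d * ∫⁻ y, H y := by
  have ht0 : 0 < t := by linarith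
  have h1 : ∫⁻ y, H (z + t • y) = ∫⁻ y, H (z + y)
      ∂(Measure.map (t • ·) (volume : Measure (EuclideanSpace ℝ (Fin d)))) := by
    rw [lintegral_map (by fun_prop) (by fun_prop)]
  rw [h1, Measure.map_addHaar_smul volume ht0.ne', lintegral_smul_measure,
    lintegral_add_left_eq_self H z, smul_eq_mul, finrank_euclideanSpace, Fintype.card_fin]
  gcongr
  have : |(t ^ d)⁻¹| ≤ 2 ^ d := by
    rw [abs_of_pos (by positivity), ← inv_pow]
    gcongr
    rw [inv_le_comm₀ ht0 (by norm_num)]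
    linarith
  calc ENNReal.ofReal |(t ^ d)⁻¹| ≤ ENNReal.ofReal (2 ^ d) := ENNReal.ofReal_le_ofReal this
    _ = 2 ^ d := by rw [ENNReal.ofReal_pow (by norm_num)]; norm_num

/-- Averaging along segments of a convex set costs at most a dimensional factor. -/
lemma lintegral_segment_le {U : Set (EuclideanSpace ℝ (Fin d))} (hU : MeasurableSet U)
    (hc : Convex ℝ U) {H : EuclideanSpace ℝ (Fin d) → ℝ≥0∞} (hH : Measurable H) :
    ∫⁻ x in U, ∫⁻ y in U, ∫⁻ t in Icc (0 : ℝ) 1, H ((1 - t) • x + t • y) ≤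
      2 ^ d * volume U * ∫⁻ x in U, H x := by
  set K := U.indicator H with hK
  have hKm : Measurable K := hH.indicator hU
  have hKint : ∫⁻ x, K x = ∫⁻ x in U, H x := lintegral_indicator hU _
  have hHK : ∀ x ∈ U, ∀ y ∈ U, ∀ t ∈ Icc (0 : ℝ) 1,
      H ((1 - t) • x + t • y) = K ((1 - t) • x + t • y) := fun x hx y hy t ht => by
    rw [hK, indicator_of_mem]
    exact hc hx hy (by linarith [ht.2]) ht.1 (by ring)
  have hm3 : Measurable fun z : (EuclideanSpace ℝ (Fin d) × EuclideanSpace ℝ (Fin d)) × ℝ =>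
      K ((1 - z.2) • z.1.1 + z.2 • z.1.2) := hKm.comp (by fun_prop)
  calc ∫⁻ x in U, ∫⁻ y in U, ∫⁻ t in Icc (0 : ℝ) 1, H ((1 - t) • x + t • y)
      = ∫⁻ x in U, ∫⁻ y in U, ∫⁻ t in Icc (0 : ℝ) 1, K ((1 - t) • x + t • y) := by
        refine setLIntegral_congr_fun hU fun x hx => setLIntegral_congr_fun hU fun y hy =>
          setLIntegral_congr_fun measurableSet_Icc fun t ht => hHK x hx y hy t ht
    _ = ∫⁻ x in U, ∫⁻ t in Icc (0 : ℝ) 1, ∫⁻ y in U, K ((1 - t) • x + t • y) := by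
        refine lintegral_congr fun x => lintegral_lintegral_swap ?_
        exact (hKm.comp (by fun_prop : Measurable fun z : EuclideanSpace ℝ (Fin d) × ℝ =>
          (1 - z.2) • x + z.2 • z.1)).aemeasurable
    _ = ∫⁻ t in Icc (0 : ℝ) 1, ∫⁻ x in U, ∫⁻ y in U, K ((1 - t) • x + t • y) := by
        refine lintegral_lintegral_swap (Measurable.aemeasurable ?_)
        have : Measurable fun z : (EuclideanSpace ℝ (Fin d) × ℝ) × EuclideanSpace ℝ (Fin d) =>
            K ((1 - z.1.2) • z.1.1 + z.1.2 • z.2) := hKm.comp (by fun_prop)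
        exact this.lintegral_prod_right'
    _ ≤ ∫⁻ _ in Icc (0 : ℝ) 1, 2 ^ d * volume U * ∫⁻ x in U, H x := by
        refine lintegral_mono fun t => ?_
        rw [← hKint]
        have hswap : ∫⁻ x in U, ∫⁻ y in U, K ((1 - t) • x + t • y) =
            ∫⁻ y in U, ∫⁻ x in U, K ((1 - t) • x + t • y) := by
          refine lintegral_lintegral_swap (Measurable.aemeasurable ?_)
          exact hKm.comp (by fun_prop)
        rcases le_total (1 / 2) t with ht | ht
        · calc ∫⁻ x in U, ∫⁻ y in U, K ((1 - t) • x + t • y)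
              ≤ ∫⁻ x in U, 2 ^ d * ∫⁻ y, K y := lintegral_mono fun x =>
                (setLIntegral_le_lintegral _ _).trans (lintegral_comp_add_smul K hKm _ ht)
            _ = _ := by rw [setLIntegral_const]; ring
        · rw [hswap]
          calc ∫⁻ y in U, ∫⁻ x in U, K ((1 - t) • x + t • y)
              ≤ ∫⁻ x in U, 2 ^ d * ∫⁻ y, K y := lintegral_mono fun y => by
                refine (setLIntegral_le_lintegral _ _).trans ?_
                simp_rw [add_comm ((1 - t) • _)]
                exact lintegral_comp_add_smul K hKm _ (by linarith)
            _ = _ := by rw [setLIntegral_const]; ring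
    _ = 2 ^ d * volume U * ∫⁻ x in U, H x := by simp

lemma enorm_sub_rpow_le {φ : EuclideanSpace ℝ (Fin d) → ℝ} {L : ℝ≥0} (hφ : LipschitzWith L φ)
    {q : ℝ} (hq : 1 ≤ q) (x y : EuclideanSpace ℝ (Fin d)) :
    ‖φ x - φ y‖ₑ ^ q ≤ ‖x - y‖ₑ ^ q * ∫⁻ t in Icc (0 : ℝ) 1,
      (‖gradient φ ((1 - t) • x + t • y)‖ₑ ^ q +
        {z | DifferentiableAt ℝ φ z}ᶜ.indicator (fun _ => ∞) ((1 - t) • x + t • y)) := by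
  have hq0 : 0 < q := by linarith
  rcases eq_or_ne x y with rfl | hxy
  · simp [hq0]
  have hne : ‖x - y‖ₑ ^ q ≠ 0 := by
    simp [ENNReal.rpow_eq_zero_iff, sub_eq_zero, hxy]
  have hDm : MeasurableSet {z | DifferentiableAt ℝ φ z} := measurableSet_of_differentiableAt ℝ φ
  have hlm : Measurable fun t : ℝ => (1 - t) • x + t • y := by fun_prop
  have hgm : Measurable fun t : ℝ => ‖gradient φ ((1 - t) • x + t • y)‖ₑ :=
    ((measurable_gradient φ).comp hlm).enorm
  have him : Measurable fun t : ℝ => {z | DifferentiableAt ℝ φ z}ᶜ.indicator (fun _ => (∞ : ℝ≥0∞))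
      ((1 - t) • x + t • y) := (measurable_const.indicator hDm.compl).comp hlm
  rw [lintegral_add_right _ him, mul_add]
  by_cases htop : ∫⁻ t in Icc (0 : ℝ) 1, {z | DifferentiableAt ℝ φ z}ᶜ.indicator
      (fun _ => (∞ : ℝ≥0∞)) ((1 - t) • x + t • y) = ∞
  · rw [htop, ENNReal.mul_top hne, add_top]
    exact le_top
  refine le_add_right ?_
  have hae : ∀ᵐ t ∂(volume.restrict (Icc (0 : ℝ) 1)),
      DifferentiableAt ℝ φ ((1 - t) • x + t • y) := by
    filter_upwards [ae_lt_top him htop] with t ht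
    by_contra h
    rw [indicator_of_mem (by exact h)] at ht
    exact lt_irrefl _ ht
  set s : ℝ → ℝ := fun t => φ ((1 - t) • x + t • y) with hs
  have hline : LipschitzWith ‖y - x‖₊ fun t : ℝ => (1 - t) • x + t • y := by
    refine LipschitzWith.of_dist_le_mul fun a b => ?_
    rw [dist_eq_norm, show (1 - a) • x + a • y - ((1 - b) • x + b • y) = (a - b) • (y - x) by
      module, norm_smul, dist_eq_norm, mul_comm]
    rfl
  have hsL : LipschitzWith (L * ‖y - x‖₊) s := hφ.comp hline
  have hftc := (hsL.lipschitzOnWith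
    (s := uIcc 0 1)).absolutelyContinuousOnInterval.integral_deriv_eq_sub
  have e0 : s 0 = φ x := by simp [hs]
  have e1 : s 1 = φ y := by simp [hs]
  rw [e0, e1, intervalIntegral.integral_of_le zero_le_one, ← integral_Icc_eq_integral_Ioc] at hftc
  have : IsProbabilityMeasure (volume.restrict (Icc (0 : ℝ) 1)) := ⟨by simp⟩
  calc ‖φ x - φ y‖ₑ ^ q = ‖φ y - φ x‖ₑ ^ q := by rw [← enorm_neg, neg_sub]
    _ ≤ (∫⁻ t in Icc (0 : ℝ) 1, ‖deriv s t‖ₑ) ^ q := by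
        rw [← hftc]
        gcongr
        exact enorm_integral_le_lintegral_enorm _
    _ ≤ ∫⁻ t in Icc (0 : ℝ) 1, ‖deriv s t‖ₑ ^ q :=
        rpow_lintegral_le hq (measurable_deriv s).enorm
    _ ≤ ∫⁻ t in Icc (0 : ℝ) 1, ‖x - y‖ₑ ^ q * ‖gradient φ ((1 - t) • x + t • y)‖ₑ ^ q := by
        refine lintegral_mono_ae (hae.mono fun t ht => ?_)
        rw [← ENNReal.mul_rpow_of_nonneg _ _ hq0.le]
        gcongr
        have h1 : HasDerivAt (fun t : ℝ => (1 - t) • x + t • y) (y - x) t := by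
          have := (((hasDerivAt_id t).const_sub 1).smul_const x).add
            ((hasDerivAt_id t).smul_const y)
          rw [show (-1 : ℝ) • x + (1 : ℝ) • y = y - x by module] at this
          exact this
        have h2 := ht.hasFDerivAt.comp_hasDerivAt t h1
        rw [show deriv s t = _ from h2.deriv, fderiv_eq_inner_gradient,
          ← ofReal_norm, ← ofReal_norm, ← ofReal_norm, ← ENNReal.ofReal_mul (norm_nonneg _)]
        refine ENNReal.ofReal_le_ofReal ?_
        rw [mul_comm, norm_sub_rev x y]
        exact norm_inner_le_norm _ _
    _ = _ := lintegral_const_mul _ (hgm.pow_const _)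

/-- A Poincaré inequality on bounded convex sets. -/
theorem poincare_of_convex {U : Set (EuclideanSpace ℝ (Fin d))} (hU : MeasurableSet U)
    (hc : Convex ℝ U) (h0 : volume U ≠ 0) (htop : volume U ≠ ∞) {D : ℝ}
    (hD : ∀ x ∈ U, ∀ y ∈ U, dist x y ≤ D) {φ : EuclideanSpace ℝ (Fin d) → ℝ} {L : ℝ≥0}
    (hφ : LipschitzWith L φ) (hφU : IntegrableOn φ U) {q : ℝ} (hq : 1 ≤ q) :
    ∫ x in U, |φ x - (volume U).toReal⁻¹ * ∫ z in U, φ z| ^ q ≤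
      2 ^ d * D ^ q * ∫ x in U, ‖gradient φ x‖ ^ q := by
  have hq0 : 0 < q := by linarith
  have hD0 : 0 ≤ D := by
    obtain ⟨x, hx⟩ := nonempty_of_measure_ne_zero h0
    simpa using hD x hx x hx
  set m := volume.restrict U with hm
  have : IsFiniteMeasure m := ⟨by rw [hm, Measure.restrict_apply_univ]; exact htop.lt_top⟩
  have hmu : m univ = volume U := Measure.restrict_apply_univ U
  set P : Measure (EuclideanSpace ℝ (Fin d)) := (volume U)⁻¹ • m with hP
  have : IsProbabilityMeasure P := ⟨by
    rw [hP, Measure.smul_apply, hmu, smul_eq_mul, ENNReal.inv_mul_cancel h0 htop]⟩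
  have hφm : Measurable φ := hφ.continuous.measurable
  have hgrad : Integrable (fun x => ‖gradient φ x‖ ^ q) m := by
    refine Integrable.of_bound (((measurable_gradient φ).norm.pow_const q).aestronglyMeasurable)
      ((L : ℝ) ^ q) (.of_forall fun x => ?_)
    rw [Real.norm_of_nonneg (by positivity)]
    exact Real.rpow_le_rpow (norm_nonneg _) (norm_gradient_le hφ x) hq0.le
  set H : EuclideanSpace ℝ (Fin d) → ℝ≥0∞ := fun z => ‖gradient φ z‖ₑ ^ q +
    {z | DifferentiableAt ℝ φ z}ᶜ.indicator (fun _ => ∞) z with hH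
  have hDm : MeasurableSet {z | DifferentiableAt ℝ φ z} := measurableSet_of_differentiableAt ℝ φ
  have hHm : Measurable H := ((measurable_gradient φ).enorm.pow_const q).add
    (measurable_const.indicator hDm.compl)
  have hHae : ∫⁻ x, H x ∂m = ENNReal.ofReal (∫ x, ‖gradient φ x‖ ^ q ∂m) := by
    rw [ofReal_integral_eq_lintegral_ofReal hgrad (.of_forall fun x => by positivity)]
    refine lintegral_congr_ae ?_
    filter_upwards [ae_restrict_of_ae hφ.ae_differentiableAt] with x hx
    simp only [hH]
    rw [indicator_of_notMem (by simpa using hx), add_zero, ← ofReal_norm,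
      ENNReal.ofReal_rpow_of_nonneg (norm_nonneg _) hq0.le]
  have hpt : ∀ x, ‖φ x - (volume U).toReal⁻¹ * ∫ z in U, φ z‖ₑ ^ q ≤
      ∫⁻ y, ‖φ x - φ y‖ₑ ^ q ∂P := fun x => by
    have hi : Integrable φ P := hφU.smul_measure (ENNReal.inv_ne_top.2 h0)
    have e : φ x - (volume U).toReal⁻¹ * ∫ z in U, φ z = ∫ y, (φ x - φ y) ∂P := by
      rw [integral_sub (integrable_const _) hi, integral_const, probReal_univ, one_smul, hP,
        integral_smul_measure, ENNReal.toReal_inv, smul_eq_mul]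
    rw [e]
    refine le_trans ?_ (rpow_lintegral_le hq (by fun_prop))
    gcongr
    exact enorm_integral_le_lintegral_enorm _
  have key : ∫⁻ x, ‖φ x - (volume U).toReal⁻¹ * ∫ z in U, φ z‖ₑ ^ q ∂m ≤
      ENNReal.ofReal (2 ^ d * D ^ q * ∫ x, ‖gradient φ x‖ ^ q ∂m) := by
    calc ∫⁻ x, ‖φ x - (volume U).toReal⁻¹ * ∫ z in U, φ z‖ₑ ^ q ∂m
        ≤ ∫⁻ x, ∫⁻ y, ‖φ x - φ y‖ₑ ^ q ∂P ∂m := lintegral_mono hpt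
      _ = (volume U)⁻¹ * ∫⁻ x in U, ∫⁻ y in U, ‖φ x - φ y‖ₑ ^ q := by
          simp_rw [hP, lintegral_smul_measure, smul_eq_mul]
          rw [lintegral_const_mul' _ _ (ENNReal.inv_ne_top.2 h0)]
      _ ≤ (volume U)⁻¹ * ∫⁻ x in U, ∫⁻ y in U, ENNReal.ofReal D ^ q *
            ∫⁻ t in Icc (0 : ℝ) 1, H ((1 - t) • x + t • y) := by
          refine mul_le_mul_right (α := ℝ≥0∞) ?_ _
          refine setLIntegral_mono' hU fun x hx => setLIntegral_mono' hU fun y hy => ?_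
          refine (enorm_sub_rpow_le hφ hq x y).trans ?_
          gcongr
          rw [← ofReal_norm, ← dist_eq_norm]
          exact ENNReal.ofReal_le_ofReal (hD x hx y hy)
      _ = (volume U)⁻¹ * (ENNReal.ofReal D ^ q * ∫⁻ x in U, ∫⁻ y in U,
            ∫⁻ t in Icc (0 : ℝ) 1, H ((1 - t) • x + t • y)) := by
          have hne : ENNReal.ofReal D ^ q ≠ ∞ := by finiteness
          simp_rw [lintegral_const_mul' _ _ hne]
      _ ≤ (volume U)⁻¹ * (ENNReal.ofReal D ^ q * (2 ^ d * volume U * ∫⁻ x in U, H x)) := by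
          gcongr
          exact lintegral_segment_le hU hc hHm
      _ = 2 ^ d * ENNReal.ofReal D ^ q * ∫⁻ x in U, H x := by
          rw [show (volume U)⁻¹ * (ENNReal.ofReal D ^ q * (2 ^ d * volume U * ∫⁻ x in U, H x)) =
            ((volume U)⁻¹ * volume U) * (2 ^ d * ENNReal.ofReal D ^ q * ∫⁻ x in U, H x) by ring,
            ENNReal.inv_mul_cancel h0 htop, one_mul]
      _ = _ := by
          rw [hHae, ENNReal.ofReal_mul (by positivity), ENNReal.ofReal_mul (by positivity),
            ENNReal.ofReal_pow (by norm_num), ENNReal.ofReal_rpow_of_nonneg hD0 hq0.le]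
          norm_num
  have hnn : 0 ≤ 2 ^ d * D ^ q * ∫ x, ‖gradient φ x‖ ^ q ∂m := by positivity
  have hnorm : ∀ a : ℝ, |a| = ‖a‖ := fun _ => rfl
  simp_rw [hnorm]
  rw [integral_eq_lintegral_of_nonneg_ae (.of_forall fun x => by positivity)
    (((hφm.sub_const _).norm.pow_const q).aestronglyMeasurable)]
  refine ENNReal.toReal_le_of_le_ofReal hnn (le_trans (le_of_eq ?_) key)
  refine lintegral_congr fun x => ?_
  rw [← ofReal_norm, ENNReal.ofReal_rpow_of_nonneg (norm_nonneg _) hq0.le]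

end Poincare

section NegativeSobolevTransport

lemma le_transportCost_of_dual {X : Type*} [MeasurableSpace X] {μ lam : Measure X}
    {c : X → X → ℝ} (hc : Measurable fun z : X × X => c z.1 z.2) (hc0 : ∀ x y, 0 ≤ c x y)
    (hfin : transportCostE c μ lam ≠ ∞) {φ ψ : X → ℝ} (hφ : Integrable φ lam)
    (hψ : Integrable ψ μ) (h : ∀ x y, ψ y - φ x ≤ c x y) :
    ∫ y, ψ y ∂μ - ∫ x, φ x ∂lam ≤ transportCost c μ lam := by
  refine (ENNReal.ofReal_le_iff_le_toReal hfin).1 (le_iInf₂ fun π hπ => ?_)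
  by_cases htop : ∫⁻ z, ENNReal.ofReal (c z.1 z.2) ∂π = ∞
  · rw [htop]
    exact le_top
  have hi : Integrable (fun z : X × X => c z.1 z.2) π :=
    (lintegral_ofReal_ne_top_iff_integrable hc.aestronglyMeasurable
      (.of_forall fun z => hc0 z.1 z.2)).1 htop
  rw [← ofReal_integral_eq_lintegral_ofReal hi (.of_forall fun z => hc0 z.1 z.2)]
  exact ENNReal.ofReal_le_ofReal (dual_le_integral hπ hi hφ hψ (.of_forall fun z => h _ _))

/-- The transport cost between measures of equal finite mass is finite if the cost is bounded on
a set carrying both measures. -/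
lemma transportCostE_ne_top {X : Type*} [MeasurableSpace X] {μ lam : Measure X}
    [IsFiniteMeasure μ] [IsFiniteMeasure lam] (hm : μ univ = lam univ) {K : Set X}
    (hμ : ∀ᵐ x ∂μ, x ∈ K) (hlam : ∀ᵐ x ∂lam, x ∈ K) {c : X → X → ℝ} {M : ℝ}
    (hM : ∀ x ∈ K, ∀ y ∈ K, c x y ≤ M) : transportCostE c μ lam ≠ ∞ := by
  rcases eq_or_ne (μ univ) 0 with h0 | h0
  · have h1 : μ = 0 := Measure.measure_univ_eq_zero.1 h0
    have h2 : lam = 0 := Measure.measure_univ_eq_zero.1 (hm ▸ h0)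
    refine ne_top_of_le_ne_top ENNReal.zero_ne_top
      ((iInf₂_le (0 : Measure (X × X)) ?_).trans (by simp))
    simp [couplings, h1, h2]
  have htop : μ univ ≠ ∞ := measure_ne_top μ univ
  set π : Measure (X × X) := (μ univ)⁻¹ • lam.prod μ with hπd
  have hπ : π ∈ couplings μ lam := by
    constructor
    · rw [hπd, Measure.map_smul, Measure.map_fst_prod, smul_smul,
        ENNReal.inv_mul_cancel h0 htop, one_smul]
    · rw [hπd, Measure.map_smul, Measure.map_snd_prod, smul_smul, ← hm,
        ENNReal.inv_mul_cancel h0 htop, one_smul]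
  have := isFiniteMeasure_of_mem_couplings hπ
  refine ne_top_of_le_ne_top ?_ (iInf₂_le π hπ)
  refine ne_top_of_le_ne_top (b := ∫⁻ _, ENNReal.ofReal M ∂π) ?_ (lintegral_mono_ae ?_)
  · rw [lintegral_const]
    exact ENNReal.mul_ne_top ENNReal.ofReal_ne_top (measure_ne_top _ _)
  · filter_upwards [ae_fst_of_mem_couplings hπ hlam, ae_snd_of_mem_couplings hπ hμ] with z h1 h2
    exact ENNReal.ofReal_le_ofReal (hM _ h1 _ h2)

lemma integral_map_fst_withDensity {X : Type*} [MeasurableSpace X] {π : Measure (X × X)}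
    {k : X × X → ℝ} (hk : Measurable k) (hk0 : ∀ z, 0 ≤ k z) {h : X → ℝ} (hh : Measurable h) :
    ∫ x, h x ∂((π.withDensity fun z => ENNReal.ofReal (k z)).map Prod.fst) =
      ∫ z, k z * h z.1 ∂π := by
  rw [integral_map measurable_fst.aemeasurable hh.aestronglyMeasurable,
    integral_withDensity_eq_integral_toReal_smul hk.ennreal_ofReal
      (.of_forall fun _ => ENNReal.ofReal_lt_top)]
  exact integral_congr_ae (.of_forall fun z => by
    simp only [ENNReal.toReal_ofReal (hk0 z), smul_eq_mul])

lemma integral_withDensity_ofReal {X : Type*} [MeasurableSpace X] {π : Measure X}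
    {k : X → ℝ} (hk : Measurable k) (hk0 : ∀ z, 0 ≤ k z) (h : X → ℝ) :
    ∫ x, h x ∂(π.withDensity fun z => ENNReal.ofReal (k z)) = ∫ z, k z * h z ∂π := by
  rw [integral_withDensity_eq_integral_toReal_smul hk.ennreal_ofReal
      (.of_forall fun _ => ENNReal.ofReal_lt_top)]
  exact integral_congr_ae (.of_forall fun z => by
    simp only [ENNReal.toReal_ofReal (hk0 z), smul_eq_mul])

variable {d : ℕ}

lemma isFiniteMeasure_withDensity_of_le {X : Type*} [MeasurableSpace X] {π : Measure X}
    [IsFiniteMeasure π] {k : X → ℝ} (hk1 : ∀ z, k z ≤ 1) :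
    IsFiniteMeasure (π.withDensity fun z => ENNReal.ofReal (k z)) := by
  refine isFiniteMeasure_withDensity (ne_top_of_le_ne_top (measure_ne_top π univ) ?_)
  calc ∫⁻ z, ENNReal.ofReal (k z) ∂π ≤ ∫⁻ _, 1 ∂π := lintegral_mono fun z => by
        simpa using ENNReal.ofReal_le_ofReal (hk1 z)
    _ = _ := by simp

/-- The interpolation argument: the dual functional is controlled by a boundary cost, an interior
transport cost and a negative Sobolev norm. -/
theorem dual_le_of_negative_sobolev {p : ℝ} (hp : 1 < p)
    {ν μ lam : Measure (EuclideanSpace ℝ (Fin d))} [IsFiniteMeasure ν] [IsFiniteMeasure μ]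
    [IsFiniteMeasure lam] (hν : ν ≪ volume) (hlam : ENNReal.ofReal (1 / 2) • ν ≤ lam)
    {π : Measure (EuclideanSpace ℝ (Fin d) × EuclideanSpace ℝ (Fin d))}
    (hπ : π ∈ couplings μ lam) {η : EuclideanSpace ℝ (Fin d) → ℝ} (hηc : Continuous η)
    (hη : ∀ x, η x ∈ Icc (0 : ℝ) 1)
    {cb : EuclideanSpace ℝ (Fin d) × EuclideanSpace ℝ (Fin d) → ℝ} (hcb : Integrable cb π)
    (hcb0 : ∀ z, 0 ≤ cb z)
    (hcbη : ∀ᵐ z ∂π, (1 - η z.2) * ‖z.1 - z.2‖ ^ p ≤ (1 - η z.2) * cb z)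
    {κ' N : ℝ} (hN : 0 ≤ N)
    (hsob : ∀ w : EuclideanSpace ℝ (Fin d) → ℝ, ∀ K B, LipschitzWith K w → (∀ x, |w x| ≤ B) →
      κ' * ∫ x, η x * w x ∂ν - ∫ z, η z.2 * w z.1 ∂π ≤
        N * (∫ x, ‖gradient w x‖ ^ (p / (p - 1)) ∂ν) ^ ((p - 1) / p))
    (hκ' : 0 ≤ κ') (hfin : transportCostE (fun x y => dist x y ^ p)
      (ENNReal.ofReal κ' • ν.withDensity fun x => ENNReal.ofReal (η x))
      (μ.withDensity fun x => ENNReal.ofReal (η x)) ≠ ∞)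
    {φ ψ : EuclideanSpace ℝ (Fin d) → ℝ} {L₁ L₂ : ℝ≥0} {B₁ B₂ : ℝ} (hφ : LipschitzWith L₁ φ)
    (hψ : LipschitzWith L₂ ψ) (hφB : ∀ x, |φ x| ≤ B₁) (hψB : ∀ x, |ψ x| ≤ B₂)
    (hφψ : ∀ x y, ψ y - φ x ≤ ‖x - y‖ ^ p) {ε : ℝ} (hε : ε ∈ Ioo (0 : ℝ) 1) :
    ∫ y, ψ y ∂μ - ∫ x, φ x ∂lam ≤ ∫ z, cb z ∂π + 3 ^ (p - 1) * (ε * ∫ z, cb z ∂π +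
      W p (ENNReal.ofReal κ' • ν.withDensity fun x => ENNReal.ofReal (η x))
        (μ.withDensity fun x => ENNReal.ofReal (η x)) +
      (p * N) ^ p * (ε / 2 * (1 / 2 - (1 / 2 : ℝ) ^ p)) ^ (1 - p)) := by
  obtain ⟨hε0, hε1⟩ := hε
  have hp0 : 0 < p := by linarith
  have hη0 : ∀ x, 0 ≤ η x := fun x => (hη x).1
  have hη1 : ∀ x, η x ≤ 1 := fun x => (hη x).2
  have hηabs : ∀ x, |η x| ≤ 1 := fun x => abs_le.2 ⟨by linarith [hη0 x], hη1 x⟩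
  have hηm : Measurable η := hηc.measurable
  have hfπ : IsFiniteMeasure π := isFiniteMeasure_of_mem_couplings hπ
  set s : ℝ := 3 ^ (p - 1) with hs
  have hs0 : 0 < s := by positivity
  set φ' : EuclideanSpace ℝ (Fin d) → ℝ := fun x => φ x / s with hφ'
  have hB : ∀ x, |φ' x| ≤ B₁ / s := fun x => by
    simp only [hφ', abs_div, abs_of_pos hs0]
    gcongr
    exact hφB x
  have hL : LipschitzWith (L₁ / s.toNNReal) φ' := by
    refine LipschitzWith.of_dist_le_mul fun x y => ?_
    simp only [hφ', Real.dist_eq]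
    rw [← sub_div, abs_div, abs_of_pos hs0, NNReal.coe_div, div_mul_eq_mul_div,
      Real.coe_toNNReal s hs0.le]
    exact div_le_div_of_nonneg_right (hφ.dist_le_mul x y) hs0.le
  have hi : ∀ t : ℝ, 0 ≤ t → ∀ (m : Measure (EuclideanSpace ℝ (Fin d))) [IsFiniteMeasure m],
      Integrable (hopfLax p t φ') m := fun t ht m _ => integrable_hopfLax hp ht hB hL m
  have hcont : ∀ t : ℝ, 0 ≤ t → Continuous (hopfLax p t φ') := fun t ht =>
    (lipschitzWith_hopfLax ht hB hL).continuous
  have hψ3 : ∀ y, ψ y / s ≤ hopfLax p 3 φ' y := fun y => by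
    refine le_hopfLax (K := univ) (ψ := fun y => ψ y / s) (by norm_num) (fun x y _ => ?_)
      (mem_univ y)
    simp only [hφ', ← sub_div]
    exact div_le_div_of_nonneg_right (hφψ x y) hs0.le
  set k : EuclideanSpace ℝ (Fin d) × EuclideanSpace ℝ (Fin d) → ℝ :=
    fun z => ε + (1 - ε) * η z.2 with hk
  have hkε : ∀ z, ε ≤ k z := fun z => by
    simp only [hk]; nlinarith [hη0 z.2]
  have hk0 : ∀ z, 0 ≤ k z := fun z => hε0.le.trans (hkε z)
  have hk1 : ∀ z, k z ≤ 1 := fun z => by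
    simp only [hk]; nlinarith [hη1 z.2]
  have hkc : Continuous k := by fun_prop
  set k₂ : EuclideanSpace ℝ (Fin d) × EuclideanSpace ℝ (Fin d) → ℝ :=
    fun z => ε * (1 - η z.2) with hk₂
  have hk₂0 : ∀ z, 0 ≤ k₂ z := fun z => mul_nonneg hε0.le (by linarith [hη1 z.2])
  have hk₂1 : ∀ z, k₂ z ≤ 1 := fun z => by
    simp only [hk₂]; nlinarith [hη0 z.2]
  have hk₂c : Continuous k₂ := by fun_prop
  set f := (π.withDensity fun z => ENNReal.ofReal (k z)).map Prod.fst with hf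
  set ην := ENNReal.ofReal κ' • ν.withDensity fun x => ENNReal.ofReal (η x) with hην
  set ημ := μ.withDensity fun x => ENNReal.ofReal (η x) with hημ
  set g := (π.withDensity fun z => ENNReal.ofReal (k₂ z)).map Prod.fst + ην with hg
  have hf1 : IsFiniteMeasure (π.withDensity fun z => ENNReal.ofReal (k z)) :=
    isFiniteMeasure_withDensity_of_le hk1
  have hf2 : IsFiniteMeasure (π.withDensity fun z => ENNReal.ofReal (k₂ z)) :=
    isFiniteMeasure_withDensity_of_le hk₂1
  have hf3 : IsFiniteMeasure (ν.withDensity fun z => ENNReal.ofReal (η z)) :=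
    isFiniteMeasure_withDensity_of_le hη1
  have hf4 : IsFiniteMeasure ημ := isFiniteMeasure_withDensity_of_le hη1
  have hf5 : IsFiniteMeasure ην := by
    rw [hην]; exact Measure.smul_finite _ ENNReal.ofReal_ne_top
  have hintg : ∀ w : EuclideanSpace ℝ (Fin d) → ℝ, Continuous w → ∀ B, (∀ x, |w x| ≤ B) →
      ∫ x, w x ∂g = ∫ z, k₂ z * w z.1 ∂π + κ' * ∫ x, η x * w x ∂ν := by
    intro w hw B hwB
    rw [hg, integral_add_measure (integrable_of_continuous_bounded hw hwB)
      (integrable_of_continuous_bounded hw hwB),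
      integral_map_fst_withDensity hk₂c.measurable hk₂0 hw.measurable, hην,
      integral_smul_measure, integral_withDensity_ofReal hηm hη0, ENNReal.toReal_ofReal hκ',
      smul_eq_mul]
  have hintf : ∀ w : EuclideanSpace ℝ (Fin d) → ℝ, Continuous w →
      ∫ x, w x ∂f = ∫ z, k z * w z.1 ∂π := fun w hw =>
    integral_map_fst_withDensity hkc.measurable hk0 hw.measurable
  have hflb : ENNReal.ofReal (ε / 2) • ν ≤ f := by
    have h1 : ENNReal.ofReal ε • lam ≤ f := by
      rw [← hπ.1, ← Measure.map_smul, hf]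
      refine Measure.map_mono ?_ measurable_fst
      rw [← withDensity_const]
      exact withDensity_mono (.of_forall fun z => ENNReal.ofReal_le_ofReal (hkε z))
    refine le_trans ?_ h1
    rw [show ε / 2 = ε * (1 / 2) by ring, ENNReal.ofReal_mul hε0.le, ← smul_smul]
    exact fun A => mul_le_mul_right (hlam A) _
  have hbd : ∀ (q : EuclideanSpace ℝ (Fin d) × EuclideanSpace ℝ (Fin d) → ℝ), Continuous q →
      ∀ B, (∀ z, |q z| ≤ B) → Integrable q π := fun q hq B hqB =>
    integrable_of_continuous_bounded hq hqB
  have hmulB : ∀ {a b B : ℝ}, 0 ≤ a → a ≤ 1 → |b| ≤ B → |a * b| ≤ B := by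
    intro a b B h0 h1 h2
    rw [abs_mul, abs_of_nonneg h0]
    nlinarith [abs_nonneg b]
  have hHL := integral_hopfLax_sub_le hp hν (f := f) (g := g) (a := ε / 2) (A := N)
    (B := B₁ / s) (by positivity) hN hflb (fun w K hw hwB => by
      rw [hintg w hw.continuous _ hwB, hintf w hw.continuous]
      refine le_trans (le_of_eq ?_) (hsob w K _ hw hwB)
      have i1 : Integrable (fun z : EuclideanSpace ℝ (Fin d) × EuclideanSpace ℝ (Fin d) =>
          k₂ z * w z.1) π := hbd _ (hk₂c.mul (hw.continuous.comp continuous_fst)) _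
            fun z => hmulB (hk₂0 z) (hk₂1 z) (hwB _)
      have i2 : Integrable (fun z : EuclideanSpace ℝ (Fin d) × EuclideanSpace ℝ (Fin d) =>
          η z.2 * w z.1) π := hbd _ ((hηc.comp continuous_snd).mul
            (hw.continuous.comp continuous_fst)) _ fun z => hmulB (hη0 _) (hη1 _) (hwB _)
      have : ∫ z, k z * w z.1 ∂π = ∫ z, k₂ z * w z.1 ∂π + ∫ z, η z.2 * w z.1 ∂π := by
        rw [← integral_add i1 i2]
        refine integral_congr_ae (.of_forall fun z => ?_)
        simp only [hk, hk₂]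
        ring
      rw [this]
      ring) hB hL
  have hw1 := hintg _ (hcont 1 zero_le_one) _ (abs_hopfLax_le hp zero_le_one hB)
  have hφf := hintf φ' hL.continuous
  have hWle : ∫ x, hopfLax p 2 φ' x ∂ημ - ∫ x, hopfLax p 1 φ' x ∂ην ≤ W p ην ημ := by
    have := le_transportCost_of_dual (μ := ην) (lam := ημ) (c := fun x y => dist x y ^ p)
      (measurable_dist.pow_const p) (fun x y => by positivity) hfin
      (φ := fun x => -hopfLax p 2 φ' x) (ψ := fun x => -hopfLax p 1 φ' x)
      (hi 2 zero_le_two _).neg (hi 1 zero_le_one _).neg (fun x y => by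
        have := hopfLax_one_add_le hp zero_le_one hB y x
        rw [one_add_one_eq_two] at this
        rw [dist_eq_norm]
        linarith)
    rw [integral_neg, integral_neg] at this
    rw [W]
    linarith
  have hην1 : ∫ x, hopfLax p 1 φ' x ∂ην = κ' * ∫ x, η x * hopfLax p 1 φ' x ∂ν := by
    rw [hην, integral_smul_measure, integral_withDensity_ofReal hηm hη0, ENNReal.toReal_ofReal hκ',
      smul_eq_mul]
  have hημ2 : ∫ x, hopfLax p 2 φ' x ∂ημ = ∫ z, η z.2 * hopfLax p 2 φ' z.2 ∂π := by
    rw [hημ, integral_withDensity_ofReal hηm hη0]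
    exact (integral_snd_of_mem_couplings hπ
      (hηc.mul (hcont 2 zero_le_two)).measurable.aestronglyMeasurable).symm
  have hψi : Integrable ψ μ := integrable_of_continuous_bounded hψ.continuous hψB
  have hφi : Integrable φ lam := integrable_of_continuous_bounded hφ.continuous hφB
  have i1 : Integrable (fun z : EuclideanSpace ℝ (Fin d) × EuclideanSpace ℝ (Fin d) =>
      k₂ z * hopfLax p 1 φ' z.1) π :=
    hbd _ (hk₂c.mul ((hcont 1 zero_le_one).comp continuous_fst)) _
      fun z => hmulB (hk₂0 z) (hk₂1 z) (abs_hopfLax_le hp zero_le_one hB _)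
  have i2 : Integrable (fun z : EuclideanSpace ℝ (Fin d) × EuclideanSpace ℝ (Fin d) =>
      η z.2 * hopfLax p 2 φ' z.2) π :=
    hbd _ ((hηc.comp continuous_snd).mul ((hcont 2 zero_le_two).comp continuous_snd)) _
      fun z => hmulB (hη0 _) (hη1 _) (abs_hopfLax_le hp zero_le_two hB _)
  have i3 : Integrable (fun z : EuclideanSpace ℝ (Fin d) × EuclideanSpace ℝ (Fin d) =>
      k z * φ' z.1) π :=
    hbd _ (hkc.mul (hL.continuous.comp continuous_fst)) _
      fun z => hmulB (hk0 z) (hk1 z) (hB _)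
  have hmain := dual_le_integral hπ (c := fun x y => (1 + s * ε) * cb (x, y) +
      s * (k₂ (x, y) * hopfLax p 1 φ' x + η y * hopfLax p 2 φ' y - k (x, y) * φ' x))
    ((hcb.const_mul _).add (((i1.add i2).sub i3).const_mul _)) hφi hψi (by
      filter_upwards [hcbη] with z hz
      have a1 := hψ3 z.2
      have a2 := hopfLax_one_add_le hp zero_le_two hB z.1 z.2
      rw [show (2 : ℝ) + 1 = 3 by norm_num, norm_sub_rev] at a2
      have a3 := hopfLax_antitone hp zero_le_two (show (2 : ℝ) ≤ 3 by norm_num) hB z.2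
      have a4 := hopfLax_antitone hp zero_le_one (show (1 : ℝ) ≤ 2 by norm_num) hB z.1
      have a5 := hφψ z.1 z.2
      have hη' : 0 ≤ 1 - η z.2 := by linarith [hη1 z.2]
      have hcz : (1 - η z.2) * cb z ≤ cb z := by nlinarith [hcb0 z, hη0 z.2]
      have b1 : (1 - ε) * (1 - η z.2) * (ψ z.2 - φ z.1) ≤ cb z := by
        have c1 : (1 - η z.2) * (ψ z.2 - φ z.1) ≤ cb z :=
          (mul_le_mul_of_nonneg_left a5 hη').trans (hz.trans hcz)
        have := mul_le_mul_of_nonneg_left c1 (by linarith : 0 ≤ 1 - ε)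
        nlinarith [hcb0 z]
      have b2 : (1 - η z.2) * (hopfLax p 3 φ' z.2 - hopfLax p 2 φ' z.1) ≤ cb z :=
        (mul_le_mul_of_nonneg_left (by linarith) hη').trans (hz.trans hcz)
      have b3 := mul_le_mul_of_nonneg_left b2 hε0.le
      have b4 := mul_le_mul_of_nonneg_left a4 (hk₂0 z)
      have b5 := mul_le_mul_of_nonneg_left a3 (hη0 z.2)
      have b6 := mul_le_mul_of_nonneg_left a1 (hk0 z)
      have e1 : k z * (ψ z.2 / s) * s = k z * ψ z.2 := by field_simp
      have e2 : k z * φ' z.1 * s = k z * φ z.1 := by simp only [hφ']; field_simp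
      have e3 : k z = k₂ z + η z.2 := by simp only [hk, hk₂]; ring
      have e4 : (1 - ε) * (1 - η z.2) = 1 - k z := by simp only [hk]; ring
      rw [e4] at b1
      have b7 : k z * (ψ z.2 / s) ≤ k₂ z * hopfLax p 1 φ' z.1 + ε * cb z +
          η z.2 * hopfLax p 2 φ' z.2 := by
        simp only [hk₂] at b4 e3 ⊢
        rw [e3] at b6 ⊢
        linarith
      have b8 := mul_le_mul_of_nonneg_right b7 hs0.le
      rw [e1] at b8
      simp only [Prod.mk.eta]
      linarith)
  have hcalc : ∫ z, ((1 + s * ε) * cb (z.1, z.2) + s * (k₂ (z.1, z.2) * hopfLax p 1 φ' z.1 +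
      η z.2 * hopfLax p 2 φ' z.2 - k (z.1, z.2) * φ' z.1)) ∂π = (1 + s * ε) * ∫ z, cb z ∂π +
      s * (∫ z, k₂ z * hopfLax p 1 φ' z.1 ∂π + ∫ z, η z.2 * hopfLax p 2 φ' z.2 ∂π -
        ∫ z, k z * φ' z.1 ∂π) := by
    simp only [Prod.mk.eta]
    have i4 : Integrable (fun z : EuclideanSpace ℝ (Fin d) × EuclideanSpace ℝ (Fin d) =>
      k₂ z * hopfLax p 1 φ' z.1 + η z.2 * hopfLax p 2 φ' z.2) π := i1.add i2
    have i5 : Integrable (fun z : EuclideanSpace ℝ (Fin d) × EuclideanSpace ℝ (Fin d) =>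
      k₂ z * hopfLax p 1 φ' z.1 + η z.2 * hopfLax p 2 φ' z.2 - k z * φ' z.1) π := i4.sub i3
    rw [integral_add (hcb.const_mul _) (i5.const_mul _), integral_const_mul,
      integral_const_mul, integral_sub i4 i3, integral_add i1 i2]
  rw [hcalc, ← hημ2, ← hφf] at hmain
  rw [hw1, ← hην1] at hHL
  have := mul_le_mul_of_nonneg_left (add_le_add hHL hWle) hs0.le
  linarith

end NegativeSobolevTransport

section NegativeSobolev

variable {d : ℕ} {Ω : Set (EuclideanSpace ℝ (Fin d))} {p q : ℝ}

theorem restrict_interior_of_convex (hc : Convex ℝ Ω) :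
    (volume : Measure (EuclideanSpace ℝ (Fin d))).restrict (interior Ω) = volume.restrict Ω :=
  Measure.restrict_congr_set (interior_ae_eq_of_null_frontier (hc.addHaar_frontier volume))

theorem volume_interior_of_convex (hc : Convex ℝ Ω) : volume (interior Ω) = volume Ω := by
  rw [← Measure.restrict_apply_univ, restrict_interior_of_convex hc, Measure.restrict_apply_univ]

theorem integrableOn_of_continuous_isBounded (hb : Bornology.IsBounded Ω)
    {f : EuclideanSpace ℝ (Fin d) → ℝ} (hf : Continuous f) : IntegrableOn f Ω :=
  (hf.continuousOn.integrableOn_compact hb.isCompact_closure).mono_set subset_closure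

theorem poincare_of_isBounded (hc : Convex ℝ Ω) (hb : Bornology.IsBounded Ω) (h0 : volume Ω ≠ 0)
    {φ : EuclideanSpace ℝ (Fin d) → ℝ} {L : ℝ≥0} (hφ : LipschitzWith L φ) (hq : 1 ≤ q) :
    ∫ x in Ω, |φ x - (volume Ω).toReal⁻¹ * ∫ z in Ω, φ z| ^ q ≤
      2 ^ d * diam Ω ^ q * ∫ x in Ω, ‖gradient φ x‖ ^ q := by
  have := poincare_of_convex isOpen_interior.measurableSet hc.interior
    (by rwa [volume_interior_of_convex hc])
    (by rw [volume_interior_of_convex hc]; exact hb.measure_lt_top.ne) (D := diam Ω)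
    (fun x hx y hy => dist_le_diam_of_mem hb (interior_subset hx) (interior_subset hy)) hφ
    ((integrableOn_of_continuous_isBounded hb hφ.continuous).mono_set interior_subset) hq
  rwa [restrict_interior_of_convex hc, volume_interior_of_convex hc] at this

theorem gradient_const_mul (a : ℝ) (φ : EuclideanSpace ℝ (Fin d) → ℝ)
    (x : EuclideanSpace ℝ (Fin d)) : gradient (fun y => a * φ y) x = a • gradient φ x := by
  have : fderiv ℝ (fun y => a * φ y) x = a • fderiv ℝ φ x := by
    have := congrFun (fderiv_const_smul_field (𝕜 := ℝ) (f := φ) a) x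
    simpa [Pi.smul_def, smul_eq_mul] using this
  simp [gradient, this]

theorem negativeSobolev_bddAbove (hc : Convex ℝ Ω) (hb : Bornology.IsBounded Ω)
    (h0 : volume Ω ≠ 0) (hp : 1 < p) {f : EuclideanSpace ℝ (Fin d) → ℝ} {B : ℝ}
    (hf : Measurable f) (hB : ∀ᵐ x ∂volume.restrict Ω, |f x| ≤ B) (hf0 : ∫ x in Ω, f x = 0) :
    BddAbove {r : ℝ | ∃ φ : EuclideanSpace ℝ (Fin d) → ℝ, (∃ K, LipschitzWith K φ) ∧
      (∫ x in Ω, ‖gradient φ x‖ ^ (p / (p - 1))) ≤ 1 ∧ r = ∫ x in Ω, f x * φ x} := by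
  have hq : 1 ≤ p / (p - 1) := by rw [le_div_iff₀] <;> linarith
  have : IsFiniteMeasure (volume.restrict Ω) := ⟨by simpa using hb.measure_lt_top⟩
  refine ⟨|B| * (2 ^ d * diam Ω ^ (p / (p - 1)) * 1 + (volume Ω).toReal), ?_⟩
  rintro _ ⟨φ, ⟨K, hK⟩, hφ, rfl⟩
  set q := p / (p - 1)
  set m := (volume Ω).toReal⁻¹ * ∫ z in Ω, φ z with hm
  have hq0 : 0 ≤ q := by linarith
  have hcont : Continuous fun x => |φ x - m| ^ q :=
    ((hK.continuous.sub continuous_const).abs).rpow_const fun _ => Or.inr hq0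
  have hint := integrableOn_of_continuous_isBounded hb hcont
  have hfi : Integrable f (volume.restrict Ω) :=
    Integrable.of_bound hf.aestronglyMeasurable B (by simpa using hB)
  have hfφ : Integrable (fun x => f x * φ x) (volume.restrict Ω) :=
    (integrableOn_of_continuous_isBounded hb hK.continuous).bdd_mul hf.aestronglyMeasurable
      (by simpa using hB)
  have h1 : ∫ x in Ω, f x * φ x = ∫ x in Ω, f x * (φ x - m) := by
    simp_rw [mul_sub]
    rw [integral_sub hfφ (hfi.mul_const m), integral_mul_const, hf0]
    ring
  rw [h1]
  calc ∫ x in Ω, f x * (φ x - m) ≤ ∫ x in Ω, |B| * (|φ x - m| ^ q + 1) := by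
        refine integral_mono_ae ?_ ((hint.add (integrable_const 1)).const_mul _) ?_
        · simp_rw [mul_sub]
          exact hfφ.sub (hfi.mul_const m)
        filter_upwards [hB] with x hx
        have h2 : |φ x - m| ≤ |φ x - m| ^ q + 1 := by
          rcases le_total 1 |φ x - m| with h | h
          · have := Real.rpow_le_rpow_of_exponent_le h hq
            rw [Real.rpow_one] at this
            linarith
          · linarith [Real.rpow_nonneg (abs_nonneg (φ x - m)) q]
        calc f x * (φ x - m) ≤ |f x| * |φ x - m| := by rw [← abs_mul]; exact le_abs_self _
          _ ≤ _ := mul_le_mul (hx.trans (le_abs_self B)) h2 (abs_nonneg _) (abs_nonneg _)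
    _ = |B| * ((∫ x in Ω, |φ x - m| ^ q) + (volume Ω).toReal) := by
        rw [integral_const_mul, integral_add hint (integrable_const 1)]
        simp [Measure.real]
    _ ≤ _ := by
        gcongr
        exact (poincare_of_isBounded hc hb h0 hK hq).trans (by gcongr)

theorem negativeSobolev_nonneg (hc : Convex ℝ Ω) (hb : Bornology.IsBounded Ω)
    (h0 : volume Ω ≠ 0) (hp : 1 < p) {f : EuclideanSpace ℝ (Fin d) → ℝ} {B : ℝ}
    (hf : Measurable f) (hB : ∀ᵐ x ∂volume.restrict Ω, |f x| ≤ B) (hf0 : ∫ x in Ω, f x = 0) :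
    0 ≤ HnegNorm p Ω f := by
  refine le_csSup (negativeSobolev_bddAbove hc hb h0 hp hf hB hf0)
    ⟨fun _ => 0, ⟨0, LipschitzWith.const 0⟩, ?_, by simp⟩
  have hq : p / (p - 1) ≠ 0 := (div_pos (by linarith) (by linarith)).ne'
  simp [gradient, Real.zero_rpow hq]

theorem integral_mul_le_negativeSobolev (hc : Convex ℝ Ω) (hb : Bornology.IsBounded Ω)
    (h0 : volume Ω ≠ 0) (hp : 1 < p) {f : EuclideanSpace ℝ (Fin d) → ℝ} {B : ℝ}
    (hf : Measurable f) (hB : ∀ᵐ x ∂volume.restrict Ω, |f x| ≤ B) (hf0 : ∫ x in Ω, f x = 0)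
    {φ : EuclideanSpace ℝ (Fin d) → ℝ} {K : ℝ≥0} (hφ : LipschitzWith K φ) :
    ∫ x in Ω, f x * φ x ≤
      HnegNorm p Ω f * (∫ x in Ω, ‖gradient φ x‖ ^ (p / (p - 1))) ^ ((p - 1) / p) := by
  have hq : 0 < p / (p - 1) := div_pos (by linarith) (by linarith)
  have hqi : (p - 1) / p = (p / (p - 1))⁻¹ := (inv_div _ _).symm
  rw [hqi]
  set q := p / (p - 1)
  set G := ∫ x in Ω, ‖gradient φ x‖ ^ q
  have hG : 0 ≤ G := integral_nonneg fun _ => by positivity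
  have key : ∀ δ > 0, ∫ x in Ω, f x * φ x ≤ HnegNorm p Ω f * (G + δ) ^ q⁻¹ := by
    intro δ hδ
    have hGδ : 0 < G + δ := by linarith
    set a := ((G + δ) ^ q⁻¹)⁻¹ with ha
    have hb0 : 0 < (G + δ) ^ q⁻¹ := by positivity
    have ha0 : 0 < a := by positivity
    have hmem : ∫ x in Ω, f x * (a * φ x) ≤ HnegNorm p Ω f := by
      refine le_csSup (negativeSobolev_bddAbove hc hb h0 hp hf hB hf0)
        ⟨fun x => a * φ x, ⟨_, (lipschitzWith_smul a).comp hφ⟩, ?_, rfl⟩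
      have : ∀ x, ‖gradient (fun y => a * φ y) x‖ ^ q = a ^ q * ‖gradient φ x‖ ^ q := fun x => by
        rw [gradient_const_mul, norm_smul, Real.mul_rpow (norm_nonneg _) (norm_nonneg _),
          Real.norm_of_nonneg ha0.le]
      change ∫ x in Ω, ‖gradient (fun y => a * φ y) x‖ ^ q ≤ 1
      simp_rw [this]
      rw [integral_const_mul, ha, Real.inv_rpow hb0.le, Real.rpow_inv_rpow hGδ.le hq.ne',
        inv_mul_le_iff₀ hGδ]
      linarith
    have h2 : ∫ x in Ω, f x * (a * φ x) = a * ∫ x in Ω, f x * φ x := by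
      rw [← integral_const_mul]
      exact integral_congr_ae (.of_forall fun x => by ring)
    rw [h2, ha, inv_mul_le_iff₀ hb0] at hmem
    linarith
  have hcont : Tendsto (fun δ : ℝ => HnegNorm p Ω f * (G + δ) ^ q⁻¹) (𝓝[>] 0)
      (𝓝 (HnegNorm p Ω f * G ^ q⁻¹)) := by
    have : Continuous fun δ : ℝ => HnegNorm p Ω f * (G + δ) ^ q⁻¹ :=
      continuous_const.mul ((continuous_const.add continuous_id).rpow_const
        fun _ => Or.inr (inv_pos.2 hq).le)
    have h := this.tendsto 0
    rw [add_zero] at h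
    exact h.mono_left nhdsWithin_le_nhds
  exact ge_of_tendsto hcont (eventually_mem_nhdsWithin.mono fun δ hδ => key δ hδ)

end NegativeSobolev

section BoundaryCost

variable {X : Type*} [PseudoMetricSpace X] {p M : ℝ} {Ω : Set X}

theorem lipschitzWith_rpow_of_le {f : X → ℝ} {K : ℝ≥0} (hf : LipschitzWith K f)
    (h0 : ∀ x, 0 ≤ f x) (hM : ∀ x, f x ≤ M) (hp : 1 < p) :
    LipschitzWith ((p * M ^ (p - 1)).toNNReal * K) (fun x => f x ^ p) := by
  refine LipschitzWith.of_dist_le_mul fun x y => ?_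
  have hM0 : 0 ≤ M := (h0 x).trans (hM x)
  have h := Convex.norm_image_sub_le_of_norm_hasDerivWithin_le (f := fun t : ℝ => t ^ p)
    (f' := fun t => p * t ^ (p - 1)) (s := Icc 0 M) (C := p * M ^ (p - 1))
    (fun t _ => (Real.hasDerivAt_rpow_const (Or.inr hp.le)).hasDerivWithinAt)
    (fun t ht => by
      rw [Real.norm_of_nonneg (mul_nonneg (by linarith) (Real.rpow_nonneg ht.1 _))]
      have := Real.rpow_le_rpow ht.1 ht.2 (by linarith : 0 ≤ p - 1)
      gcongr)
    (convex_Icc 0 M) ⟨h0 y, hM y⟩ ⟨h0 x, hM x⟩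
  have h2 : 0 ≤ p * M ^ (p - 1) := by positivity
  rw [NNReal.coe_mul, Real.coe_toNNReal _ h2, mul_assoc, Real.dist_eq]
  refine h.trans (mul_le_mul_of_nonneg_left ?_ h2)
  rw [← dist_eq_norm]
  exact hf.dist_le_mul x y

theorem bdist_nonneg (x y : X) : 0 ≤ bdist p Ω x y :=
  le_min dist_nonneg (Real.rpow_nonneg (add_nonneg (Real.rpow_nonneg infDist_nonneg _)
    (Real.rpow_nonneg infDist_nonneg _)) _)

theorem bdist_le_dist (x y : X) : bdist p Ω x y ≤ dist x y := min_le_left _ _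

theorem bdist_rpow (hp : 1 < p) (x y : X) :
    bdist p Ω x y ^ p = min (dist x y ^ p) (infDist x Ωᶜ ^ p + infDist y Ωᶜ ^ p) := by
  have h0 : 0 ≤ infDist x Ωᶜ ^ p + infDist y Ωᶜ ^ p :=
    add_nonneg (Real.rpow_nonneg infDist_nonneg _) (Real.rpow_nonneg infDist_nonneg _)
  have hmono : MonotoneOn (fun t : ℝ => t ^ p) (Ici 0) := fun a ha b _ hab =>
    Real.rpow_le_rpow ha hab (by linarith)
  rw [bdist]
  have := hmono.map_min (a := dist x y) (b := (infDist x Ωᶜ ^ p + infDist y Ωᶜ ^ p) ^ (1 / p))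
    dist_nonneg (Real.rpow_nonneg h0 _)
  rw [this, ← Real.rpow_mul h0, one_div_mul_cancel (by linarith), Real.rpow_one]

theorem bdist_comm (x y : X) : bdist p Ω x y = bdist p Ω y x := by
  simp [bdist, dist_comm, add_comm]

theorem bdist_rpow_le (hp : 1 < p) (hM : ∀ x, infDist x Ωᶜ ≤ M) (x y : X) :
    bdist p Ω x y ^ p ≤ 2 * M ^ p := by
  rw [bdist_rpow hp]
  refine (min_le_right _ _).trans ?_
  have := Real.rpow_le_rpow infDist_nonneg (hM x) (by linarith : 0 ≤ p)
  have := Real.rpow_le_rpow infDist_nonneg (hM y) (by linarith : 0 ≤ p)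
  linarith

theorem exists_lipschitzWith_bdist_rpow (hp : 1 < p) (hM : ∀ x, infDist x Ωᶜ ≤ M) :
    ∃ L : ℝ≥0, ∀ y, LipschitzWith L (fun x => bdist p Ω x y ^ p) := by
  set N := max (2 * M) 0
  have hN : 0 ≤ N := le_max_right _ _
  have h1 : ∀ y, LipschitzWith ((p * N ^ (p - 1)).toNNReal * 1)
      (fun x : X => min (dist x y) N ^ p) := fun y =>
    lipschitzWith_rpow_of_le ((LipschitzWith.dist_left y).min_const N)
      (fun x => le_min dist_nonneg hN) (fun x => min_le_right _ _) hp
  have h2 : ∀ y, LipschitzWith ((p * M ^ (p - 1)).toNNReal * 1)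
      (fun x => infDist x Ωᶜ ^ p + infDist y Ωᶜ ^ p) := fun y => by
    have := (lipschitzWith_rpow_of_le (lipschitz_infDist_pt Ωᶜ) (fun x => infDist_nonneg) hM
      hp).add (LipschitzWith.const (infDist y Ωᶜ ^ p))
    simpa using this
  refine ⟨max ((p * N ^ (p - 1)).toNNReal * 1) ((p * M ^ (p - 1)).toNNReal * 1), fun y => ?_⟩
  convert (h1 y).min (h2 y) using 2 with x
  rw [bdist_rpow hp]
  rcases le_total (dist x y) N with h | h
  · rw [min_eq_left h]
  · have hM0 : 0 ≤ M := infDist_nonneg.trans (hM x)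
    have h3 : infDist x Ωᶜ ^ p + infDist y Ωᶜ ^ p ≤ N ^ p := by
      have := Real.rpow_le_rpow infDist_nonneg (hM x) (by linarith : 0 ≤ p)
      have := Real.rpow_le_rpow infDist_nonneg (hM y) (by linarith : 0 ≤ p)
      calc _ ≤ M ^ p + M ^ p := by linarith
        _ ≤ (M + M) ^ p := Real.add_rpow_le_rpow_add hM0 hM0 hp.le
        _ ≤ N ^ p := Real.rpow_le_rpow (by linarith) (by
            rw [← two_mul]; exact le_max_left _ _) (by linarith)
    rw [min_eq_right h, min_eq_right h3,
      min_eq_right (h3.trans (Real.rpow_le_rpow hN h (by linarith)))]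

end BoundaryCost

section BoundaryTransport

variable {d : ℕ} {p : ℝ} {Ω Y : Set (EuclideanSpace ℝ (Fin d))}
  {v : EuclideanSpace ℝ (Fin d) → ℝ}

theorem infDist_compl_le_diam (hd : 1 ≤ d) (hb : Bornology.IsBounded Ω)
    (x : EuclideanSpace ℝ (Fin d)) : infDist x Ωᶜ ≤ diam Ω := by
  have : Nonempty (Fin d) := ⟨⟨0, hd⟩⟩
  by_cases hx : x ∈ Ω
  · refine le_of_forall_pos_le_add fun δ hδ => ?_
    obtain ⟨e, he⟩ := exists_norm_eq (EuclideanSpace ℝ (Fin d))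
      (by have := diam_nonneg (s := Ω); linarith : 0 ≤ diam Ω + δ)
    have h1 : dist x (x + e) = diam Ω + δ := by simp [he]
    have h2 : x + e ∈ Ωᶜ := fun h => by
      have := dist_le_diam_of_mem hb hx h
      linarith
    exact h1 ▸ infDist_le_dist_of_mem h2
  · rw [infDist_zero_of_mem hx]
    exact diam_nonneg

theorem memS.exists_lipschitzOnWith (hd : 1 ≤ d) (hp : 1 < p) (hb : Bornology.IsBounded Ω)
    {K : Set (EuclideanSpace ℝ (Fin d))} (hK : K.Nonempty) (hv : memS p Ω K Y v) :
    ∃ L : ℝ≥0, LipschitzOnWith L v Y := by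
  obtain ⟨u, hu⟩ := hv
  have hM := infDist_compl_le_diam hd hb
  obtain ⟨L, hL⟩ := exists_lipschitzWith_bdist_rpow hp hM
  have : Nonempty K := hK.to_subtype
  by_cases hbd : BddAbove (range fun x : K => u x)
  · refine ⟨L, LipschitzOnWith.of_le_add_mul L fun y hy y' hy' => ?_⟩
    rw [hu y hy, hu y' hy']
    have hbd' : BddAbove (range fun x : K => u x - bdist p Ω x y' ^ p) := by
      obtain ⟨b, hb⟩ := hbd
      refine ⟨b, ?_⟩
      rintro _ ⟨x, rfl⟩
      have := hb (mem_range_self x)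
      have h2 := Real.rpow_nonneg
        (bdist_nonneg (p := p) (Ω := Ω) (x : EuclideanSpace ℝ (Fin d)) y') p
      simp only at this ⊢
      linarith
    refine ciSup_le fun x => ?_
    have h1 := le_ciSup hbd' x
    have h2 := (hL x).le_add_mul y' y
    simp only [bdist_comm _ (x : EuclideanSpace ℝ (Fin d))] at h2
    rw [dist_comm y' y] at h2
    simp only [Qbhat]
    linarith
  · refine ⟨0, LipschitzOnWith.of_dist_le_mul fun y hy y' hy' => ?_⟩
    have h0 : ∀ y ∈ Y, v y = 0 := fun y hy => by
      rw [hu y hy, Qbhat]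
      refine Real.iSup_of_not_bddAbove fun ⟨b, hb⟩ => hbd ⟨b + 2 * diam Ω ^ p, ?_⟩
      rintro _ ⟨x, rfl⟩
      have := hb (mem_range_self x)
      have h2 := bdist_rpow_le hp hM (x : EuclideanSpace ℝ (Fin d)) y
      simp only at this ⊢
      linarith
    rw [h0 y hy, h0 y' hy']
    simp

theorem exists_boundary_coupling (hd : 1 ≤ d) (hp : 1 < p) (hb : Bornology.IsBounded Ω)
    (hΩ : Ω.Nonempty) (hY : IsClosed Y) (hYΩ : Y ⊆ closure Ω) (hYn : Y.Nonempty)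
    {μ lam : Measure (EuclideanSpace ℝ (Fin d))} [IsFiniteMeasure μ] [IsFiniteMeasure lam]
    (hμ : μ Ωᶜ = 0) (hlam : lam Ωᶜ = 0) (hμY : μ Yᶜ = 0) (hm : μ univ = lam univ)
    (hv : IsDualOpt p Ω (closure Ω) Y v μ lam) :
    ∃ π ∈ couplings μ lam, Wb p Ω μ lam = ∫ z, bdist p Ω z.1 z.2 ^ p ∂π ∧
      (∃ L, LipschitzWith L (Qb p Ω Y v)) ∧
      (∀ x, ∀ y ∈ Y, Qb p Ω Y v x - v y ≤ bdist p Ω x y ^ p) ∧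
      (∀ x ∈ Ω, ∀ y ∈ Y, Qb p Ω Y v x - v y ≤ oscOn Y v + supInfDist Ω Y ^ p) ∧
      ∀ᵐ z ∂π, z.1 ∈ Ω ∧ z.2 ∈ Ω ∧ z.2 ∈ Y ∧ Qb p Ω Y v z.1 - v z.2 = bdist p Ω z.1 z.2 ^ p := by
  have hM := infDist_compl_le_diam hd hb
  obtain ⟨L, hL⟩ := exists_lipschitzWith_bdist_rpow hp hM
  have hL' : ∀ x, LipschitzWith L (fun y => bdist p Ω x y ^ p) := fun x => by
    simpa only [bdist_comm x] using hL x
  have hcc : Continuous fun z : EuclideanSpace ℝ (Fin d) × EuclideanSpace ℝ (Fin d) =>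
      bdist p Ω z.1 z.2 ^ p := (LipschitzWith.uncurry hL hL').continuous
  have hc0 : ∀ x y, 0 ≤ bdist p Ω x y ^ p := fun x y => Real.rpow_nonneg (bdist_nonneg x y) p
  have hcM := bdist_rpow_le hp hM
  have hrμ : μ.restrict Ω = μ := Measure.restrict_eq_self_of_ae_mem hμ
  have hrl : lam.restrict Ω = lam := Measure.restrict_eq_self_of_ae_mem hlam
  have hKc : (closure Ω)ᶜ ⊆ Ωᶜ := compl_subset_compl.2 subset_closure
  obtain ⟨π, hπ, hW, -⟩ := exists_optimal_coupling hb.isCompact_closure hΩ.closure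
    (measure_mono_null hKc hμ) (measure_mono_null hKc hlam) hm hL hL' hc0 hcM
  have := isFiniteMeasure_of_mem_couplings hπ
  have hWb : Wb p Ω μ lam = ∫ z, bdist p Ω z.1 z.2 ^ p ∂π := by
    rw [Wb, hrμ, hrl, hW]
  have hYc : IsCompact Y := hb.isCompact_closure.of_isClosed_subset hY hYΩ
  obtain ⟨Lv, hLv⟩ := hv.1.exists_lipschitzOnWith hd hp hb hΩ.closure
  have hvB : ∃ B, ∀ y ∈ Y, |v y| ≤ B := by
    obtain ⟨B, hB⟩ := hYc.exists_bound_of_continuousOn hLv.continuousOn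
    exact ⟨B, hB⟩
  obtain ⟨B, hB⟩ := hvB
  have : Nonempty Y := hYn.to_subtype
  have hbdd : ∀ x, BddBelow (range fun y : Y => v ↑y + bdist p Ω x ↑y ^ p) := fun x => by
    refine ⟨-B, ?_⟩
    rintro _ ⟨y, rfl⟩
    have := (abs_le.1 (hB y y.2)).1
    have := hc0 x y
    simp only
    linarith
  have huL : LipschitzWith L (Qb p Ω Y v) := by
    refine LipschitzWith.of_le_add_mul L fun x x' => ?_
    rw [← sub_le_iff_le_add]
    refine le_ciInf fun y => ?_
    have h1 := ciInf_le (hbdd x) y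
    have h2 := (hL y).le_add_mul x x'
    simp only [Qb] at *
    linarith
  have hule : ∀ x, ∀ y ∈ Y, Qb p Ω Y v x - v y ≤ bdist p Ω x y ^ p := fun x y hy => by
    have h1 := ciInf_le (hbdd x) ⟨y, hy⟩
    simp only [Qb] at *
    linarith
  have huB : ∀ x, |Qb p Ω Y v x| ≤ B + 2 * diam Ω ^ p := fun x => by
    obtain ⟨y, hy⟩ := hYn
    have h1 := hule x y hy
    have h2 := hcM x y
    have h3 := abs_le.1 (hB y hy)
    have h4 : -B ≤ Qb p Ω Y v x := le_ciInf fun y => by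
      have := (abs_le.1 (hB y y.2)).1
      have := hc0 x y
      linarith
    have h5 : 0 ≤ diam Ω ^ p := Real.rpow_nonneg diam_nonneg _
    rw [abs_le]
    constructor <;> linarith
  refine ⟨π, hπ, hWb, ⟨L, huL⟩, hule, ?_, ?_⟩
  · intro x hx y hy
    have himg : IsCompact (v '' Y) := hYc.image_of_continuousOn hLv.continuousOn
    obtain ⟨y', hy', hxy⟩ := hYc.exists_infDist_eq_dist hYn x
    have h1 := hule x y' hy'
    have h2 : bdist p Ω x y' ^ p ≤ infDist x Y ^ p := by
      rw [hxy]
      exact Real.rpow_le_rpow (bdist_nonneg _ _) (bdist_le_dist _ _) (by linarith)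
    have h3 : infDist x Y ≤ supInfDist Ω Y := by
      refine le_csSup ?_ (mem_image_of_mem _ hx)
      refine (hb.isCompact_closure.image (continuous_infDist_pt Y)).bddAbove.mono ?_
      exact image_mono subset_closure
    have h4 := Real.rpow_le_rpow infDist_nonneg h3 (by linarith : 0 ≤ p)
    have h5 : v y' ≤ sSup (v '' Y) := le_csSup himg.bddAbove (mem_image_of_mem _ hy')
    have h6 : sInf (v '' Y) ≤ v y := csInf_le himg.bddBelow (mem_image_of_mem _ hy)
    rw [oscOn]
    linarith
  · obtain ⟨g, hg, hgv⟩ := hLv.extend_real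
    have hπΩ1 : ∀ᵐ z ∂π, z.1 ∈ Ω := ae_fst_of_mem_couplings hπ hlam
    have hπΩ2 : ∀ᵐ z ∂π, z.2 ∈ Ω := ae_snd_of_mem_couplings hπ hμ
    have hπY : ∀ᵐ z ∂π, z.2 ∈ Y := ae_snd_of_mem_couplings hπ hμY
    have hgm : AEStronglyMeasurable g μ := hg.continuous.measurable.aestronglyMeasurable
    have hum : AEStronglyMeasurable (Qb p Ω Y v) lam :=
      huL.continuous.measurable.aestronglyMeasurable
    have h1 : ∫ y in Y, v y ∂μ = ∫ z, g z.2 ∂π := by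
      rw [integral_snd_of_mem_couplings hπ hgm,
        Measure.restrict_eq_self_of_ae_mem (show ∀ᵐ y ∂μ, y ∈ Y from hμY)]
      refine integral_congr_ae ?_
      exact (show ∀ᵐ y ∂μ, y ∈ Y from hμY).mono fun y hy => hgv hy
    have h2 : ∫ x, Qb p Ω Y v x ∂lam = ∫ z, Qb p Ω Y v z.1 ∂π :=
      (integral_fst_of_mem_couplings hπ hum).symm
    have i1 : Integrable (fun z : EuclideanSpace ℝ (Fin d) × EuclideanSpace ℝ (Fin d) =>
        Qb p Ω Y v z.1) π :=
      integrable_of_continuous_bounded (huL.continuous.comp continuous_fst) fun z => huB z.1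
    have i2 : Integrable (fun z : EuclideanSpace ℝ (Fin d) × EuclideanSpace ℝ (Fin d) => g z.2) π :=
      Integrable.of_bound (hg.continuous.comp continuous_snd).measurable.aestronglyMeasurable B
        (hπY.mono fun z hz => by rw [← hgv hz]; exact hB _ hz)
    have i3 : Integrable (fun z : EuclideanSpace ℝ (Fin d) × EuclideanSpace ℝ (Fin d) =>
        bdist p Ω z.1 z.2 ^ p) π :=
      integrable_of_continuous_bounded hcc fun z => by
        rw [abs_of_nonneg (hc0 _ _)]; exact hcM _ _
    have h3 := hv.2
    rw [h1, h2, hWb, ← integral_sub i1 i2] at h3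
    have h4 := (integral_eq_iff_of_ae_le (i1.sub i2) i3
      (hπY.mono fun z hz => by
        simp only [Pi.sub_apply]
        rw [← hgv hz]
        exact hule _ _ hz)).1 h3
    filter_upwards [hπΩ1, hπΩ2, hπY, h4] with z a1 a2 a3 a4
    refine ⟨a1, a2, a3, ?_⟩
    rw [hgv a3]
    exact a4

end BoundaryTransport

section ContactSet

variable {d : ℕ} {p r : ℝ} {Ω Y : Set (EuclideanSpace ℝ (Fin d))}
  {u v : EuclideanSpace ℝ (Fin d) → ℝ} {x y x₀ y₀ : EuclideanSpace ℝ (Fin d)}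

theorem exists_midpoint_radius (hp : 1 < p) :
    ∃ δ : ℝ, 0 < δ ∧ δ ≤ 1 / 2 ∧ 2 * (1 / 2 + 2 * δ) ^ p < 1 := by
  have hcont : Continuous fun δ : ℝ => 2 * (1 / 2 + 2 * δ) ^ p :=
    continuous_const.mul ((continuous_const.add (continuous_const.mul continuous_id)).rpow_const
      fun _ => Or.inr (by linarith))
  have h0 : ∀ᶠ δ in 𝓝[>] (0 : ℝ), 2 * (1 / 2 + 2 * δ) ^ p < 1 := by
    refine (hcont.tendsto 0).eventually_lt_const ?_ |>.filter_mono nhdsWithin_le_nhds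
    have := half_sub_half_rpow_pos hp
    norm_num
    norm_num at this
    linarith
  have h1 : ∀ᶠ δ in 𝓝[>] (0 : ℝ), δ ≤ 1 / 2 :=
    (eventually_le_nhds (by norm_num)).filter_mono nhdsWithin_le_nhds
  obtain ⟨δ, ⟨h2, h3⟩, h4⟩ := ((h0.and h1).and eventually_mem_nhdsWithin).exists
  exact ⟨δ, h4, h3, h2⟩

theorem bdist_eq_dist_or (hp : 1 < p) (x y : EuclideanSpace ℝ (Fin d)) :
    bdist p Ω x y = dist x y ∨
      (infDist x Ωᶜ ≤ bdist p Ω x y ∧ infDist y Ωᶜ ≤ bdist p Ω x y) := by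
  have hx : 0 ≤ infDist x Ωᶜ ^ p := Real.rpow_nonneg infDist_nonneg _
  have hy : 0 ≤ infDist y Ωᶜ ^ p := Real.rpow_nonneg infDist_nonneg _
  have hp0 : p ≠ 0 := by linarith
  have key : ∀ t s : ℝ, 0 ≤ t → 0 ≤ s → t ≤ (t ^ p + s) ^ (1 / p) := fun t s ht hs => by
    calc t = (t ^ p) ^ (1 / p) := by rw [← Real.rpow_mul ht, mul_one_div_cancel hp0, Real.rpow_one]
      _ ≤ _ := Real.rpow_le_rpow (Real.rpow_nonneg ht _) (by linarith)
        (by have : 0 < p := by linarith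
            positivity)
  rcases le_total (dist x y) ((infDist x Ωᶜ ^ p + infDist y Ωᶜ ^ p) ^ (1 / p)) with h | h
  · exact Or.inl (min_eq_left h)
  · right
    rw [bdist, min_eq_right h]
    refine ⟨key _ _ infDist_nonneg hy, ?_⟩
    rw [add_comm]
    exact key _ _ infDist_nonneg hx

theorem infDist_sub_dist_le (x y : EuclideanSpace ℝ (Fin d)) :
    infDist x Ωᶜ - dist x y ≤ infDist y Ωᶜ := by
  have := infDist_le_infDist_add_dist (s := Ωᶜ) (x := x) (y := y)
  linarith

theorem le_bdist_of_dist_midpoint_lt (hp : 1 < p) {δ : ℝ} (hδ : 0 < δ) (hδ1 : δ ≤ 1 / 2)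
    (hδp : 2 * (1 / 2 + 2 * δ) ^ p < 1)
    (h00 : u x₀ - v y₀ = bdist p Ω x₀ y₀ ^ p) (h11 : u x - v y = bdist p Ω x y ^ p)
    (h01 : u x₀ - v y ≤ bdist p Ω x₀ y ^ p) (h10 : u x - v y₀ ≤ bdist p Ω x y₀ ^ p)
    (hb : bdist p Ω x₀ y₀ = dist x₀ y₀) (hin : 3 * dist x₀ y₀ ≤ infDist x₀ Ωᶜ)
    (hpos : 0 < dist x₀ y₀) (hx : dist x (midpoint ℝ x₀ y₀) < δ * dist x₀ y₀) :
    δ * dist x₀ y₀ ≤ bdist p Ω x y := by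
  set D := dist x₀ y₀
  have hm1 : dist x₀ (midpoint ℝ x₀ y₀) = D / 2 := by
    rw [dist_left_midpoint (𝕜 := ℝ)]; norm_num; ring
  have hm2 : dist (midpoint ℝ x₀ y₀) y₀ = D / 2 := by
    rw [dist_midpoint_right (𝕜 := ℝ)]; norm_num; ring
  have hxx₀ : dist x₀ x ≤ D / 2 + δ * D := by
    have := dist_triangle x₀ (midpoint ℝ x₀ y₀) x
    rw [dist_comm (midpoint ℝ x₀ y₀) x] at this
    linarith
  have hxy₀ : dist x y₀ ≤ D / 2 + δ * D := by
    have := dist_triangle x (midpoint ℝ x₀ y₀) y₀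
    linarith
  by_contra! hlt
  rcases bdist_eq_dist_or (Ω := Ω) hp x y with h | h
  · have hx₀y : dist x₀ y ≤ (1 / 2 + 2 * δ) * D := by
      have := dist_triangle x₀ x y
      rw [← h] at this
      linarith
    have hb0 : ∀ a b, 0 ≤ bdist p Ω a b := bdist_nonneg
    have h2 : bdist p Ω x₀ y ^ p ≤ (1 / 2 + 2 * δ) ^ p * D ^ p := by
      rw [← Real.mul_rpow (by linarith) hpos.le]
      exact Real.rpow_le_rpow (hb0 _ _) ((bdist_le_dist _ _).trans hx₀y) (by linarith)
    have h3 : bdist p Ω x y₀ ^ p ≤ (1 / 2 + 2 * δ) ^ p * D ^ p := by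
      rw [← Real.mul_rpow (by linarith) hpos.le]
      refine Real.rpow_le_rpow (hb0 _ _) ((bdist_le_dist _ _).trans (hxy₀.trans ?_)) (by linarith)
      nlinarith
    have h4 : 0 ≤ bdist p Ω x y ^ p := Real.rpow_nonneg (hb0 _ _) _
    have h5 : 0 < D ^ p := by positivity
    rw [hb] at h00
    nlinarith
  · have := infDist_sub_dist_le (Ω := Ω) x₀ x
    nlinarith [h.1]

theorem gradient_of_contact (hp : 1 < p) (hdiff : DifferentiableAt ℝ u x)
    (hle : ∀ z, u z - v y ≤ dist z y ^ p) (heq : u x - v y = dist x y ^ p) :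
    gradient u x = (p * ‖x - y‖ ^ (p - 2)) • (x - y) := by
  have h1 : HasFDerivAt (fun z => ‖z - y‖ ^ p) ((p * ‖x - y‖ ^ (p - 2)) • innerSL ℝ (x - y)) x := by
    have := (hasFDerivAt_norm_rpow (x - y) hp).comp x ((hasFDerivAt_id x).sub_const y)
    simpa [Function.comp_def] using this
  have h2 : IsLocalMin (fun z => ‖z - y‖ ^ p - u z) x := by
    refine Filter.Eventually.of_forall fun z => ?_
    have := hle z
    rw [dist_eq_norm] at this heq
    linarith
  have h3 := h2.hasFDerivAt_eq_zero (h1.sub hdiff.hasFDerivAt)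
  refine ext_inner_right ℝ fun w => ?_
  rw [← fderiv_eq_inner_gradient, ← sub_eq_zero.1 h3]
  simp [inner_smul_left, inner_sub_left]

theorem vpow_gradient_of_contact (hp : 1 < p) (hdiff : DifferentiableAt ℝ u x)
    (hle : ∀ z, u z - v y ≤ dist z y ^ p) (heq : u x - v y = dist x y ^ p) :
    vpow (gradient u x) ((p / (p - 1)) / p) = p ^ (1 / (p - 1)) • (x - y) := by
  have hp1 : p - 1 ≠ 0 := by linarith
  have hp0 : 0 < p := by linarith
  rw [gradient_of_contact hp hdiff hle heq, show p / (p - 1) / p = 1 / (p - 1) by field_simp]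
  rcases eq_or_ne (x - y) 0 with h | h
  · simp [vpow, h]
  · have hn : 0 < ‖x - y‖ := norm_pos_iff.2 h
    rw [vpow, norm_smul, Real.norm_of_nonneg (by positivity), smul_smul]
    congr 1
    rw [mul_assoc, ← Real.rpow_add_one hn.ne', Real.mul_rpow hp0.le (by positivity),
      ← Real.rpow_mul hn.le]
    calc p ^ (1 / (p - 1) - 1) * ‖x - y‖ ^ ((p - 2 + 1) * (1 / (p - 1) - 1)) *
          (p * ‖x - y‖ ^ (p - 2)) = (p ^ (1 / (p - 1) - 1) * p) *
          (‖x - y‖ ^ ((p - 2 + 1) * (1 / (p - 1) - 1)) * ‖x - y‖ ^ (p - 2)) := by ring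
      _ = p ^ (1 / (p - 1)) := by
        rw [← Real.rpow_add_one hp0.ne', ← Real.rpow_add hn, sub_add_cancel,
          show (p - 2 + 1) * (1 / (p - 1) - 1) + (p - 2) = 0 by field_simp; ring, Real.rpow_zero,
          mul_one]

theorem abs_taylor_le {η : EuclideanSpace ℝ (Fin d) → ℝ} (hη : ContDiff ℝ 2 η) {A : ℝ}
    (hA : ∀ x, ‖iteratedFDeriv ℝ 2 η x‖ ≤ A) (x y : EuclideanSpace ℝ (Fin d)) :
    |η y - η x - ⟪y - x, gradient η x⟫| ≤ A * dist x y ^ 2 := by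
  have hA0 : 0 ≤ A := (norm_nonneg _).trans (hA 0)
  have hd1 : Differentiable ℝ η := hη.differentiable (by norm_num)
  have hd2 : Differentiable ℝ (fderiv ℝ η) :=
    (hη.fderiv_right (m := 1) (by norm_num)).differentiable (by norm_num)
  have h2 : ∀ z, ‖fderiv ℝ (fderiv ℝ η) z‖ ≤ A := fun z => by
    rw [← norm_iteratedFDeriv_one, norm_iteratedFDeriv_fderiv]
    exact hA z
  have hlip : ∀ z ∈ segment ℝ x y, ‖fderiv ℝ η z - fderiv ℝ η x‖ ≤ A * dist x y := fun z hz => by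
    have := convex_univ.norm_image_sub_le_of_norm_fderiv_le (𝕜 := ℝ) (f := fderiv ℝ η) (C := A)
      (fun w _ => hd2 w) (fun w _ => h2 w) (mem_univ x) (mem_univ z)
    refine this.trans (mul_le_mul_of_nonneg_left ?_ hA0)
    have := dist_add_dist_of_mem_segment hz
    rw [← dist_eq_norm, dist_comm]
    linarith [dist_nonneg (x := z) (y := y)]
  have h3 := (convex_segment x y).norm_image_sub_le_of_norm_fderiv_le' (𝕜 := ℝ)
    (fun w _ => hd1 w) hlip (left_mem_segment ℝ x y) (right_mem_segment ℝ x y)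
  rw [fderiv_eq_inner_gradient, real_inner_comm, Real.norm_eq_abs, ← dist_eq_norm y x,
    dist_comm y x] at h3
  rwa [pow_two, ← mul_assoc]

end ContactSet

section ContactEstimates

variable {d : ℕ} {p r c : ℝ} {Ω Y : Set (EuclideanSpace ℝ (Fin d))}
  {u v η : EuclideanSpace ℝ (Fin d) → ℝ} {x y x₀ y₀ : EuclideanSpace ℝ (Fin d)}

theorem cutoff_mul_dist_rpow_le (hp : 1 < p) (hη1 : ∀ x, infDist x Ωᶜ ≤ r → η x = 1)
    (hb : bdist p Ω x y ≤ r) : (1 - η y) * ‖x - y‖ ^ p ≤ (1 - η y) * bdist p Ω x y ^ p := by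
  rcases bdist_eq_dist_or (Ω := Ω) hp x y with h | h
  · rw [h, dist_eq_norm]
  · simp [hη1 y (h.2.trans hb)]

theorem gradient_cutoff_eq_zero (hη1 : ∀ x, infDist x Ωᶜ ≤ r → η x = 1) (hx : infDist x Ωᶜ < r) :
    gradient η x = 0 := by
  have h : η =ᶠ[𝓝 x] fun _ => (1 : ℝ) :=
    ((continuous_infDist_pt Ωᶜ).continuousAt.eventually_lt_const hx).mono fun z hz => hη1 z hz.le
  rw [gradient, h.fderiv_eq]
  simp

theorem cutoff_taylor_of_contact (hp : 1 < p) (hr : 0 < r) (hη : ContDiff ℝ 2 η)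
    (hη1 : ∀ x, infDist x Ωᶜ ≤ r → η x = 1)
    (hη2 : ∀ x, ‖iteratedFDeriv ℝ 2 η x‖ ≤ c / r ^ 2) (hb : bdist p Ω x y ≤ r / 4)
    (hle : ∀ z, u z - v y ≤ bdist p Ω z y ^ p) (heq : u x - v y = bdist p Ω x y ^ p)
    (hdiff : DifferentiableAt ℝ u x) :
    η y - η x + p ^ (-(1 / (p - 1))) *
        ⟪vpow (gradient u x) ((p / (p - 1)) / p), gradient η x⟫ = 0 ∨
      (bdist p Ω x y = dist x y ∧ 3 * dist x y ≤ infDist x Ωᶜ ∧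
        |η y - η x + p ^ (-(1 / (p - 1))) *
          ⟪vpow (gradient u x) ((p / (p - 1)) / p), gradient η x⟫| ≤
            c / r ^ 2 * dist x y ^ 2) := by
  rcases le_or_gt (3 * r / 4) (infDist x Ωᶜ) with hx | hx
  · right
    have hbd : bdist p Ω x y = dist x y := by
      rcases bdist_eq_dist_or (Ω := Ω) hp x y with h | h
      · exact h
      · linarith [h.1]
    refine ⟨hbd, by linarith, ?_⟩
    rw [vpow_gradient_of_contact hp hdiff (fun z => (hle z).trans
      (Real.rpow_le_rpow (bdist_nonneg _ _) (bdist_le_dist _ _) (by linarith)))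
      (by rw [heq, hbd]), real_inner_smul_left, ← mul_assoc, ← Real.rpow_add (by linarith),
      neg_add_cancel, Real.rpow_zero, one_mul]
    have := abs_taylor_le hη hη2 x y
    rwa [← neg_sub x y, inner_neg_left, sub_neg_eq_add] at this
  · left
    have hy : infDist y Ωᶜ ≤ r := by
      rcases bdist_eq_dist_or (Ω := Ω) hp x y with h | h
      · have := infDist_sub_dist_le (Ω := Ω) y x
        rw [dist_comm] at this
        linarith
      · linarith [h.2]
    rw [hη1 y hy, hη1 x (by linarith), gradient_cutoff_eq_zero hη1 (by linarith)]
    simp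

/-- The `L^∞` bound on the displacement of contact pairs away from the boundary. -/
theorem exists_dist_rpow_le_of_contact (d : ℕ) (hp : 1 < p) : ∃ C : ℝ, 0 < C ∧
    ∀ (Ω Y : Set (EuclideanSpace ℝ (Fin d))) (u v : EuclideanSpace ℝ (Fin d) → ℝ)
      (μ lam : Measure (EuclideanSpace ℝ (Fin d)))
      (π : Measure (EuclideanSpace ℝ (Fin d) × EuclideanSpace ℝ (Fin d))), IsFiniteMeasure π →
      π ∈ couplings μ lam → ENNReal.ofReal (1 / 2) • volume.restrict Ω ≤ lam →
      (∀ x, ∀ y ∈ Y, u x - v y ≤ bdist p Ω x y ^ p) →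
      (∀ᵐ z ∂π, z.2 ∈ Y ∧ u z.1 - v z.2 = bdist p Ω z.1 z.2 ^ p) →
      Integrable (fun z : EuclideanSpace ℝ (Fin d) × EuclideanSpace ℝ (Fin d) =>
        bdist p Ω z.1 z.2 ^ p) π →
      ∀ x₀, ∀ y₀ ∈ Y, u x₀ - v y₀ = bdist p Ω x₀ y₀ ^ p → bdist p Ω x₀ y₀ = dist x₀ y₀ →
        3 * dist x₀ y₀ ≤ infDist x₀ Ωᶜ →
        dist x₀ y₀ ^ p ≤ C * (∫ z, bdist p Ω z.1 z.2 ^ p ∂π) ^ (p / (d + p)) := by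
  obtain ⟨δ, hδ, hδ1, hδp⟩ := exists_midpoint_radius hp
  set ω := (volume (ball (0 : EuclideanSpace ℝ (Fin d)) 1)).toReal with hω
  have hω0 : 0 < ω := ENNReal.toReal_pos (measure_ball_pos _ _ one_pos).ne' measure_ball_lt_top.ne
  have hdp : 0 < (d : ℝ) + p := by positivity
  have hp0 : 0 < p := by linarith
  refine ⟨(2 / (ω * δ ^ ((d : ℝ) + p))) ^ (p / (d + p)), by positivity, ?_⟩
  intro Ω Y u v μ lam π _ hπ hlam hle hcontact hint x₀ y₀ hy₀ h00 hb hin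
  set I := ∫ z, bdist p Ω z.1 z.2 ^ p ∂π
  have hb0 : ∀ x y : EuclideanSpace ℝ (Fin d), 0 ≤ bdist p Ω x y ^ p :=
    fun x y => Real.rpow_nonneg (bdist_nonneg x y) p
  have hI : 0 ≤ I := integral_nonneg fun z => hb0 _ _
  rcases (dist_nonneg (x := x₀) (y := y₀)).eq_or_lt with h0 | hpos
  · rw [← h0, Real.zero_rpow hp0.ne']
    exact mul_nonneg (Real.rpow_nonneg (by positivity) _) (Real.rpow_nonneg hI _)
  set D := dist x₀ y₀
  set B := ball (midpoint ℝ x₀ y₀) (δ * D)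
  have hBΩ : B ⊆ Ω := fun x hx => by
    by_contra hxΩ
    have h1 : infDist x Ωᶜ = 0 := infDist_zero_of_mem hxΩ
    have h2 := infDist_sub_dist_le (Ω := Ω) x₀ x
    have h3 := dist_triangle x₀ (midpoint ℝ x₀ y₀) x
    have h4 : dist x₀ (midpoint ℝ x₀ y₀) = D / 2 := by
      rw [dist_left_midpoint (𝕜 := ℝ)]; norm_num; ring
    have h5 : dist x (midpoint ℝ x₀ y₀) < δ * D := hx
    rw [dist_comm] at h5
    nlinarith
  have hvolB : (volume B).toReal = (δ * D) ^ d * ω := by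
    rw [Measure.addHaar_ball_of_pos _ _ (by positivity), ENNReal.toReal_mul,
      ENNReal.toReal_ofReal (by positivity), finrank_euclideanSpace, Fintype.card_fin]
  have hπB : ENNReal.ofReal (1 / 2) * volume B ≤
      π {z | (δ * D) ^ p ≤ bdist p Ω z.1 z.2 ^ p} := by
    calc ENNReal.ofReal (1 / 2) * volume B ≤ lam B := by
          have := hlam B
          rwa [Measure.smul_apply, Measure.restrict_apply isOpen_ball.measurableSet,
            inter_eq_left.2 hBΩ, smul_eq_mul] at this
      _ = π (Prod.fst ⁻¹' B) := by
          rw [← hπ.1, Measure.map_apply measurable_fst isOpen_ball.measurableSet]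
      _ ≤ _ := by
          refine measure_mono_ae ?_
          filter_upwards [hcontact] with z hz hzB
          refine Real.rpow_le_rpow (by positivity) ?_ hp0.le
          exact le_bdist_of_dist_midpoint_lt hp hδ hδ1 hδp h00 hz.2 (hle _ _ hz.1) (hle _ _ hy₀)
            hb hin hpos hzB
  have hmarkov := mul_meas_ge_le_integral_of_nonneg (μ := π) (.of_forall fun z => hb0 z.1 z.2)
    hint ((δ * D) ^ p)
  have hreal : 1 / 2 * ((δ * D) ^ d * ω) ≤
      π.real {z | (δ * D) ^ p ≤ bdist p Ω z.1 z.2 ^ p} := by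
    have := ENNReal.toReal_mono (measure_ne_top π _) hπB
    rwa [ENNReal.toReal_mul, ENNReal.toReal_ofReal (by norm_num), hvolB] at this
  have h1 : (δ * D) ^ p * (1 / 2 * ((δ * D) ^ d * ω)) ≤ I :=
    (mul_le_mul_of_nonneg_left hreal (by positivity)).trans hmarkov
  have h2 : (δ * D) ^ p * (1 / 2 * ((δ * D) ^ d * ω)) =
      D ^ ((d : ℝ) + p) * (ω * δ ^ ((d : ℝ) + p)) / 2 := by
    have : (δ * D) ^ p * (δ * D) ^ d = δ ^ ((d : ℝ) + p) * D ^ ((d : ℝ) + p) := by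
      rw [← Real.mul_rpow hδ.le hpos.le, ← Real.rpow_natCast, ← Real.rpow_add (by positivity),
        add_comm]
    linear_combination (ω / 2) * this
  have h3 : D ^ ((d : ℝ) + p) ≤ 2 / (ω * δ ^ ((d : ℝ) + p)) * I := by
    rw [h2] at h1
    rw [div_mul_eq_mul_div, le_div_iff₀ (by positivity)]
    linarith
  calc D ^ p = (D ^ ((d : ℝ) + p)) ^ (p / (d + p)) := by
        rw [← Real.rpow_mul hpos.le, mul_div_cancel₀ _ hdp.ne']
    _ ≤ (2 / (ω * δ ^ ((d : ℝ) + p)) * I) ^ (p / (d + p)) :=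
        Real.rpow_le_rpow (by positivity) h3 (by positivity)
    _ = _ := Real.mul_rpow (by positivity) hI

end ContactEstimates

section PairingEstimate

theorem integral_abs_mul_le_of_bounded {α : Type*} [MeasurableSpace α] {m : Measure α}
    [IsFiniteMeasure m] {p : ℝ} (hp : 1 < p) {f g : α → ℝ} (hf : AEStronglyMeasurable f m)
    (hg : AEStronglyMeasurable g m) {Bf Bg : ℝ} (hBf : ∀ x, |f x| ≤ Bf) (hBg : ∀ x, |g x| ≤ Bg) :
    ∫ x, |f x * g x| ∂m ≤
      (∫ x, |f x| ^ p ∂m) ^ (1 / p) * (∫ x, |g x| ^ (p / (p - 1)) ∂m) ^ ((p - 1) / p) := by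
  have hpq : p.HolderConjugate (p / (p - 1)) := Real.HolderConjugate.conjExponent hp
  have := integral_mul_norm_le_Lp_mul_Lq hpq (MemLp.of_bound hf Bf (.of_forall hBf))
    (MemLp.of_bound hg Bg (.of_forall hBg))
  simp only [Real.norm_eq_abs, one_div_div] at this
  simpa only [abs_mul] using this

variable {d : ℕ} {p : ℝ} {Ω : Set (EuclideanSpace ℝ (Fin d))}

theorem mean_zero_pairing_le (hp : 1 < p) (hc : Convex ℝ Ω) (hb : Bornology.IsBounded Ω)
    (h0 : volume Ω ≠ 0) {μ lam : Measure (EuclideanSpace ℝ (Fin d))}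
    {π : Measure (EuclideanSpace ℝ (Fin d) × EuclideanSpace ℝ (Fin d))} [IsFiniteMeasure π]
    (hπ : π ∈ couplings μ lam) {κ : ℝ} (hκ0 : 0 ≤ κ) (hκ2 : κ ≤ 2)
    (hlam : lam = ENNReal.ofReal κ • volume.restrict Ω)
    {η F : EuclideanSpace ℝ (Fin d) → ℝ} (hηc : Continuous η) (hη : ∀ x, η x ∈ Icc (0 : ℝ) 1)
    (hF : Measurable F) {BF : ℝ} (hBF : ∀ x, |F x| ≤ BF) {P : ℝ} (hP0 : 0 ≤ P) (hP1 : P ≤ 1)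
    {S : ℝ} (hS : ∫ z, |η z.2 - η z.1 + P * F z.1| ^ p ∂π ≤ S)
    {κ' θ : ℝ} (hκ' : κ' * ∫ x in Ω, η x = ∫ x, η x ∂μ) (hθ : |κ' - κ| ≤ 2 * θ)
    {w : EuclideanSpace ℝ (Fin d) → ℝ} {K : ℝ≥0} (hw : LipschitzWith K w) {B : ℝ}
    (hB : ∀ x, |w x| ≤ B) :
    (κ' * ∫ x in Ω, η x * w x) - ∫ z, η z.2 * w z.1 ∂π ≤
      (2 * 2 ^ (d * (p - 1) / p) * diam Ω * (θ * (∫ x in Ω, η x ^ p) ^ (1 / p) + S ^ (1 / p)) +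
        2 * HnegNorm p Ω (fun x => F x - (volume Ω).toReal⁻¹ * ∫ z in Ω, F z)) *
      (∫ x in Ω, ‖gradient w x‖ ^ (p / (p - 1))) ^ ((p - 1) / p) := by
  have hfinν : IsFiniteMeasure (volume.restrict Ω) := ⟨by simpa using hb.measure_lt_top⟩
  have hp0 : 0 < p := by linarith
  have hq : 1 ≤ p / (p - 1) := by rw [le_div_iff₀] <;> linarith
  have hexp : 0 ≤ (p - 1) / p := div_nonneg (by linarith) hp0.le
  have hV0 : 0 < (volume Ω).toReal := ENNReal.toReal_pos h0 hb.measure_lt_top.ne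
  set ν := (volume : Measure (EuclideanSpace ℝ (Fin d))).restrict Ω with hν
  set G := ∫ x, ‖gradient w x‖ ^ (p / (p - 1)) ∂ν
  set m := (volume Ω).toReal⁻¹ * ∫ z, w z ∂ν with hm
  set f := fun x => F x - (volume Ω).toReal⁻¹ * ∫ z, F z ∂ν with hf
  set R := fun z : EuclideanSpace ℝ (Fin d) × EuclideanSpace ℝ (Fin d) =>
    η z.2 - η z.1 + P * F z.1 with hR
  have hθ0 : 0 ≤ θ := by linarith [abs_nonneg (κ' - κ)]
  have hG : 0 ≤ G := integral_nonneg fun _ => by positivity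
  have hηa : ∀ x, |η x| ≤ 1 := fun x => abs_le.2 ⟨by linarith [(hη x).1], (hη x).2⟩
  have hw0B : ∀ x, |w x - m| ≤ B + |m| := fun x => (abs_sub _ _).trans (by linarith [hB x])
  have hwm : Measurable w := hw.continuous.measurable
  have hw0m : Measurable fun x => w x - m := hwm.sub_const m
  have hreal : ν.real univ = (volume Ω).toReal := by simp [hν, Measure.real]
  have iw : Integrable w ν := Integrable.of_bound hwm.aestronglyMeasurable B (.of_forall hB)
  have iF : Integrable F ν := Integrable.of_bound hF.aestronglyMeasurable BF (.of_forall hBF)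
  have hw00 : ∫ x, (w x - m) ∂ν = 0 := by
    rw [integral_sub iw (integrable_const m), integral_const, hreal, smul_eq_mul, hm,
      mul_inv_cancel_left₀ hV0.ne', sub_self]
  have hf0 : ∫ x, f x ∂ν = 0 := by
    rw [hf, integral_sub iF (integrable_const _), integral_const, hreal, smul_eq_mul,
      mul_inv_cancel_left₀ hV0.ne', sub_self]
  have hfm : Measurable f := hF.sub_const _
  have hfB : ∀ x, |f x| ≤ BF + |(volume Ω).toReal⁻¹ * ∫ z, F z ∂ν| := fun x =>
    (abs_sub _ _).trans (by linarith [hBF x])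
  have hH := integral_mul_le_negativeSobolev hc hb h0 hp hfm (.of_forall hfB) hf0 hw
  have hH0 : 0 ≤ HnegNorm p Ω f := negativeSobolev_nonneg hc hb h0 hp hfm (.of_forall hfB) hf0
  have hpoin : (∫ x, |w x - m| ^ (p / (p - 1)) ∂ν) ^ ((p - 1) / p) ≤
      2 ^ (d * (p - 1) / p) * diam Ω * G ^ ((p - 1) / p) := by
    refine (Real.rpow_le_rpow (integral_nonneg fun _ => by positivity)
      (poincare_of_isBounded hc hb h0 hw hq) hexp).trans_eq ?_
    have hD : (0 : ℝ) ≤ diam Ω := diam_nonneg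
    rw [Real.mul_rpow (by positivity) hG, Real.mul_rpow (by positivity) (by positivity),
      ← Real.rpow_natCast, ← Real.rpow_mul zero_le_two, ← Real.rpow_mul hD,
      div_mul_div_cancel₀ (by linarith), div_self hp0.ne', Real.rpow_one, mul_div_assoc]
  have hfst : ∀ {g : EuclideanSpace ℝ (Fin d) → ℝ}, Measurable g →
      ∫ z, g z.1 ∂π = κ * ∫ x, g x ∂ν := fun {g} hg => by
    rw [integral_fst_of_mem_couplings hπ hg.aestronglyMeasurable, hlam, integral_smul_measure,
      ENNReal.toReal_ofReal hκ0, smul_eq_mul]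
  have hT1 : (κ' - κ) * ∫ x, η x * (w x - m) ∂ν ≤
      2 * θ * (∫ x, η x ^ p ∂ν) ^ (1 / p) *
        (2 ^ (d * (p - 1) / p) * diam Ω * G ^ ((p - 1) / p)) := by
    have h1 := integral_abs_mul_le_of_bounded (m := ν) hp hηc.measurable.aestronglyMeasurable
      hw0m.aestronglyMeasurable hηa hw0B
    have h2 : ∀ x, |η x| = η x := fun x => abs_of_nonneg (hη x).1
    simp only [h2] at h1
    have h3 := abs_integral_le_integral_abs (μ := ν) (f := fun x => η x * (w x - m))
    have h4 : 0 ≤ (∫ x, η x ^ p ∂ν) ^ (1 / p) :=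
      Real.rpow_nonneg (integral_nonneg fun x => Real.rpow_nonneg (hη x).1 _) _
    calc _ ≤ |κ' - κ| * |∫ x, η x * (w x - m) ∂ν| := by rw [← abs_mul]; exact le_abs_self _
      _ ≤ (2 * θ) * ((∫ x, η x ^ p ∂ν) ^ (1 / p) *
          (2 ^ (d * (p - 1) / p) * diam Ω * G ^ ((p - 1) / p))) :=
        mul_le_mul hθ (h3.trans (h1.trans (mul_le_mul_of_nonneg_left hpoin h4)))
          (abs_nonneg _) (by positivity)
      _ = _ := by ring
  have hRm : Measurable R := by
    refine ((hηc.measurable.comp measurable_snd).sub (hηc.measurable.comp measurable_fst)).add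
      ((hF.comp measurable_fst).const_mul P)
  have hRB : ∀ z, |R z| ≤ 2 + P * BF := fun z => by
    have h1 : |P * F z.1| ≤ P * BF := by
      rw [abs_mul, abs_of_nonneg hP0]
      exact mul_le_mul_of_nonneg_left (hBF _) hP0
    have h2 := abs_add_le (η z.2 - η z.1) (P * F z.1)
    have h3 := abs_sub (η z.2) (η z.1)
    simp only [hR]
    linarith [hηa z.1, hηa z.2]
  have hT3 : -∫ z, R z * (w z.1 - m) ∂π ≤
      2 * S ^ (1 / p) * (2 ^ (d * (p - 1) / p) * diam Ω * G ^ ((p - 1) / p)) := by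
    have h1 := integral_abs_mul_le_of_bounded (m := π) hp hRm.aestronglyMeasurable
      (hw0m.comp measurable_fst).aestronglyMeasurable hRB (fun z => hw0B z.1)
    have h2 : ∫ z : EuclideanSpace ℝ (Fin d) × EuclideanSpace ℝ (Fin d),
        |((fun x => w x - m) ∘ Prod.fst) z| ^ (p / (p - 1)) ∂π =
        κ * ∫ x, |w x - m| ^ (p / (p - 1)) ∂ν :=
      hfst (g := fun x => |w x - m| ^ (p / (p - 1))) (hw0m.abs.pow_const _)
    have h3 : 0 ≤ ∫ x, |w x - m| ^ (p / (p - 1)) ∂ν := integral_nonneg fun _ => by positivity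
    have h4 : κ ^ ((p - 1) / p) ≤ 2 := by
      calc κ ^ ((p - 1) / p) ≤ 2 ^ ((p - 1) / p) := Real.rpow_le_rpow hκ0 hκ2 hexp
        _ ≤ 2 ^ (1 : ℝ) := Real.rpow_le_rpow_of_exponent_le one_le_two (by
            rw [div_le_one hp0]; linarith)
        _ = 2 := Real.rpow_one 2
    have h5 : 0 ≤ ∫ z, |R z| ^ p ∂π := integral_nonneg fun _ => by positivity
    have h6 := Real.rpow_le_rpow h5 hS (by positivity : 0 ≤ 1 / p)
    rw [h2, Real.mul_rpow hκ0 h3] at h1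
    calc _ ≤ |∫ z, R z * (w z.1 - m) ∂π| := neg_le_abs _
      _ ≤ ∫ z, |R z * (w z.1 - m)| ∂π := abs_integral_le_integral_abs
      _ ≤ _ := h1
      _ ≤ S ^ (1 / p) * (2 * (2 ^ (d * (p - 1) / p) * diam Ω * G ^ ((p - 1) / p))) := by
          refine mul_le_mul h6 (mul_le_mul h4 hpoin (by positivity) zero_le_two)
            (by positivity) (h6.trans' (by positivity))
      _ = _ := by ring
  have hT2 : P * (κ * ∫ x, f x * w x ∂ν) ≤ 2 * HnegNorm p Ω f * G ^ ((p - 1) / p) := by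
    have h1 : P * κ ≤ 2 := by nlinarith
    have h2 : 0 ≤ HnegNorm p Ω f * G ^ ((p - 1) / p) := by positivity
    calc _ = (P * κ) * ∫ x, f x * w x ∂ν := by ring
      _ ≤ (P * κ) * (HnegNorm p Ω f * G ^ ((p - 1) / p)) :=
          mul_le_mul_of_nonneg_left hH (by positivity)
      _ ≤ 2 * (HnegNorm p Ω f * G ^ ((p - 1) / p)) := mul_le_mul_of_nonneg_right h1 h2
      _ = _ := by ring
  have hηm : Measurable η := hηc.measurable
  have iη : Integrable η ν := Integrable.of_bound hηm.aestronglyMeasurable 1 (.of_forall hηa)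
  have iηw : Integrable (fun x => η x * w x) ν :=
    iw.bdd_mul hηm.aestronglyMeasurable (.of_forall hηa)
  have iFw : Integrable (fun x => F x * w x) ν :=
    iw.bdd_mul hF.aestronglyMeasurable (.of_forall hBF)
  have e1 : ∫ x, η x * (w x - m) ∂ν = ∫ x, η x * w x ∂ν - (∫ x, η x ∂ν) * m := by
    simp_rw [mul_sub]
    rw [integral_sub iηw (iη.mul_const m), integral_mul_const]
  have e2 : ∫ x, F x * (w x - m) ∂ν = ∫ x, f x * w x ∂ν := by
    have : ∫ x, f x * w x ∂ν = ∫ x, F x * w x ∂ν -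
        ((volume Ω).toReal⁻¹ * ∫ z, F z ∂ν) * ∫ x, w x ∂ν := by
      simp_rw [hf, sub_mul]
      rw [integral_sub iFw (iw.const_mul _), integral_const_mul]
    rw [this]
    simp_rw [mul_sub]
    rw [integral_sub iFw (iF.mul_const m), integral_mul_const, hm]
    ring
  have hbdπ : ∀ {g h : EuclideanSpace ℝ (Fin d) × EuclideanSpace ℝ (Fin d) → ℝ} {a b : ℝ},
      Measurable g → Measurable h → (∀ z, |g z| ≤ a) → (∀ z, |h z| ≤ b) →
      Integrable (fun z => g z * h z) π := fun {g h a b} hg hh ha hb =>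
    (Integrable.of_bound hh.aestronglyMeasurable b (.of_forall hb)).bdd_mul
      hg.aestronglyMeasurable (.of_forall ha)
  have hη2m : Measurable fun z : EuclideanSpace ℝ (Fin d) × EuclideanSpace ℝ (Fin d) => η z.2 :=
    hηm.comp measurable_snd
  have hw1m : Measurable fun z : EuclideanSpace ℝ (Fin d) × EuclideanSpace ℝ (Fin d) =>
    w z.1 - m := hw0m.comp measurable_fst
  have e3 : ∫ z, η z.2 * w z.1 ∂π = ∫ z, η z.2 * (w z.1 - m) ∂π + (∫ x, η x ∂μ) * m := by
    rw [← integral_snd_of_mem_couplings hπ hηm.aestronglyMeasurable, ← integral_mul_const,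
      ← integral_add (hbdπ hη2m hw1m (fun z => hηa z.2) (fun z => hw0B z.1))
        ((Integrable.of_bound hη2m.aestronglyMeasurable 1
          (.of_forall fun z => hηa z.2)).mul_const m)]
    exact integral_congr_ae (.of_forall fun z => by ring)
  have e4 : ∫ z, η z.2 * (w z.1 - m) ∂π = ∫ z, R z * (w z.1 - m) ∂π +
      κ * ∫ x, η x * (w x - m) ∂ν - P * (κ * ∫ x, F x * (w x - m) ∂ν) := by
    rw [← hfst (g := fun x => η x * (w x - m)) (hηm.mul hw0m),
      ← hfst (g := fun x => F x * (w x - m)) (hF.mul hw0m), ← integral_const_mul]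
    have j1 := hbdπ hRm hw1m hRB (fun z => hw0B z.1)
    have j2 := hbdπ (hηm.comp measurable_fst) hw1m (fun z => hηa z.1) (fun z => hw0B z.1)
    have j3 := (hbdπ (hF.comp measurable_fst) hw1m (fun z => hBF z.1)
      (fun z => hw0B z.1)).const_mul P
    have j4 : Integrable (fun z : EuclideanSpace ℝ (Fin d) × EuclideanSpace ℝ (Fin d) =>
      R z * (w z.1 - m) + η z.1 * (w z.1 - m)) π := j1.add j2
    refine Eq.trans ?_ (congrArg₂ (· - ·) (integral_add j1 j2) rfl)
    refine Eq.trans ?_ (integral_sub j4 j3)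
    exact integral_congr_ae (.of_forall fun z => by
      simp only [hR]
      ring)
  rw [e2] at e4
  have e5 : κ' * ∫ x, η x * w x ∂ν - ∫ z, η z.2 * w z.1 ∂π =
      (κ' - κ) * ∫ x, η x * (w x - m) ∂ν + P * (κ * ∫ x, f x * w x ∂ν) -
        ∫ z, R z * (w z.1 - m) ∂π := by
    rw [e3, e4, ← hκ', sub_mul, e1]
    ring
  rw [e5]
  linarith

end PairingEstimate

section DeterministicBound

theorem add_three_rpow_le {x y z p : ℝ} (hx : 0 ≤ x) (hy : 0 ≤ y) (hz : 0 ≤ z) (hp : 0 ≤ p) :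
    (x + y + z) ^ p ≤ 3 ^ p * (x ^ p + y ^ p + z ^ p) := by
  have h1 := Real.rpow_nonneg hx p
  have h2 := Real.rpow_nonneg hy p
  have h3 := Real.rpow_nonneg hz p
  have key : ∀ m, 0 ≤ m → x ≤ m → y ≤ m → z ≤ m → m ^ p ≤ x ^ p + y ^ p + z ^ p →
      (x + y + z) ^ p ≤ 3 ^ p * (x ^ p + y ^ p + z ^ p) := fun m hm hxm hym hzm h => by
    calc (x + y + z) ^ p ≤ (3 * m) ^ p := Real.rpow_le_rpow (by positivity) (by linarith) hp
      _ = 3 ^ p * m ^ p := Real.mul_rpow (by norm_num) hm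
      _ ≤ _ := by gcongr
  rcases le_total x y with hxy | hxy
  · rcases le_total y z with hyz | hyz
    · exact key z hz (hxy.trans hyz) hyz le_rfl (by linarith)
    · exact key y hy hxy le_rfl hyz (by linarith)
  · rcases le_total x z with hxz | hxz
    · exact key z hz hxz (hxy.trans hxz) le_rfl (by linarith)
    · exact key x hx le_rfl hxy hxz (by linarith)

variable {d : ℕ} {p : ℝ} {Ω : Set (EuclideanSpace ℝ (Fin d))}

theorem W_le_of_dual_le (hp : 1 < p) (hb : Bornology.IsBounded Ω) (hΩ : Ω.Nonempty)
    {μ lam : Measure (EuclideanSpace ℝ (Fin d))} [IsFiniteMeasure μ] [IsFiniteMeasure lam]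
    (hμ : μ Ωᶜ = 0) (hlam : lam Ωᶜ = 0) (hm : μ univ = lam univ) {A : ℝ}
    (hA : ∀ (φ ψ : EuclideanSpace ℝ (Fin d) → ℝ) (L₁ L₂ : ℝ≥0) (B₁ B₂ : ℝ), LipschitzWith L₁ φ →
      LipschitzWith L₂ ψ → (∀ x, |φ x| ≤ B₁) → (∀ x, |ψ x| ≤ B₂) →
      (∀ x y, ψ y - φ x ≤ ‖x - y‖ ^ p) → ∫ y, ψ y ∂μ - ∫ x, φ x ∂lam ≤ A) :
    W p μ lam ≤ A := by
  set c : EuclideanSpace ℝ (Fin d) → EuclideanSpace ℝ (Fin d) → ℝ :=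
    fun x y => min (dist x y) (diam Ω) ^ p with hcdef
  have hD : (0 : ℝ) ≤ diam Ω := diam_nonneg
  have hmin0 : ∀ x y : EuclideanSpace ℝ (Fin d), 0 ≤ min (dist x y) (diam Ω) := fun x y =>
    le_min dist_nonneg hD
  have hW : W p μ lam = transportCost c μ lam :=
    transportCost_congr (K := Ω) hμ hlam fun x hx y hy => by
      simp only [hcdef]
      rw [min_eq_left (dist_le_diam_of_mem hb hx hy)]
  have hc1 : ∀ y, LipschitzWith ((p * diam Ω ^ (p - 1)).toNNReal * 1) (fun x => c x y) :=
    fun y => lipschitzWith_rpow_of_le ((LipschitzWith.dist_left y).min_const (diam Ω))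
      (fun x => hmin0 x y) (fun x => min_le_right _ _) hp
  have hc2 : ∀ x, LipschitzWith ((p * diam Ω ^ (p - 1)).toNNReal * 1) (c x) :=
    fun x => lipschitzWith_rpow_of_le ((LipschitzWith.dist_right x).min_const (diam Ω))
      (fun y => hmin0 x y) (fun y => min_le_right _ _) hp
  have hKc : (closure Ω)ᶜ ⊆ Ωᶜ := compl_subset_compl.2 subset_closure
  obtain ⟨π, -, hπ, hdual⟩ := exists_optimal_coupling hb.isCompact_closure hΩ.closure
    (measure_mono_null hKc hμ) (measure_mono_null hKc hlam) hm hc1 hc2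
    (fun x y => Real.rpow_nonneg (hmin0 x y) p) (M := diam Ω ^ p)
    (fun x y => Real.rpow_le_rpow (hmin0 x y) (min_le_right _ _) (by linarith))
  refine le_of_forall_pos_le_add fun δ hδ => ?_
  obtain ⟨φ, ψ, hφ, hψ, ⟨B₁, hB₁⟩, ⟨B₂, hB₂⟩, hφψ, hle⟩ := hdual δ hδ
  have := hA φ ψ _ _ B₁ B₂ hφ hψ hB₁ hB₂ fun x y => (hφψ x y).trans (by
    rw [← dist_eq_norm]
    exact Real.rpow_le_rpow (hmin0 x y) (min_le_left _ _) (by linarith))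
  rw [hW, hπ]
  linarith

theorem exists_integral_residual_le (d : ℕ) {p : ℝ} (hp : 1 < p) : ∃ C : ℝ, 0 < C ∧
    ∀ (Ω Y : Set (EuclideanSpace ℝ (Fin d))) (u v η : EuclideanSpace ℝ (Fin d) → ℝ)
      (μ lam : Measure (EuclideanSpace ℝ (Fin d)))
      (π : Measure (EuclideanSpace ℝ (Fin d) × EuclideanSpace ℝ (Fin d))) (c r : ℝ) (L : ℝ≥0),
      IsFiniteMeasure π → π ∈ couplings μ lam →
      ENNReal.ofReal (1 / 2) • volume.restrict Ω ≤ lam → lam ≪ volume →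
      0 < c → 0 < r → ContDiff ℝ 2 η → (∀ x, infDist x Ωᶜ ≤ r → η x = 1) →
      (∀ x, ‖iteratedFDeriv ℝ 2 η x‖ ≤ c / r ^ 2) → LipschitzWith L u →
      (∀ x, ∀ y ∈ Y, u x - v y ≤ bdist p Ω x y ^ p) →
      (∀ᵐ z ∂π, z.2 ∈ Y ∧ u z.1 - v z.2 = bdist p Ω z.1 z.2 ^ p) →
      (∀ᵐ z ∂π, bdist p Ω z.1 z.2 ≤ r / 4) →
      Integrable (fun z : EuclideanSpace ℝ (Fin d) × EuclideanSpace ℝ (Fin d) =>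
        bdist p Ω z.1 z.2 ^ p) π →
      ∫ z, |η z.2 - η z.1 + p ^ (-(1 / (p - 1))) *
        ⟪vpow (gradient u z.1) ((p / (p - 1)) / p), gradient η z.1⟫| ^ p ∂π ≤
      C * c ^ p * (r ^ (-(2 * p)) * (∫ z, bdist p Ω z.1 z.2 ^ p ∂π) ^ ((d + 2 * p) / (d + p))) := by
  obtain ⟨C, hC, h⟩ := exists_dist_rpow_le_of_contact d hp
  refine ⟨C, hC, ?_⟩
  intro Ω Y u v η μ lam π c r L _ hπ hlam hac hc hr hη hη1 hη2 hu hle hcontact hsmall hint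
  have hp0 : 0 < p := by linarith
  have hdp : (0 : ℝ) < d + p := by positivity
  set I := ∫ z, bdist p Ω z.1 z.2 ^ p ∂π with hI
  have hb0 : ∀ z : EuclideanSpace ℝ (Fin d) × EuclideanSpace ℝ (Fin d),
    0 ≤ bdist p Ω z.1 z.2 ^ p := fun z => Real.rpow_nonneg (bdist_nonneg _ _) p
  have hI0 : 0 ≤ I := integral_nonneg hb0
  have hdiff : ∀ᵐ z ∂π, DifferentiableAt ℝ u z.1 :=
    ae_fst_of_mem_couplings hπ (hac.ae_le hu.ae_differentiableAt)
  have hpt : ∀ᵐ z ∂π, |η z.2 - η z.1 + p ^ (-(1 / (p - 1))) *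
        ⟪vpow (gradient u z.1) ((p / (p - 1)) / p), gradient η z.1⟫| ^ p ≤
      (c / r ^ 2) ^ p * (C * I ^ (p / (d + p))) * bdist p Ω z.1 z.2 ^ p := by
    filter_upwards [hdiff, hcontact, hsmall] with z hz ⟨hzY, hzc⟩ hzs
    have hcr : 0 ≤ c / r ^ 2 := by positivity
    rcases cutoff_taylor_of_contact hp hr hη hη1 hη2 hzs (fun x => hle x z.2 hzY) hzc hz with
      h0 | ⟨h1, h2, h3⟩
    · rw [h0, abs_zero, Real.zero_rpow hp0.ne']
      exact mul_nonneg (mul_nonneg (Real.rpow_nonneg hcr p)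
        (mul_nonneg hC.le (Real.rpow_nonneg hI0 _))) (hb0 z)
    · have h4 := h Ω Y u v μ lam π ‹_› hπ hlam hle hcontact hint z.1 z.2 hzY hzc h1 h2
      have hd0 : 0 ≤ dist z.1 z.2 := dist_nonneg
      calc _ ≤ (c / r ^ 2 * dist z.1 z.2 ^ 2) ^ p := Real.rpow_le_rpow (abs_nonneg _) h3 hp0.le
        _ = (c / r ^ 2) ^ p * dist z.1 z.2 ^ p * dist z.1 z.2 ^ p := by
          rw [Real.mul_rpow hcr (by positivity), sq (dist _ _), Real.mul_rpow hd0 hd0, mul_assoc]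
        _ ≤ _ := by
          rw [h1]
          exact mul_le_mul_of_nonneg_right
            (mul_le_mul_of_nonneg_left h4 (Real.rpow_nonneg hcr p)) (Real.rpow_nonneg hd0 p)
  have hexp : I ^ (p / (d + p)) * I = I ^ ((d + 2 * p) / (d + p)) := by
    rw [← Real.rpow_add_one' hI0 (by positivity)]
    congr 1
    field_simp
    ring
  have hcr : (c / r ^ 2) ^ p = c ^ p * r ^ (-(2 * p)) := by
    rw [div_eq_mul_inv, Real.mul_rpow hc.le (by positivity), Real.rpow_neg hr.le,
      Real.inv_rpow (by positivity), ← Real.rpow_natCast r 2, ← Real.rpow_mul hr.le]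
    norm_num
  calc _ ≤ ∫ z, (c / r ^ 2) ^ p * (C * I ^ (p / (d + p))) * bdist p Ω z.1 z.2 ^ p ∂π :=
        integral_mono_of_nonneg (.of_forall fun _ => by positivity) (hint.const_mul _) hpt
    _ = _ := by
      rw [integral_const_mul, ← hI, ← hexp, hcr]
      ring

theorem integral_cutoff_pos (hb : Bornology.IsBounded Ω) (hc : Convex ℝ Ω) (h0 : volume Ω ≠ 0)
    {η : EuclideanSpace ℝ (Fin d) → ℝ} (hηc : Continuous η) (hη : ∀ x, η x ∈ Icc (0 : ℝ) 1)
    {r : ℝ} (hr : 0 < r) (hd : 1 ≤ d) (hη1 : ∀ x, infDist x Ωᶜ ≤ r → η x = 1) :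
    0 < ∫ x in Ω, η x := by
  have : Nonempty (Fin d) := ⟨⟨0, hd⟩⟩
  have hη0 : ∀ x, 0 ≤ η x := fun x => (hη x).1
  have hint : (interior Ω).Nonempty := nonempty_iff_ne_empty.2 fun h =>
    h0 (by rw [← volume_interior_of_convex hc, h, measure_empty])
  refine (integral_nonneg hη0).lt_of_ne fun h => ?_
  rw [← restrict_interior_of_convex hc, eq_comm, integral_eq_zero_iff_of_nonneg hη0
    ((integrableOn_of_continuous_isBounded hb hηc).mono_set interior_subset)] at h
  have hzero : EqOn η 0 (closure (interior Ω)) :=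
    (Measure.eqOn_open_of_ae_eq h isOpen_interior hηc.continuousOn continuousOn_const).closure hηc
      continuous_const
  rw [hc.closure_interior_eq_closure_of_nonempty_interior hint] at hzero
  have hfr : (frontier Ω).Nonempty := by
    refine nonempty_frontier_iff.2 ⟨hint.mono interior_subset, fun h => ?_⟩
    exact NormedSpace.unbounded_univ ℝ (EuclideanSpace ℝ (Fin d)) (h ▸ hb)
  obtain ⟨y, hy⟩ := hfr
  have hy0 : infDist y Ωᶜ = 0 :=
    infDist_zero_of_mem_closure (frontier_compl Ω ▸ hy).1
  have h1 := hη1 y (hy0 ▸ hr.le)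
  have h2 := hzero hy.1
  simp [h1] at h2

end DeterministicBound

section MainBound

theorem scaled_sum_rpow_le {p a D θ e s H A J : ℝ} (hp : 0 < p) (ha : 0 ≤ a) (hD : 0 ≤ D)
    (hθ : 0 ≤ θ) (he : 0 ≤ e) (hs : 0 ≤ s) (hH : 0 ≤ H) (hA : 0 ≤ A) (hJ : 0 ≤ J)
    (hsA : s ^ p = A * J) :
    (a * D * (θ * e + s) + 2 * H) ^ p ≤
      3 ^ p * ((a ^ p * (1 + A) + 2 ^ p) * (D ^ p * (θ ^ p * e ^ p + J) + H ^ p)) := by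
  have h1 : (a * D * (θ * e)) ^ p = a ^ p * (D ^ p * (θ ^ p * e ^ p)) := by
    rw [Real.mul_rpow (by positivity) (by positivity), Real.mul_rpow ha hD,
      Real.mul_rpow hθ he, mul_assoc]
  have h2 : (a * D * s) ^ p = a ^ p * A * (D ^ p * J) := by
    rw [Real.mul_rpow (by positivity) hs, Real.mul_rpow ha hD, hsA]
    ring
  have h3 : (2 * H) ^ p = 2 ^ p * H ^ p := Real.mul_rpow zero_le_two hH
  have h4 : a * D * (θ * e + s) + 2 * H = a * D * (θ * e) + a * D * s + 2 * H := by ring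
  rw [h4]
  refine (add_three_rpow_le (by positivity) (by positivity) (by positivity) hp.le).trans
    (mul_le_mul_of_nonneg_left ?_ (by positivity))
  rw [h1, h2, h3, mul_add (D ^ p)]
  generalize hx1 : D ^ p * (θ ^ p * e ^ p) = x₁
  generalize hx2 : D ^ p * J = x₂
  generalize hx3 : H ^ p = x₃
  generalize hy1 : a ^ p = y₁
  generalize hy3 : (2 : ℝ) ^ p = y₃
  have x1 : 0 ≤ x₁ := by rw [← hx1]; positivity
  have x2 : 0 ≤ x₂ := by rw [← hx2]; positivity
  have x3 : 0 ≤ x₃ := by rw [← hx3]; positivity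
  have y1 : 0 ≤ y₁ := by rw [← hy1]; positivity
  have y3 : 0 ≤ y₃ := by rw [← hy3]; positivity
  have h : 0 ≤ y₁ * x₂ + y₁ * x₃ + y₁ * A * (x₁ + x₃) + y₃ * (x₁ + x₂) := by positivity
  linarith

theorem add_add_le_of_le {ε e I W' Q T X : ℝ} (hI : 0 ≤ I) (hW : 0 ≤ W') (hQ : 0 ≤ Q) (hT : 0 ≤ T)
    (hε : 0 ≤ ε) (he : 1 ≤ e) (hX : X ≤ Q * (e * T)) :
    ε * I + W' + X ≤ (1 + Q) * (ε * I + e * (W' + T)) := by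
  have h1 : W' ≤ e * W' := le_mul_of_one_le_left hW he
  have h2 : 0 ≤ Q * (ε * I) + Q * (e * W') + e * T := by positivity
  linarith

theorem exists_deterministic_bound (d : ℕ) (hd : 1 ≤ d) {p : ℝ} (hp : 1 < p) {c : ℝ} (hc : 0 < c) :
    ∃ C : ℝ, 0 < C ∧ ∀ (Ω : Set (EuclideanSpace ℝ (Fin d))), Convex ℝ Ω → Bornology.IsBounded Ω →
    volume Ω ≠ 0 → ∀ (r : ℝ), 0 < r →
    ∀ η : EuclideanSpace ℝ (Fin d) → ℝ, ContDiff ℝ 2 η → (∀ x, η x ∈ Icc (0:ℝ) 1) →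
      (∀ x, infDist x Ωᶜ ≤ r → η x = 1) →
      (∀ x, ‖fderiv ℝ η x‖ ≤ c / r) →
      (∀ x, ‖iteratedFDeriv ℝ 2 η x‖ ≤ c / r ^ 2) →
    ∀ (μ : Measure (EuclideanSpace ℝ (Fin d))), IsFiniteMeasure μ → μ Ωᶜ = 0 →
    ∀ Y : Set (EuclideanSpace ℝ (Fin d)), IsClosed Y → Y ⊆ closure Ω → μ Yᶜ = 0 →
      (volume Ω).toReal / 2 ≤ (μ Ω).toReal → (μ Ω).toReal ≤ 2 * (volume Ω).toReal →
    ∀ lam : Measure (EuclideanSpace ℝ (Fin d)), lam = (μ Ω / volume Ω) • volume.restrict Ω →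
    ∀ v : EuclideanSpace ℝ (Fin d) → ℝ, IsDualOpt p Ω (closure Ω) Y v μ lam →
    ∀ u : EuclideanSpace ℝ (Fin d) → ℝ, u = Qb p Ω Y v →
    ∀ ℓ : ℝ, ℓ = (oscOn Y v + supInfDist Ω Y ^ p) ^ (1 / p) →
    4 * ℓ ≤ r →
    ∀ ε : ℝ, ε ∈ Ioo (0:ℝ) 1 →
      W p μ lam - Wb p Ω μ lam ≤
        C * (ε * Wb p Ω μ lam + ε ^ (1 - p) *
          (W p
              (ENNReal.ofReal ((∫ x in Ω, η x ∂μ) / (∫ x in Ω, η x)) •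
                ((volume.restrict Ω).withDensity fun x => ENNReal.ofReal (η x)))
              (μ.withDensity fun x => ENNReal.ofReal (η x)) +
            diam Ω ^ p *
              (|((∫ x in Ω, η x ∂μ) / (μ Ω).toReal) /
                  ((∫ x in Ω, η x) / (volume Ω).toReal) - 1| ^ p * (∫ x in Ω, η x ^ p) +
                r ^ (-(2 * p)) * Wb p Ω μ lam ^ ((d + 2 * p) / (d + p))) +
            HnegNorm p Ω
              (fun x => ⟪vpow (gradient u x) ((p / (p - 1)) / p), gradient η x⟫ -
                (volume Ω).toReal⁻¹ *
                  ∫ z in Ω, ⟪vpow (gradient u z) ((p / (p - 1)) / p), gradient η z⟫) ^ p)) := by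
  obtain ⟨C₁, hC₁, hres⟩ := exists_integral_residual_le d hp
  have hp0 : 0 < p := by linarith
  have hdp : (0 : ℝ) < d + p := by positivity
  set a : ℝ := 2 * 2 ^ (d * (p - 1) / p) with ha
  have ha0 : 0 < a := by positivity
  set M : ℝ := a ^ p * (1 + C₁ * c ^ p) + 2 ^ p with hM
  have hM0 : 0 < M := by positivity
  set k : ℝ := 1 / 2 * (1 / 2 - (1 / 2 : ℝ) ^ p) with hk
  have hk0 : 0 < k := mul_pos (by norm_num) (half_sub_half_rpow_pos hp)
  refine ⟨3 ^ (p - 1) * (1 + p ^ p * (3 ^ p * M) * k ^ (1 - p)), by positivity, ?_⟩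
  intro Ω hconv hb h0 r hr η hη hη01 hη1 hηd hη2 μ hfin hμ Y hY hYΩ hμY hm1 hm2 lam hlam v hv u hu
    ℓ hℓ hℓr ε hε
  have hΩ : Ω.Nonempty := nonempty_iff_ne_empty.2 fun h => h0 (by rw [h, measure_empty])
  have hvt : volume Ω ≠ ∞ := hb.measure_lt_top.ne
  have hV : 0 < (volume Ω).toReal := ENNReal.toReal_pos h0 hvt
  have hμt : μ Ω ≠ ∞ := measure_ne_top _ _
  have hμΩ : 0 < (μ Ω).toReal := by linarith
  have hfinν : IsFiniteMeasure (volume.restrict Ω) := ⟨by simpa using hb.measure_lt_top⟩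
  have hηc : Continuous η := hη.continuous
  have hηa : ∀ x, |η x| ≤ 1 := fun x => abs_le.2 ⟨by linarith [(hη01 x).1], (hη01 x).2⟩
  have hrμ : μ.restrict Ω = μ := Measure.restrict_eq_self_of_ae_mem hμ
  set κ : ℝ := (μ Ω).toReal / (volume Ω).toReal with hκ
  have hκ1 : 1 / 2 ≤ κ := by rw [hκ, le_div_iff₀ hV]; linarith
  have hκ2 : κ ≤ 2 := by rw [hκ, div_le_iff₀ hV]; linarith
  have hκe : μ Ω / volume Ω = ENNReal.ofReal κ := by
    rw [hκ, ← ENNReal.toReal_div, ENNReal.ofReal_toReal (ENNReal.div_ne_top hμt h0)]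
  rw [hκe] at hlam
  have hflam : IsFiniteMeasure lam := by
    rw [hlam]; exact Measure.smul_finite _ ENNReal.ofReal_ne_top
  have hνΩ : volume.restrict Ω Ωᶜ = 0 := by
    rw [← restrict_interior_of_convex hconv,
      Measure.restrict_apply₀' isOpen_interior.nullMeasurableSet]
    exact measure_mono_null (t := ∅) (fun x hx => hx.1 (interior_subset hx.2)) measure_empty
  have hlamΩ : lam Ωᶜ = 0 := by rw [hlam]; simp [hνΩ]
  have hm : μ univ = lam univ := by
    rw [← hrμ, hlam, ← hκe]
    simp [ENNReal.div_mul_cancel h0 hvt]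
  have hYn : Y.Nonempty := nonempty_iff_ne_empty.2 fun h => by
    rw [h, compl_empty] at hμY
    rw [measure_mono_null (subset_univ Ω) hμY] at hμΩ
    simp at hμΩ
  have hlamν : ENNReal.ofReal (1 / 2) • volume.restrict Ω ≤ lam := by
    rw [hlam]
    refine Measure.le_iff'.2 fun s => ?_
    simp only [Measure.smul_apply, smul_eq_mul]
    exact mul_le_mul_left (ENNReal.ofReal_le_ofReal hκ1) _
  have hac : lam ≪ volume := by
    rw [hlam]
    exact Measure.absolutelyContinuous_of_le Measure.restrict_le_self |>.smul_left _
  obtain ⟨π, hπ, hWb, ⟨L, hL⟩, hle, hleℓ, hcon⟩ :=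
    exists_boundary_coupling hd hp hb hΩ hY hYΩ hYn hμ hlamΩ hμY hm hv
  rw [← hu] at hL hle hleℓ hcon
  have hfπ : IsFiniteMeasure π := isFiniteMeasure_of_mem_couplings hπ
  have hD := infDist_compl_le_diam hd hb
  have hb0 : ∀ z : EuclideanSpace ℝ (Fin d) × EuclideanSpace ℝ (Fin d),
    0 ≤ bdist p Ω z.1 z.2 ^ p := fun z => Real.rpow_nonneg (bdist_nonneg _ _) p
  obtain ⟨Lb, hLb⟩ := exists_lipschitzWith_bdist_rpow hp hD
  have hint : Integrable (fun z : EuclideanSpace ℝ (Fin d) × EuclideanSpace ℝ (Fin d) =>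
      bdist p Ω z.1 z.2 ^ p) π :=
    integrable_of_continuous_bounded (LipschitzWith.uncurry hLb fun x => by
      simpa only [bdist_comm x] using hLb x).continuous (B := 2 * diam Ω ^ p) fun z => by
        rw [abs_of_nonneg (hb0 z)]; exact bdist_rpow_le hp hD z.1 z.2
  have hsmall : ∀ᵐ z ∂π, bdist p Ω z.1 z.2 ≤ r / 4 := by
    filter_upwards [hcon] with z ⟨h1, _, h2, h3⟩
    have h4 := hleℓ z.1 h1 z.2 h2
    rw [h3] at h4
    have h5 := Real.rpow_le_rpow (hb0 z) h4 (by positivity : 0 ≤ 1 / p)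
    rw [← Real.rpow_mul (bdist_nonneg _ _), mul_one_div_cancel hp0.ne', Real.rpow_one, ← hℓ] at h5
    linarith
  have hcon' : ∀ᵐ z ∂π, z.2 ∈ Y ∧ u z.1 - v z.2 = bdist p Ω z.1 z.2 ^ p :=
    hcon.mono fun z hz => hz.2.2
  set I := ∫ z, bdist p Ω z.1 z.2 ^ p ∂π with hI
  have hI0 : 0 ≤ I := integral_nonneg hb0
  set F : EuclideanSpace ℝ (Fin d) → ℝ :=
    fun x => ⟪vpow (gradient u x) ((p / (p - 1)) / p), gradient η x⟫ with hF
  have hα : 0 < (p / (p - 1)) / p := div_pos (div_pos hp0 (by linarith)) hp0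
  have hFm : Measurable F :=
    (measurable_vpow.comp (measurable_gradient u)).inner (measurable_gradient η)
  have hgrad : ∀ x, ‖gradient η x‖ ≤ c / r := fun x => by
    rw [gradient, LinearIsometryEquiv.norm_map]; exact hηd x
  have hFB : ∀ x, |F x| ≤ L ^ ((p / (p - 1)) / p) * (c / r) := fun x => by
    refine (abs_real_inner_le_norm _ _).trans ?_
    rw [norm_vpow _ hα]
    exact mul_le_mul (Real.rpow_le_rpow (norm_nonneg _) (norm_gradient_le hL x) hα.le) (hgrad x)
      (norm_nonneg _) (by positivity)
  set P : ℝ := p ^ (-(1 / (p - 1))) with hP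
  have hP0 : 0 ≤ P := by positivity
  have hP1 : P ≤ 1 := Real.rpow_le_one_of_one_le_of_nonpos hp.le
    (neg_nonpos.2 (one_div_nonneg.2 (by linarith)))
  set J := r ^ (-(2 * p)) * I ^ ((d + 2 * p) / (d + p)) with hJ
  have hJ0 : 0 ≤ J := by positivity
  set S := C₁ * c ^ p * J with hS
  have hS0 : 0 ≤ S := by positivity
  have hRS : ∫ z, |η z.2 - η z.1 + P * F z.1| ^ p ∂π ≤ S :=
    hres Ω Y u v η μ lam π c r L hfπ hπ hlamν hac hc hr hη hη1 hη2 hL hle hcon' hsmall hint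
  have hEpos : 0 < ∫ x in Ω, η x := integral_cutoff_pos hb hconv h0 hηc hη01 hr hd hη1
  have hEμ : 0 ≤ ∫ x in Ω, η x ∂μ := integral_nonneg fun x => (hη01 x).1
  set κ' := (∫ x in Ω, η x ∂μ) / (∫ x in Ω, η x) with hκ'
  have hκ'0 : 0 ≤ κ' := div_nonneg hEμ hEpos.le
  have hκ'e : κ' * (∫ x in Ω, η x) = ∫ x, η x ∂μ := by
    rw [hκ', div_mul_cancel₀ _ hEpos.ne', hrμ]
  set θ := |((∫ x in Ω, η x ∂μ) / (μ Ω).toReal) / ((∫ x in Ω, η x) / (volume Ω).toReal) - 1| with hθ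
  have hθ0 : 0 ≤ θ := abs_nonneg _
  have hκθ : |κ' - κ| ≤ 2 * θ := by
    have : κ' - κ = κ * (((∫ x in Ω, η x ∂μ) / (μ Ω).toReal) /
        ((∫ x in Ω, η x) / (volume Ω).toReal) - 1) := by
      rw [hκ', hκ]
      field_simp
    rw [this, abs_mul, abs_of_nonneg (by linarith)]
    exact mul_le_mul_of_nonneg_right hκ2 hθ0
  set Eη := ∫ x in Ω, η x ^ p with hEη
  have hEη0 : 0 ≤ Eη := integral_nonneg fun x => Real.rpow_nonneg (hη01 x).1 _
  set H := HnegNorm p Ω (fun x => F x - (volume Ω).toReal⁻¹ * ∫ z in Ω, F z) with hH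
  have hH0 : 0 ≤ H := by
    refine negativeSobolev_nonneg hconv hb h0 hp (hFm.sub_const _)
      (B := L ^ ((p / (p - 1)) / p) * (c / r) + |(volume Ω).toReal⁻¹ * ∫ z in Ω, F z|)
      (.of_forall fun x => (abs_sub _ _).trans (by linarith [hFB x])) ?_
    have iF : Integrable F (volume.restrict Ω) :=
      Integrable.of_bound hFm.aestronglyMeasurable _ (.of_forall hFB)
    rw [integral_sub iF (integrable_const _), integral_const, measureReal_restrict_apply_univ,
      Measure.real, smul_eq_mul, mul_inv_cancel_left₀ hV.ne', sub_self]
  have hdiam : (0 : ℝ) ≤ diam Ω := diam_nonneg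
  set N := a * diam Ω * (θ * Eη ^ (1 / p) + S ^ (1 / p)) + 2 * H with hN
  have hN0 : 0 ≤ N := by positivity
  set W' := W p
    (ENNReal.ofReal κ' • ((volume.restrict Ω).withDensity fun x => ENNReal.ofReal (η x)))
    (μ.withDensity fun x => ENNReal.ofReal (η x)) with hW'
  have hW'0 : 0 ≤ W' := transportCost_nonneg _ _ _
  have hfin1 : transportCostE (fun x y => dist x y ^ p)
      (ENNReal.ofReal κ' • ((volume.restrict Ω).withDensity fun x => ENNReal.ofReal (η x)))
      (μ.withDensity fun x => ENNReal.ofReal (η x)) ≠ ∞ := by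
    have iη : ∀ (m : Measure (EuclideanSpace ℝ (Fin d))) [IsFiniteMeasure m], Integrable η m :=
      fun m _ => Integrable.of_bound hηc.aestronglyMeasurable 1 (.of_forall hηa)
    have hη0 : ∀ x, 0 ≤ η x := fun x => (hη01 x).1
    have hf1 := isFiniteMeasure_withDensity_of_le (π := volume.restrict Ω) fun x => (hη01 x).2
    have hf2 := isFiniteMeasure_withDensity_of_le (π := μ) fun x => (hη01 x).2
    have hf3 : IsFiniteMeasure (ENNReal.ofReal κ' •
        ((volume.restrict Ω).withDensity fun x => ENNReal.ofReal (η x))) :=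
      Measure.smul_finite _ ENNReal.ofReal_ne_top
    refine transportCostE_ne_top (K := Ω) ?_ ?_ ?_ (M := diam Ω ^ p) fun x hx y hy =>
      Real.rpow_le_rpow dist_nonneg (dist_le_diam_of_mem hb hx hy) hp0.le
    · rw [Measure.smul_apply, withDensity_apply _ .univ, withDensity_apply _ .univ,
        Measure.restrict_univ, Measure.restrict_univ,
        ← ofReal_integral_eq_lintegral_ofReal (iη _) (.of_forall hη0),
        ← ofReal_integral_eq_lintegral_ofReal (iη _) (.of_forall hη0), smul_eq_mul,
        ← ENNReal.ofReal_mul hκ'0, hκ'e]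
    · exact (((withDensity_absolutelyContinuous _ _).smul_left _).ae_le hνΩ)
    · exact (withDensity_absolutelyContinuous _ _).ae_le hμ
  have hmain : W p μ lam ≤ I + 3 ^ (p - 1) * (ε * I + W' +
      (p * N) ^ p * (ε / 2 * (1 / 2 - (1 / 2 : ℝ) ^ p)) ^ (1 - p)) :=
    W_le_of_dual_le hp hb hΩ hμ hlamΩ hm fun φ ψ L₁ L₂ B₁ B₂ hφ hψ hφB hψB hφψ =>
      dual_le_of_negative_sobolev hp
        (Measure.absolutelyContinuous_of_le Measure.restrict_le_self) hlamν hπ hηc hη01 hint hb0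
        (hsmall.mono fun z hz => cutoff_mul_dist_rpow_le hp hη1 (by linarith)) hN0
        (fun w K B hw hB => mean_zero_pairing_le hp hconv hb h0 hπ (by linarith) hκ2 hlam hηc hη01
          hFm hFB hP0 hP1 hRS hκ'e hκθ hw hB) hκ'0 hfin1 hφ hψ hφB hψB hφψ hε
  rw [hWb]
  have hrpow : ∀ {x : ℝ}, 0 ≤ x → (x ^ (1 / p)) ^ p = x := fun {x} hx => by
    rw [← Real.rpow_mul hx, one_div_mul_cancel hp0.ne', Real.rpow_one]
  have hNp : N ^ p ≤ 3 ^ p * (M * (diam Ω ^ p * (θ ^ p * Eη + J) + H ^ p)) := by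
    have h := scaled_sum_rpow_le hp0 ha0.le hdiam hθ0 (Real.rpow_nonneg hEη0 (1 / p))
      (Real.rpow_nonneg hS0 (1 / p)) hH0 (A := C₁ * c ^ p) (by positivity) hJ0
      ((hrpow hS0).trans hS)
    rwa [hrpow hEη0] at h
  have hNB : (p * N) ^ p * (ε / 2 * (1 / 2 - (1 / 2 : ℝ) ^ p)) ^ (1 - p) ≤
      p ^ p * (3 ^ p * M) * k ^ (1 - p) * (ε ^ (1 - p) *
        (diam Ω ^ p * (θ ^ p * Eη + J) + H ^ p)) := by
    have h1 : ε / 2 * (1 / 2 - (1 / 2 : ℝ) ^ p) = ε * k := by rw [hk]; ring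
    rw [h1, Real.mul_rpow hε.1.le hk0.le, Real.mul_rpow hp0.le hN0]
    have h2 : 0 ≤ p ^ p * (ε ^ (1 - p) * k ^ (1 - p)) :=
      mul_nonneg (by positivity) (mul_nonneg (Real.rpow_nonneg hε.1.le _) (by positivity))
    linear_combination p ^ p * (ε ^ (1 - p) * k ^ (1 - p)) * hNp
  have hε1 : 1 ≤ ε ^ (1 - p) :=
    Real.one_le_rpow_of_pos_of_le_one_of_nonpos hε.1 hε.2.le (by linarith)
  rw [add_assoc W', mul_assoc (3 ^ (p - 1)), sub_le_iff_le_add']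
  refine hmain.trans (add_le_add_right (mul_le_mul_of_nonneg_left ?_ (by positivity)) _)
  exact add_add_le_of_le hI0 hW'0 (by positivity) (by positivity) hε.1.le hε1 hNB

end MainBound

theorem transportCost_zero {X : Type*} [MeasurableSpace X] (c : X → X → ℝ) :
    transportCost c (0 : Measure X) 0 = 0 := by
  have : transportCostE c (0 : Measure X) 0 ≤ 0 :=
    (iInf₂_le (0 : Measure (X × X)) (by simp [couplings])).trans (by simp)
  simp [transportCost, le_antisymm this zero_le]

theorem HnegNorm_nonneg_of_volume_eq_zero {d : ℕ} {p : ℝ} {Ω : Set (EuclideanSpace ℝ (Fin d))}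
    (h0 : volume Ω = 0) (f : EuclideanSpace ℝ (Fin d) → ℝ) : 0 ≤ HnegNorm p Ω f := by
  refine Real.sSup_nonneg ?_
  rintro _ ⟨φ, -, -, rfl⟩
  simp [Measure.restrict_eq_zero.2 h0]

/-- main deterministic bound, Theorem 3.5: for `d ≥ 1`, `p > 1`, `c > 0`
and a bounded convex `Ω₀`, there is a constant `C = C(c,d,p,Ω₀)`, invariant under dilations
of `Ω₀`, such that for every dilation `Ω = t • Ω₀`, every cut-off `η` as in (1), every
measure `μ` as in (2) with `λ := (μ(Ω)/|Ω|)χ_Ω`, every dual optimizer `v` as in (3) with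
`u := Q_{b_Ω^p}(v)` and `ℓ := (osc_Y(v) + d(Ω,Y)^p)^{1/p}`, if `r ≥ 4ℓ` then for every
`ε ∈ (0,1)`,
`W^p_Ω(μ,λ) − Wb^p_Ω(μ,λ) ≤ C [ε Wb^p_Ω(μ,λ) + ε^{1-p}(W^p_Ω((∫η dμ/∫η)η, ημ)`
`+ diam(Ω)^p (|⨍η dμ/⨍η − 1|^p ∫η^p + r^{-2p} Wb^p_Ω(μ,λ)^{(d+2p)/(d+p)})`
`+ ‖(∇u)^{(p'/p)}·∇η − ⨍_Ω (∇u)^{(p'/p)}·∇η‖^p_{H^{-1,p}(Ω)})]`. -/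
theorem main_deterministic_bound
    (d : ℕ) (hd : 1 ≤ d) (p : ℝ) (hp : 1 < p) (c : ℝ) (hc : 0 < c)
    (Ω₀ : Set (EuclideanSpace ℝ (Fin d))) (hconv : Convex ℝ Ω₀)
    (hbdd : Bornology.IsBounded Ω₀) :
    ∃ C : ℝ, 0 < C ∧
    ∀ (t : ℝ), 0 < t → ∀ Ω : Set (EuclideanSpace ℝ (Fin d)), Ω = t • Ω₀ →
    ∀ (r : ℝ), 0 < r →
    -- (1) the cut-off η
    ∀ η : EuclideanSpace ℝ (Fin d) → ℝ, ContDiff ℝ 2 η → (∀ x, η x ∈ Icc (0:ℝ) 1) →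
      (∀ x, infDist x Ωᶜ ≤ r → η x = 1) →
      (∀ x, 2 * r ≤ infDist x Ωᶜ → η x = 0) →
      (∀ x, ‖fderiv ℝ η x‖ ≤ c / r) →
      (∀ x, ‖iteratedFDeriv ℝ 2 η x‖ ≤ c / r ^ 2) →
    -- (2) the measure μ, supported on Y ⊆ cl Ω, and λ := (μ(Ω)/|Ω|) χ_Ω
    ∀ (μ : Measure (EuclideanSpace ℝ (Fin d))), IsFiniteMeasure μ → μ Ωᶜ = 0 →
    ∀ Y : Set (EuclideanSpace ℝ (Fin d)), IsClosed Y → Y ⊆ closure Ω → μ Yᶜ = 0 →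
      (volume Ω).toReal / 2 ≤ (μ Ω).toReal → (μ Ω).toReal ≤ 2 * (volume Ω).toReal →
    ∀ lam : Measure (EuclideanSpace ℝ (Fin d)), lam = (μ Ω / volume Ω) • volume.restrict Ω →
    -- (3) a dual optimizer v, with u := Q_{b_Ω^p}(v) and ℓ
    ∀ v : EuclideanSpace ℝ (Fin d) → ℝ, IsDualOpt p Ω (closure Ω) Y v μ lam →
    ∀ u : EuclideanSpace ℝ (Fin d) → ℝ, u = Qb p Ω Y v →
    ∀ ℓ : ℝ, ℓ = (oscOn Y v + supInfDist Ω Y ^ p) ^ (1 / p) →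
    4 * ℓ ≤ r →
    ∀ ε : ℝ, ε ∈ Ioo (0:ℝ) 1 →
      W p μ lam - Wb p Ω μ lam ≤
        C * (ε * Wb p Ω μ lam + ε ^ (1 - p) *
          (W p
              (ENNReal.ofReal ((∫ x in Ω, η x ∂μ) / (∫ x in Ω, η x)) •
                ((volume.restrict Ω).withDensity fun x => ENNReal.ofReal (η x)))
              (μ.withDensity fun x => ENNReal.ofReal (η x)) +
            diam Ω ^ p *
              (|((∫ x in Ω, η x ∂μ) / (μ Ω).toReal) /
                  ((∫ x in Ω, η x) / (volume Ω).toReal) - 1| ^ p * (∫ x in Ω, η x ^ p) +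
                r ^ (-(2 * p)) * Wb p Ω μ lam ^ ((d + 2 * p) / (d + p))) +
            HnegNorm p Ω
              (fun x => ⟪vpow (gradient u x) ((p / (p - 1)) / p), gradient η x⟫ -
                (volume Ω).toReal⁻¹ *
                  ∫ z in Ω, ⟪vpow (gradient u z) ((p / (p - 1)) / p), gradient η z⟫) ^ p)) := by
  obtain ⟨C, hC, h⟩ := exists_deterministic_bound d hd hp hc
  refine ⟨C, hC, ?_⟩
  intro t ht Ω hΩ r hr η hη hη01 hη1 _ hηd hη2 μ hfin hμ Y hY hYΩ hμY hm1 hm2 lam hlam v hv u hu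
    ℓ hℓ hℓr ε hε
  by_cases h0 : volume Ω = 0
  · have hμ0 : μ = 0 := by
      have h1 : μ Ω = 0 := by
        rw [h0] at hm2
        refine ((ENNReal.toReal_eq_zero_iff _).1
          (le_antisymm ?_ ENNReal.toReal_nonneg)).resolve_right (measure_ne_top _ _)
        simpa using hm2
      rw [← Measure.measure_univ_eq_zero, ← union_compl_self Ω]
      exact measure_union_null h1 hμ
    have hlam0 : lam = 0 := by rw [hlam, Measure.restrict_eq_zero.2 h0, smul_zero]
    have hW : W p μ lam = 0 := by rw [hμ0, hlam0]; exact transportCost_zero _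
    have hWb : 0 ≤ Wb p Ω μ lam := transportCost_nonneg _ _ _
    have hD : (0 : ℝ) ≤ diam Ω := diam_nonneg
    have hE : 0 ≤ ∫ x in Ω, η x ^ p := integral_nonneg fun x => Real.rpow_nonneg (hη01 x).1 _
    rw [hW, zero_sub]
    refine (neg_nonpos.2 hWb).trans (mul_nonneg hC.le (add_nonneg (mul_nonneg hε.1.le hWb)
      (mul_nonneg (Real.rpow_nonneg hε.1.le _) (add_nonneg (add_nonneg (transportCost_nonneg _ _ _)
      (mul_nonneg (by positivity) (add_nonneg (mul_nonneg (by positivity) hE) ?_)))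
      (Real.rpow_nonneg (HnegNorm_nonneg_of_volume_eq_zero h0 _) _)))))
    exact mul_nonneg (Real.rpow_nonneg hr.le _) (Real.rpow_nonneg hWb _)
  · subst hΩ
    exact h _ (hconv.smul t) (hbdd.smul₀ t) h0 r hr η hη hη01 hη1 hηd hη2 μ hfin hμ Y hY hYΩ hμY
      hm1 hm2 lam hlam v hv u hu ℓ hℓ hℓr ε hε

end
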